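/- Let f : ℂ → ℂ be the evaluation map of a polynomial of degree d ≥ 2 whose Julia set J_f is connected and locally connected. Then there is no wandering continuum in J_f: for every compact connected subset C ⊆ J_f containing at least two distinct points, there exist natural numbers m ≠ n such that f^[m](C) ∩ f^[n](C) ≠ ∅. -/

import Mathlib

open Function Set Topology

/-- The filled Julia set of `f`: points with bounded forward orbit. -/
def filledJulia (f : ℂ → ℂ) : Set ℂ :=
  {z : ℂ | Bornology.IsBounded (Set.range fun n => f^[n] z)}


/-- `h` has a continuous logarithm on `E`. -/
def HasLog (E : Set ℂ) (h : ℂ → ℂ) : Prop :=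
  ∃ G : ℂ → ℂ, ContinuousOn G E ∧ ∀ z ∈ E, Complex.exp (G z) = h z

theorem HasLog.mono {E F : Set ℂ} {h : ℂ → ℂ} (H : HasLog E h) (hF : F ⊆ E) : HasLog F h := by
  obtain ⟨G, h1, h2⟩ := H
  exact ⟨G, h1.mono hF, fun z hz => h2 z (hF hz)⟩

theorem HasLog.congr {E : Set ℂ} {h k : ℂ → ℂ} (H : HasLog E h) (hk : ∀ z ∈ E, k z = h z) :
    HasLog E k := by
  obtain ⟨G, h1, h2⟩ := H
  exact ⟨G, h1, fun z hz => (h2 z hz).trans (hk z hz).symm⟩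

theorem HasLog.mul {E : Set ℂ} {h k : ℂ → ℂ} (H : HasLog E h) (H' : HasLog E k) :
    HasLog E (fun z => h z * k z) := by
  obtain ⟨G, h1, h2⟩ := H
  obtain ⟨G', h1', h2'⟩ := H'
  refine ⟨fun z => G z + G' z, h1.add h1', fun z hz => ?_⟩
  simp only [Complex.exp_add, h2 z hz, h2' z hz]

theorem HasLog.inv {E : Set ℂ} {h : ℂ → ℂ} (H : HasLog E h) : HasLog E (fun z => (h z)⁻¹) := by
  obtain ⟨G, h1, h2⟩ := H
  refine ⟨fun z => - G z, h1.neg, fun z hz => ?_⟩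
  simp only [Complex.exp_neg, h2 z hz]

theorem HasLog.div {E : Set ℂ} {h k : ℂ → ℂ} (H : HasLog E h) (H' : HasLog E k) :
    HasLog E (fun z => h z / k z) :=
  (H.mul H'.inv).congr (fun z _ => div_eq_mul_inv _ _)

theorem hasLog_const (E : Set ℂ) {c : ℂ} (hc : c ≠ 0) : HasLog E (fun _ => c) :=
  ⟨fun _ => Complex.log c, continuousOn_const, fun _ _ => Complex.exp_log hc⟩

theorem hasLog_of_slit {E : Set ℂ} {h : ℂ → ℂ} (hc : ContinuousOn h E)
    (hs : ∀ z ∈ E, h z ∈ Complex.slitPlane) : HasLog E h :=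
  ⟨fun z => Complex.log (h z), hc.clog hs,
    fun z hz => Complex.exp_log (Complex.slitPlane_ne_zero (hs z hz))⟩

theorem HasLog.ne_zero {E : Set ℂ} {h : ℂ → ℂ} (H : HasLog E h) {z : ℂ} (hz : z ∈ E) : h z ≠ 0 := by
  obtain ⟨G, h1, h2⟩ := H
  rw [← h2 z hz]; exact Complex.exp_ne_zero _

theorem slit_of_near_one {w : ℂ} (h : ‖w - 1‖ < 1) : w ∈ Complex.slitPlane := by
  left
  have := Complex.abs_re_le_norm (w - 1)
  have h2 := neg_abs_le (w - 1).re
  simp at this h2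
  linarith

theorem hasLog_near {E : Set ℂ} {p q : ℂ} (h : ∀ z ∈ E, ‖p - q‖ < ‖z - q‖) :
    HasLog E (fun z => (z - p) / (z - q)) := by
  have h0 : ∀ z ∈ E, z - q ≠ 0 := fun z hz => norm_pos_iff.1 ((norm_nonneg _).trans_lt (h z hz))
  apply hasLog_of_slit
  · exact ContinuousOn.div (by fun_prop) (by fun_prop) h0
  · intro z hz
    apply slit_of_near_one
    have : (z - p) / (z - q) - 1 = - ((p - q) / (z - q)) := by
      field_simp [h0 z hz]; ring
    rw [this, norm_neg, norm_div, div_lt_one (norm_pos_iff.2 (h0 z hz))]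
    exact h z hz

theorem hasLog_move {E A : Set ℂ} (hE : IsClosed E) (hA : IsPreconnected A) (hd : Disjoint A E)
    {q1 q2 : ℂ} (h1 : q1 ∈ A) (h2 : q2 ∈ A) : HasLog E (fun z => (z - q1) / (z - q2)) := by
  have hne : ∀ q ∈ A, ∀ z ∈ E, z - q ≠ 0 := by
    intro q hq z hz h
    rw [sub_eq_zero] at h; subst h
    exact Set.disjoint_left.1 hd hq hz
  refine hA.induction₂ (fun a b => HasLog E (fun z => (z - a) / (z - b))) ?_ ?_ ?_ h1 h2
  · intro q hq
    have hq' : q ∈ Eᶜ := Set.disjoint_left.1 hd hq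
    obtain ⟨ε, hε, hb⟩ := Metric.isOpen_iff.1 hE.isOpen_compl q hq'
    have : Metric.ball q (ε/2) ∈ 𝓝[A] q := mem_nhdsWithin_of_mem_nhds (Metric.ball_mem_nhds _ (by linarith))
    filter_upwards [this] with p hp
    have hfar : ∀ z ∈ E, ε ≤ ‖z - q‖ := by
      intro z hz
      by_contra hlt
      push Not at hlt
      exact hb (by simpa [dist_eq_norm] using hlt) hz
    rw [Metric.mem_ball, dist_eq_norm] at hp
    have : HasLog E (fun z => (z - p) / (z - q)) :=
      hasLog_near (fun z hz => by linarith [hfar z hz])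
    exact this.inv.congr (fun z hz => by rw [inv_div])
  · intro a b c ha hb hc hab hbc
    refine (hab.mul hbc).congr (fun z hz => ?_)
    have := hne b hb z hz
    have := hne c hc z hz
    field_simp
  · intro a b ha hb hab
    exact hab.inv.congr (fun z hz => by rw [inv_div])

theorem hasLog_unbounded {E A : Set ℂ} (hE : IsCompact E) (hA : IsPreconnected A)
    (hd : Disjoint A E) (hub : ¬ Bornology.IsBounded A) {q : ℂ} (hq : q ∈ A) :
    HasLog E (fun z => z - q) := by
  obtain ⟨R, hR⟩ := hE.isBounded.exists_norm_le
  have : ∃ a ∈ A, max R 0 < ‖a‖ := by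
    by_contra hcon
    push Not at hcon
    exact hub (isBounded_iff_forall_norm_le.2 ⟨_, hcon⟩)
  obtain ⟨a, ha, hRa⟩ := this
  have ha0 : a ≠ 0 := by
    rw [← norm_pos_iff]; exact (le_max_right _ _).trans_lt hRa
  have hza : ∀ z ∈ E, ‖z‖ < ‖a‖ := fun z hz => (hR z hz).trans_lt ((le_max_left _ _).trans_lt hRa)
  have key : HasLog E (fun z => (z - a) / (-a)) := by
    apply hasLog_of_slit
    · exact ContinuousOn.div_const (by fun_prop) _
    · intro z hz
      apply slit_of_near_one
      have : (z - a) / (-a) - 1 = - (z / a) := by field_simp; ring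
      rw [this, norm_neg, norm_div, div_lt_one (norm_pos_iff.2 ha0)]
      exact hza z hz
  refine ((hasLog_move hE.isClosed hA hd hq ha).mul (key.mul (hasLog_const E (neg_ne_zero.2 ha0)))).congr ?_
  intro z hz
  have : z - a ≠ 0 := by
    intro h; rw [sub_eq_zero] at h; subst h; exact absurd (hza _ hz) (lt_irrefl _)
  field_simp



inductive StepFn (F : Set ℝ) : (ℝ → ℤ) → Prop
  | const (n : ℤ) : StepFn F (fun _ => n)
  | add {φ ψ : ℝ → ℤ} : StepFn F φ → StepFn F ψ → StepFn F (fun y => φ y + ψ y)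
  | neg {φ : ℝ → ℤ} : StepFn F φ → StepFn F (fun y => - φ y)
  | gen {p : ℝ} : p ∉ F → StepFn F (fun y => if y < p then 1 else 0)

theorem StepFn.smul_gen {F : Set ℝ} {p : ℝ} (hp : p ∉ F) (n : ℤ) :
    StepFn F (fun y => if y < p then n else 0) := by
  induction n with
  | zero => simpa using StepFn.const (F := F) 0
  | succ n ih =>
    convert StepFn.add ih (StepFn.gen hp) using 2 with y
    split_ifs <;> simp
  | pred n ih =>
    convert StepFn.add ih (StepFn.neg (StepFn.gen hp)) using 2 with y
    split_ifs <;> first | ring | simp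

theorem StepFn.trunc {F : Set ℝ} {p : ℝ} (hp : p ∉ F) {φ : ℝ → ℤ} (h : StepFn F φ) :
    StepFn F (fun y => if y < p then φ y else 0) := by
  induction h with
  | const n => exact StepFn.smul_gen hp n
  | add _ _ ih1 ih2 =>
    convert StepFn.add ih1 ih2 using 2 with y
    split_ifs <;> simp
  | neg _ ih =>
    convert StepFn.neg ih using 2 with y
    split_ifs <;> simp
  | @gen q hq =>
    have : min p q ∉ F := by
      rcases min_choice p q with h | h <;> rw [h] <;> assumption
    convert StepFn.gen this using 2 with y
    simp only [lt_min_iff]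
    split_ifs <;> simp_all

theorem StepFn.trunc' {F : Set ℝ} {p : ℝ} (hp : p ∉ F) {φ : ℝ → ℤ} (h : StepFn F φ) (n : ℤ) :
    StepFn F (fun y => if y < p then φ y else n) := by
  convert StepFn.add (StepFn.trunc hp h) (StepFn.add (StepFn.const n)
    (StepFn.neg (StepFn.smul_gen hp n))) using 2 with y
  split_ifs <;> simp

theorem exists_stepFn {F : Set ℝ} (hF : IsCompact F) {m : ℝ → ℤ} (hm : ContinuousOn m F) :
    ∃ φ, StepFn F φ ∧ ∀ y ∈ F, φ y = m y := by
  have huc := hF.uniformContinuousOn_of_continuous hm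
  rw [Metric.uniformContinuousOn_iff] at huc
  obtain ⟨δ, hδ, hu⟩ := huc 1 one_pos
  have hu' : ∀ x ∈ F, ∀ y ∈ F, |x - y| < δ → m x = m y := by
    intro x hx y hy hxy
    have := hu x hx y hy (by simpa [Real.dist_eq] using hxy)
    rw [Int.dist_eq] at this
    have h3 : |m x - m y| < 1 := by exact_mod_cast this
    rw [Int.abs_lt_one_iff] at h3
    omega
  obtain ⟨R, hR⟩ := hF.isBounded.exists_norm_le
  have step : ∀ N : ℕ, ∃ φ, StepFn F φ ∧ (∀ y ∈ F, y ≤ -R - 1 + N * (δ/3) → φ y = m y) ∧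
      ∀ y, -R - 1 + N * (δ/3) ≤ y → φ y = φ (-R - 1 + N * (δ/3)) := by
    intro N
    induction N with
    | zero =>
      refine ⟨fun _ => 0, StepFn.const 0, ?_, fun _ _ => rfl⟩
      intro y hy h
      have := hR y hy
      rw [Real.norm_eq_abs] at this
      have := neg_abs_le y
      simp at h
      linarith
    | succ N ih =>
      obtain ⟨φ, h1, h2, h3⟩ := ih
      set s := -R - 1 + N * (δ/3) with hs
      have hs' : -R - 1 + ((N+1 : ℕ) : ℝ) * (δ/3) = s + δ/3 := by push_cast; rw [hs]; ring
      rw [hs']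
      by_cases hne : ∃ y0 ∈ F, s - δ/3 < y0 ∧ y0 ≤ s + δ/3
      · obtain ⟨y0, hy0, hy1, hy2⟩ := hne
        have hc : ∀ y ∈ F, s - δ/3 < y → y ≤ s + δ/3 → m y = m y0 := by
          intro y hy ha hb
          apply hu' y hy y0 hy0
          rw [abs_lt]; constructor <;> linarith
        by_cases hp : ∃ p, s - δ/3 < p ∧ p ≤ s ∧ p ∉ F
        · obtain ⟨p, hp1, hp2, hp3⟩ := hp
          refine ⟨_, StepFn.trunc' hp3 h1 (m y0), ?_, ?_⟩
          · intro y hy hys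
            by_cases hyp : y < p
            · simp only [hyp, if_true]; exact h2 y hy (by linarith)
            · simp only [hyp, if_false]; exact (hc y hy (by linarith [not_lt.1 hyp]) hys).symm
          · intro y hy
            have a1 : ¬ y < p := by linarith
            have a2 : ¬ s + δ/3 < p := by linarith
            simp only [a1, a2, if_false]
        · push Not at hp
          have hsF := hp s (by linarith) le_rfl
          refine ⟨φ, h1, ?_, ?_⟩
          · intro y hy hys
            by_cases hyp : y ≤ s
            · exact h2 y hy hyp
            · push Not at hyp
              rw [h3 y hyp.le, h2 s hsF le_rfl, hc s hsF (by linarith) (by linarith),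
                hc y hy (by linarith) hys]
          · intro y hy
            rw [h3 y (by linarith), h3 (s + δ/3) (by linarith)]
      · push Not at hne
        refine ⟨φ, h1, ?_, ?_⟩
        · intro y hy hys
          apply h2 y hy
          by_contra hlt
          push Not at hlt
          linarith [hne y hy (by linarith)]
        · intro y hy
          rw [h3 y (by linarith), h3 (s + δ/3) (by linarith)]
  obtain ⟨N, hN⟩ := exists_nat_gt ((2 * R + 1) / (δ/3))
  obtain ⟨φ, h1, h2, h3⟩ := step N
  refine ⟨φ, h1, fun y hy => h2 y hy ?_⟩
  have := hR y hy
  rw [Real.norm_eq_abs] at this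
  have := le_abs_self y
  rw [div_lt_iff₀ (by positivity)] at hN
  linarith

inductive RatFn (Q : Set ℂ) : (ℂ → ℂ) → Prop
  | one : RatFn Q (fun _ => 1)
  | mul {r s : ℂ → ℂ} : RatFn Q r → RatFn Q s → RatFn Q (fun z => r z * s z)
  | inv {r : ℂ → ℂ} : RatFn Q r → RatFn Q (fun z => (r z)⁻¹)
  | lin {p : ℂ} : p ∈ Q → RatFn Q (fun z => z - p)

theorem RatFn.mono {Q Q' : Set ℂ} (h : Q ⊆ Q') {r} (hr : RatFn Q r) : RatFn Q' r := by
  induction hr with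
  | one => exact .one
  | mul _ _ a b => exact .mul a b
  | inv _ a => exact .inv a
  | lin hp => exact .lin (h hp)

theorem RatFn.hasLog {Q E : Set ℂ} (h : ∀ p ∈ Q, HasLog E (fun z => z - p)) {r}
    (hr : RatFn Q r) : HasLog E r := by
  induction hr with
  | one => exact hasLog_const E one_ne_zero
  | mul _ _ a b => exact a.mul b
  | inv _ a => exact a.inv
  | lin hp => exact h _ hp

theorem RatFn.ne_zero {Q : Set ℂ} {r} (hr : RatFn Q r) {z : ℂ} (hz : z ∉ Q) : r z ≠ 0 := by
  induction hr with
  | one => exact one_ne_zero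
  | mul _ _ a b => exact mul_ne_zero a b
  | inv _ a => exact inv_ne_zero a
  | @lin p hp => intro h; rw [sub_eq_zero] at h; subst h; exact hz hp

/-- logarithm on closed left half plane -/
theorem hasLog_left {E : Set ℂ} {c : ℝ} (hE : ∀ z ∈ E, z.re ≤ c) {p : ℂ} (hp : c ≤ p.re)
    (hpE : p ∉ E) : HasLog E (fun z => z - p) := by
  have : HasLog E (fun z => p - z) := by
    apply hasLog_of_slit (by fun_prop)
    intro z hz
    have h1 := hE z hz
    rw [Complex.mem_slitPlane_iff]
    by_cases h2 : z.re = p.re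
    · right
      intro h3
      apply hpE
      have : p = z := by
        apply Complex.ext h2.symm
        simp at h3; linarith
      rwa [this]
    · left
      simp
      exact lt_of_le_of_ne (by linarith) h2
  refine (this.mul (hasLog_const E (c := -1) (by norm_num))).congr (fun z _ => by ring)

theorem hasLog_right {E : Set ℂ} {c : ℝ} (hE : ∀ z ∈ E, c ≤ z.re) {p : ℂ} (hp : p.re ≤ c)
    (hpE : p ∉ E) : HasLog E (fun z => z - p) := by
  apply hasLog_of_slit (by fun_prop)
  intro z hz
  have h1 := hE z hz
  rw [Complex.mem_slitPlane_iff]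
  by_cases h2 : z.re = p.re
  · right
    intro h3
    apply hpE
    have : p = z := by
      apply Complex.ext h2.symm
      simp at h3; linarith
    rwa [this]
  · left
    simp
    exact lt_of_le_of_ne (by linarith) (Ne.symm h2)

theorem RatFn.drop {E X Q : Set ℂ} (h : ∀ p, p ∉ E → p ∉ Q → HasLog E (fun z => z - p))
    (hX : ∀ p, p ∉ E → p ∈ Q → p ∉ X)
    {r} (hr : RatFn Eᶜ r) : ∃ s, RatFn (Xᶜ ∩ Q) s ∧ HasLog E (fun z => r z / s z) := by
  induction hr with
  | one => exact ⟨_, .one, (hasLog_const E one_ne_zero).congr (fun _ _ => by simp)⟩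
  | mul _ _ a b =>
    obtain ⟨s, h1, h2⟩ := a
    obtain ⟨s', h1', h2'⟩ := b
    exact ⟨_, .mul h1 h1', (h2.mul h2').congr (fun z _ => by simp [mul_div_mul_comm])⟩
  | inv _ a =>
    obtain ⟨s, h1, h2⟩ := a
    exact ⟨_, .inv h1, h2.inv.congr (fun z _ => by simp [div_eq_mul_inv, mul_comm])⟩
  | @lin p hp =>
    by_cases hpQ : p ∈ Q
    · refine ⟨_, .lin (p := p) ⟨hX p hp hpQ, hpQ⟩, (hasLog_const E one_ne_zero).congr ?_⟩
      intro z hz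
      apply div_self
      intro h; rw [sub_eq_zero] at h; subst h; exact hp hz
    · exact ⟨_, .one, (h p hp hpQ).congr (fun _ _ => by simp)⟩

theorem log_jump {s : ℝ} (hs : s ≠ 0) :
    (Complex.log (-(s * Complex.I)) + Real.pi * Complex.I) - Complex.log (s * Complex.I)
      = ((if s < 0 then 1 else 0 : ℤ) : ℂ) * (2 * Real.pi * Complex.I) := by
  rcases lt_or_gt_of_ne hs with h | h
  · have e1 : -((s : ℂ) * Complex.I) = ((-s : ℝ) : ℂ) * Complex.I := by push_cast; ring
    have e2 : ((s : ℂ) * Complex.I) = ((-s : ℝ) : ℂ) * (-Complex.I) := by push_cast; ring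
    rw [e1, e2, Complex.log_ofReal_mul (by linarith) Complex.I_ne_zero,
      Complex.log_ofReal_mul (by linarith) (neg_ne_zero.2 Complex.I_ne_zero), Complex.log_I,
      Complex.log_neg_I]
    simp [h]; ring
  · have e1 : -((s : ℂ) * Complex.I) = (s : ℂ) * (-Complex.I) := by ring
    rw [e1, Complex.log_ofReal_mul h Complex.I_ne_zero,
      Complex.log_ofReal_mul h (neg_ne_zero.2 Complex.I_ne_zero), Complex.log_I,
      Complex.log_neg_I]
    simp [not_lt.2 h.le]; ring

theorem StepFn.exists_rat {X : Set ℂ} {c : ℝ} {φ : ℝ → ℤ}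
    (hφ : StepFn {y : ℝ | (⟨c, y⟩ : ℂ) ∈ X} φ) :
    ∃ r, RatFn (Xᶜ) r ∧ ∃ A B : ℂ → ℂ,
      ContinuousOn A (X ∩ {z | z.re ≤ c}) ∧ ContinuousOn B (X ∩ {z | c ≤ z.re}) ∧
      (∀ z ∈ X ∩ {z | z.re ≤ c}, Complex.exp (A z) = r z) ∧
      (∀ z ∈ X ∩ {z | c ≤ z.re}, Complex.exp (B z) = r z) ∧
      ∀ z ∈ X, z.re = c → A z - B z = φ z.im * (2 * Real.pi * Complex.I) := by
  induction hφ with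
  | const n =>
    refine ⟨_, .one, fun _ => n * (2 * Real.pi * Complex.I), fun _ => 0, continuousOn_const,
      continuousOn_const, ?_, ?_, ?_⟩
    · intro z _; exact Complex.exp_int_mul_two_pi_mul_I n
    · intro z _; simp
    · intro z _ _; simp
  | add _ _ a b =>
    obtain ⟨r, h0, A, B, h1, h2, h3, h4, h5⟩ := a
    obtain ⟨r', h0', A', B', h1', h2', h3', h4', h5'⟩ := b
    refine ⟨_, .mul h0 h0', fun z => A z + A' z, fun z => B z + B' z, h1.add h1', h2.add h2',
      ?_, ?_, ?_⟩
    · intro z hz; rw [Complex.exp_add, h3 z hz, h3' z hz]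
    · intro z hz; rw [Complex.exp_add, h4 z hz, h4' z hz]
    · intro z hz hc
      have a := h5 z hz hc
      have b := h5' z hz hc
      push_cast
      linear_combination a + b
  | neg _ a =>
    obtain ⟨r, h0, A, B, h1, h2, h3, h4, h5⟩ := a
    refine ⟨_, .inv h0, fun z => - A z, fun z => - B z, h1.neg, h2.neg,
      ?_, ?_, ?_⟩
    · intro z hz; rw [Complex.exp_neg, h3 z hz]
    · intro z hz; rw [Complex.exp_neg, h4 z hz]
    · intro z hz hc
      have a := h5 z hz hc
      push_cast
      linear_combination -a
  | @gen p hp =>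
    have hp' : (⟨c, p⟩ : ℂ) ∉ X := hp
    set P : ℂ := ⟨c, p⟩ with hP
    have hne : ∀ z ∈ X, z - P ≠ 0 := by
      intro z hz h
      rw [sub_eq_zero] at h; subst h; exact hp' hz
    refine ⟨_, .lin hp', fun z => Complex.log (-(z - P)) + Real.pi * Complex.I,
      fun z => Complex.log (z - P), ?_, ?_, ?_, ?_, ?_⟩
    · refine ContinuousOn.add (ContinuousOn.clog (by fun_prop) ?_) continuousOn_const
      rintro z ⟨hz, hz'⟩
      rw [Complex.mem_slitPlane_iff]
      by_cases h : z.re = c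
      · right
        intro h3
        apply hne z hz
        apply Complex.ext
        · simp [h, hP]
        · simp at h3 ⊢; linarith
      · left
        have : z.re < c := lt_of_le_of_ne hz' h
        simp [hP]; linarith
    · refine (ContinuousOn.clog (by fun_prop) ?_)
      rintro z ⟨hz, hz'⟩
      rw [Complex.mem_slitPlane_iff]
      by_cases h : z.re = c
      · right
        intro h3
        apply hne z hz
        apply Complex.ext
        · simp [h, hP]
        · simpa using h3
      · left
        have : c < z.re := lt_of_le_of_ne hz' (Ne.symm h)
        simp [hP]; linarith
    · rintro z ⟨hz, hz'⟩
      rw [Complex.exp_add, Complex.exp_log (neg_ne_zero.2 (hne z hz)), Complex.exp_pi_mul_I]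
      ring
    · rintro z ⟨hz, hz'⟩
      rw [Complex.exp_log (hne z hz)]
    · intro z hz hc
      have hz0 : z - P = ((z.im - p : ℝ) : ℂ) * Complex.I := by
        apply Complex.ext <;> simp [hP, hc]
      have hs : z.im - p ≠ 0 := by
        intro h; apply hne z hz; rw [hz0, h]; simp
      simp only [hz0]
      rw [log_jump hs]
      simp

/-- `h` times a rational function has a log. -/
def RLog (h : ℂ → ℂ) (X : Set ℂ) : Prop :=
  ∃ r, RatFn Xᶜ r ∧ HasLog X (fun z => h z * r z)

theorem RLog.glue_core {h : ℂ → ℂ} {X : Set ℂ} (hX : IsCompact X) {c : ℝ}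
    (hL : HasLog (X ∩ {z | z.re ≤ c}) h) (hR : HasLog (X ∩ {z | c ≤ z.re}) h) : RLog h X := by
  obtain ⟨G, g1, g2⟩ := hL
  obtain ⟨H, k1, k2⟩ := hR
  have hcl1 : IsClosed {z : ℂ | z.re ≤ c} := isClosed_le Complex.continuous_re continuous_const
  have hcl2 : IsClosed {z : ℂ | c ≤ z.re} := isClosed_le continuous_const Complex.continuous_re
  set F : Set ℝ := {y : ℝ | (⟨c, y⟩ : ℂ) ∈ X} with hF
  have hι : Continuous (fun y : ℝ => (⟨c, y⟩ : ℂ)) := by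
    have : (fun y : ℝ => (⟨c, y⟩ : ℂ)) = fun y : ℝ => (c : ℂ) + y * Complex.I := by
      funext y; apply Complex.ext <;> simp
    rw [this]; fun_prop
  have hFc : IsCompact F := by
    have hcl : IsClosed F := hX.isClosed.preimage hι
    obtain ⟨R, hR⟩ := hX.isBounded.exists_norm_le
    apply (isCompact_Icc (a := -R) (b := R)).of_isClosed_subset hcl
    intro y hy
    have h1 := hR _ hy
    have h2 := Complex.abs_im_le_norm (⟨c, y⟩ : ℂ)
    simp only at h2
    exact abs_le.1 (h2.trans h1)
  have hInteger : ∀ y ∈ F, ∃ n : ℤ, G ⟨c, y⟩ = H ⟨c, y⟩ + n * (2 * Real.pi * Complex.I) := by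
    intro y hy
    rw [← Complex.exp_eq_exp_iff_exists_int, g2 _ ⟨hy, le_refl c⟩, k2 _ ⟨hy, le_refl c⟩]
  choose! m hm using hInteger
  have hmc : ContinuousOn m F := by
    have hc1 : ContinuousOn (fun y : ℝ => (G ⟨c, y⟩ - H ⟨c, y⟩) / (2 * Real.pi * Complex.I)) F := by
      apply ContinuousOn.div_const
      apply ContinuousOn.sub
      · exact g1.comp hι.continuousOn (fun y hy => ⟨hy, le_refl c⟩)
      · exact k1.comp hι.continuousOn (fun y hy => ⟨hy, le_refl c⟩)
    have hc2 : ContinuousOn (fun y => ((m y : ℤ) : ℝ)) F := by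
      have := Complex.continuous_re.comp_continuousOn hc1
      refine this.congr (fun y hy => ?_)
      simp only [Function.comp]
      rw [hm y hy, add_sub_cancel_left, mul_div_cancel_right₀ _ Complex.two_pi_I_ne_zero]
      simp
    exact Int.isClosedEmbedding_coe_real.isEmbedding.continuousOn_iff.2 hc2
  obtain ⟨φ, hφ, hφm⟩ := exists_stepFn hFc hmc
  obtain ⟨r, h0, A, B, h1, h2, h3, h4, h5⟩ := hφ.exists_rat
  have hXu : X = (X ∩ {z | z.re ≤ c}) ∪ (X ∩ {z | c ≤ z.re}) := by
    ext z; constructor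
    · intro hz; rcases le_total z.re c with h | h
      · exact .inl ⟨hz, h⟩
      · exact .inr ⟨hz, h⟩
    · rintro (h | h) <;> exact h.1
  classical
  have hRcongr : ∀ z ∈ X ∩ {z | c ≤ z.re},
      (if z.re ≤ c then G z - A z else H z - B z) = H z - B z := by
    rintro z ⟨hz, hzc⟩
    split_ifs with hle
    · have hzc' : z.re = c := le_antisymm hle hzc
      have e := h5 z hz hzc'
      have hzeq : (⟨c, z.im⟩ : ℂ) = z := Complex.ext hzc'.symm rfl
      have hzF : z.im ∈ F := by rw [hF, mem_ofPred_eq, hzeq]; exact hz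
      have e2 := hm _ hzF
      rw [hzeq] at e2
      rw [hφm _ hzF] at e
      linear_combination e2 - e
    · rfl
  refine ⟨_, .inv h0, fun z => if z.re ≤ c then G z - A z else H z - B z, ?_, ?_⟩
  · rw [hXu]
    apply ContinuousOn.union_of_isClosed
    · exact (g1.sub h1).congr (fun z hz => if_pos hz.2)
    · exact (k1.sub h2).congr hRcongr
    · exact hX.isClosed.inter hcl1
    · exact hX.isClosed.inter hcl2
  · intro z hz
    rcases le_total z.re c with h | h
    · simp only [h, if_true]
      rw [Complex.exp_sub, g2 z ⟨hz, h⟩, h3 z ⟨hz, h⟩, div_eq_mul_inv]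
    · simp only []
      rw [hRcongr z ⟨hz, h⟩, Complex.exp_sub, k2 z ⟨hz, h⟩, h4 z ⟨hz, h⟩, div_eq_mul_inv]

theorem RLog.glue {h : ℂ → ℂ} {X : Set ℂ} (hX : IsCompact X) (c : ℝ)
    (hL : RLog h (X ∩ {z | z.re ≤ c})) (hR : RLog h (X ∩ {z | c ≤ z.re})) : RLog h X := by
  obtain ⟨r, hr, hlr⟩ := hL
  obtain ⟨s, hs, hls⟩ := hR
  obtain ⟨r', hr', hlr'⟩ := RatFn.drop (E := X ∩ {z | z.re ≤ c}) (X := X) (Q := {z | z.re ≤ c})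
    (fun p hp hpQ => hasLog_left (c := c) (fun z hz => hz.2) (le_of_not_ge hpQ) hp)
    (fun p hp hpQ hpX => hp ⟨hpX, hpQ⟩) hr
  obtain ⟨s', hs', hls'⟩ := RatFn.drop (E := X ∩ {z | c ≤ z.re}) (X := X) (Q := {z | c ≤ z.re})
    (fun p hp hpQ => hasLog_right (c := c) (fun z hz => hz.2) (le_of_not_ge hpQ) hp)
    (fun p hp hpQ hpX => hp ⟨hpX, hpQ⟩) hs
  have l1 : HasLog (X ∩ {z | z.re ≤ c}) s' :=
    RatFn.hasLog (fun p hp => hasLog_left (c := c) (fun z hz => hz.2) hp.2 (fun h => hp.1 h.1)) hs'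
  have l2 : HasLog (X ∩ {z | c ≤ z.re}) r' :=
    RatFn.hasLog (fun p hp => hasLog_right (c := c) (fun z hz => hz.2) hp.2 (fun h => hp.1 h.1)) hr'
  have k1 : HasLog (X ∩ {z | z.re ≤ c}) (fun z => h z * (r' z * s' z)) := by
    refine ((hlr.div hlr').mul l1).congr (fun z hz => ?_)
    have a := hr.ne_zero (z := z) (fun hq => hq hz)
    have b := hr'.ne_zero (z := z) (fun hq => hq.1 hz.1)
    field_simp
  have k2 : HasLog (X ∩ {z | c ≤ z.re}) (fun z => h z * (r' z * s' z)) := by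
    refine ((hls.div hls').mul l2).congr (fun z hz => ?_)
    have a := hs.ne_zero (z := z) (fun hq => hq hz)
    have b := hs'.ne_zero (z := z) (fun hq => hq.1 hz.1)
    field_simp
  obtain ⟨t, ht, hlt⟩ := RLog.glue_core hX k1 k2
  refine ⟨fun z => (r' z * s' z) * t z, .mul (.mul (hr'.mono inter_subset_left) (hs'.mono inter_subset_left)) ht,
    hlt.congr (fun z _ => by ring)⟩

theorem HasLog.comp {E F : Set ℂ} {h g : ℂ → ℂ} (H : HasLog E h) (hg : ContinuousOn g F)
    (hm : MapsTo g F E) : HasLog F (fun z => h (g z)) := by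
  obtain ⟨G, h1, h2⟩ := H
  exact ⟨fun z => G (g z), h1.comp hg hm, fun z hz => h2 _ (hm hz)⟩

/-- rotation invariance -/
theorem RLog.rot {h : ℂ → ℂ} {X : Set ℂ} {u : ℂ} (hu : u ≠ 0)
    (H : RLog (fun z => h (u * z)) {z | u * z ∈ X}) : RLog h X := by
  obtain ⟨r, hr, G, g1, g2⟩ := H
  have : ∃ s, RatFn Xᶜ s ∧ HasLog X (fun z => r (z / u) / s z) := by
    clear g1 g2
    induction hr with
    | one => exact ⟨_, .one, (hasLog_const X one_ne_zero).congr (fun _ _ => by simp)⟩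
    | mul _ _ a b =>
      obtain ⟨s, h1, h2⟩ := a
      obtain ⟨s', h1', h2'⟩ := b
      exact ⟨_, .mul h1 h1', (h2.mul h2').congr (fun z _ => by simp [mul_div_mul_comm])⟩
    | inv _ a =>
      obtain ⟨s, h1, h2⟩ := a
      exact ⟨_, .inv h1, h2.inv.congr (fun z _ => by simp [div_eq_mul_inv, mul_comm])⟩
    | @lin p hp =>
      refine ⟨_, .lin (p := u * p) hp, (hasLog_const X (inv_ne_zero hu)).congr ?_⟩
      intro z hz
      have : z - u * p ≠ 0 := by
        intro h; rw [sub_eq_zero] at h; subst h; exact hp hz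
      rw [div_eq_iff this]; field_simp
  obtain ⟨s, hs, hl⟩ := this
  have hm : MapsTo (fun z => z / u) X {z | u * z ∈ X} := by
    intro z hz; simp only [mem_ofPred_eq]; rwa [mul_div_cancel₀ _ hu]
  have h2 : HasLog X (fun z => h z * r (z / u)) := by
    refine (HasLog.comp ⟨G, g1, g2⟩ (g := fun z => z / u) (by fun_prop) hm).congr ?_
    intro z hz; simp only; rw [mul_div_cancel₀ _ hu]
  refine ⟨s, hs, (h2.div hl).congr (fun z hz => ?_)⟩
  have a := hr.ne_zero (z := z / u) (fun hq => hq (hm hz))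
  have b := hs.ne_zero (z := z) (fun hq => hq hz)
  field_simp

theorem RLog.glue_im {h : ℂ → ℂ} {X : Set ℂ} (hX : IsCompact X) (c : ℝ)
    (hL : RLog h (X ∩ {z | z.im ≤ c})) (hR : RLog h (X ∩ {z | c ≤ z.im})) : RLog h X := by
  have hI : (-Complex.I) ≠ 0 := neg_ne_zero.2 Complex.I_ne_zero
  have tr : ∀ Y, RLog h Y → RLog (fun z => h (Complex.I * z)) {z | Complex.I * z ∈ Y} := by
    intro Y hY
    apply RLog.rot hI
    convert hY using 2
    · congr 1; rw [← mul_assoc]; simp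
    · ext z; simp only [mem_ofPred_eq]; rw [← mul_assoc]; simp
  have hcont : IsCompact {z | Complex.I * z ∈ X} := by
    have := hX.image (f := fun z => -Complex.I * z) (by fun_prop)
    convert this using 1
    ext z; simp only [mem_ofPred_eq, mem_image]
    constructor
    · intro hz; exact ⟨_, hz, by rw [← mul_assoc]; simp⟩
    · rintro ⟨w, hw, rfl⟩; rw [← mul_assoc]; simpa using hw
  apply RLog.rot Complex.I_ne_zero
  apply RLog.glue hcont c
  · convert tr _ hL using 1
    ext z; simp [mem_ofPred_eq]
  · convert tr _ hR using 1
    ext z; simp [mem_ofPred_eq]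

theorem strips (P : Set ℂ → Prop) (g : ℂ → ℝ) (hgc : Continuous g) (hP0 : P ∅)
    (hglue : ∀ X, IsCompact X → ∀ c : ℝ, P (X ∩ {z | g z ≤ c}) → P (X ∩ {z | c ≤ g z}) → P X)
    {K : Set ℂ} {δ : ℝ} (hδ : 0 < δ)
    (hsm : ∀ Y, IsCompact Y → Y ⊆ K → (∃ t, ∀ z ∈ Y, t ≤ g z ∧ g z ≤ t + δ) → P Y) :
    ∀ Y, IsCompact Y → Y ⊆ K → P Y := by
  have key : ∀ N : ℕ, ∀ Y t, IsCompact Y → Y ⊆ K → (∀ z ∈ Y, t ≤ g z ∧ g z ≤ t + N * δ) → P Y := by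
    intro N
    induction N with
    | zero => intro Y t hY hYK h; exact hsm Y hY hYK ⟨t, fun z hz => ⟨(h z hz).1, by have := (h z hz).2; simp at this; linarith⟩⟩
    | succ N ih =>
      intro Y t hY hYK h
      apply hglue Y hY (t + N * δ)
      · exact ih _ t (hY.inter_right (isClosed_le hgc continuous_const)) (inter_subset_left.trans hYK)
          (fun z hz => ⟨(h z hz.1).1, hz.2⟩)
      · refine hsm _ (hY.inter_right (isClosed_le continuous_const hgc)) (inter_subset_left.trans hYK)
          ⟨t + N * δ, fun z hz => ⟨hz.2, ?_⟩⟩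
        have := (h z hz.1).2
        push_cast at this; linarith
  intro Y hY hYK
  rcases Y.eq_empty_or_nonempty with rfl | hne
  · exact hP0
  obtain ⟨a, ha, hmin⟩ := hY.exists_isMinOn hne hgc.continuousOn
  obtain ⟨b, hb, hmax⟩ := hY.exists_isMaxOn hne hgc.continuousOn
  obtain ⟨N, hN⟩ := exists_nat_gt ((g b - g a) / δ)
  rw [div_lt_iff₀ hδ] at hN
  apply key N Y (g a) hY hYK
  intro z hz
  have h1 : g a ≤ g z := hmin hz
  have h2 : g z ≤ g b := hmax hz
  exact ⟨h1, by linarith⟩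

theorem hasLog_of_connected_compl {K : Set ℂ} (hK : IsCompact K) (hc : IsPreconnected Kᶜ)
    {h : ℂ → ℂ} (hh : ContinuousOn h K) (h0 : ∀ z ∈ K, h z ≠ 0) : HasLog K h := by
  have hempty : ∀ h : ℂ → ℂ, RLog h ∅ := fun h => ⟨_, .one, fun _ => 0, continuousOn_empty _, by simp⟩
  rcases K.eq_empty_or_nonempty with rfl | hne
  · exact ⟨fun _ => 0, continuousOn_empty _, by simp⟩
  obtain ⟨a, ha, hmin⟩ := hK.exists_isMinOn hne hh.norm
  have hpos : 0 < ‖h a‖ := norm_pos_iff.2 (h0 a ha)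
  have huc := hK.uniformContinuousOn_of_continuous hh
  rw [Metric.uniformContinuousOn_iff] at huc
  obtain ⟨δ, hδ, hu⟩ := huc _ hpos
  have main : RLog h K := by
    refine strips (RLog h) Complex.re Complex.continuous_re (hempty h)
      (fun X hX c => RLog.glue hX c) (K := K) (δ := δ/3) (by positivity) ?_ K hK subset_rfl
    intro Y hY hYK hre
    refine strips (RLog h) Complex.im Complex.continuous_im (hempty h)
      (fun X hX c => RLog.glue_im hX c) (K := Y) (δ := δ/3) (by positivity) ?_ Y hY subset_rfl
    intro Z hZ hZY him
    rcases Z.eq_empty_or_nonempty with rfl | ⟨b, hb⟩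
    · exact hempty h
    obtain ⟨t, ht⟩ := hre
    obtain ⟨s, hs⟩ := him
    refine ⟨_, .one, ?_⟩
    have hb0 := h0 b (hYK (hZY hb))
    have : HasLog Z (fun z => h z / h b) := by
      apply hasLog_of_slit ((hh.mono (hZY.trans hYK)).div_const _)
      intro z hz
      apply slit_of_near_one
      have : h z / h b - 1 = (h z - h b) / h b := by field_simp
      rw [this, norm_div, div_lt_one (norm_pos_iff.2 hb0)]
      have h1 : ‖h a‖ ≤ ‖h b‖ := hmin (hYK (hZY hb))
      have h2 := hu z (hYK (hZY hz)) b (hYK (hZY hb)) ?_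
      · rw [dist_eq_norm] at h2; linarith
      rw [dist_eq_norm]
      have h3 := Complex.norm_le_abs_re_add_abs_im (z - b)
      have h4 : |(z - b).re| ≤ δ/3 := by
        rw [abs_le, Complex.sub_re]
        have := ht z (hZY hz); have := ht b (hZY hb); constructor <;> linarith
      have h5 : |(z - b).im| ≤ δ/3 := by
        rw [abs_le, Complex.sub_im]
        have := hs z hz; have := hs b hb; constructor <;> linarith
      linarith
    refine (this.mul (hasLog_const Z hb0)).congr (fun z _ => by field_simp)
  obtain ⟨r, hr, hl⟩ := main
  have hub : ¬ Bornology.IsBounded Kᶜ := by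
    intro hb
    have : Bornology.IsBounded (univ : Set ℂ) := by
      rw [← union_compl_self K]; exact hK.isBounded.union hb
    exact NormedSpace.unbounded_univ ℝ ℂ this
  have hlr : HasLog K r := RatFn.hasLog (fun p hp =>
    hasLog_unbounded hK hc disjoint_compl_left hub hp) hr
  refine (hl.div hlr).congr (fun z hz => ?_)
  have := hr.ne_zero (z := z) (fun hq => hq hz)
  field_simp

/-- Two logs on a preconnected set differ by a constant. -/
theorem log_sub_const {α : Type*} [TopologicalSpace α] {E : Set α} (hE : IsPreconnected E)
    {G H : α → ℂ} (hG : ContinuousOn G E)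
    (hH : ContinuousOn H E) (h : ∀ z ∈ E, Complex.exp (G z) = Complex.exp (H z)) :
    ∃ n : ℤ, ∀ z ∈ E, G z = H z + n * (2 * Real.pi * Complex.I) := by
  have hInteger : ∀ z ∈ E, ∃ n : ℤ, G z = H z + n * (2 * Real.pi * Complex.I) :=
    fun z hz => Complex.exp_eq_exp_iff_exists_int.1 (h z hz)
  choose! m hm using hInteger
  have hmc : ContinuousOn m E := by
    have hc1 : ContinuousOn (fun z => (G z - H z) / (2 * Real.pi * Complex.I)) E :=
      (hG.sub hH).div_const _
    have hc2 : ContinuousOn (fun y => ((m y : ℤ) : ℝ)) E := by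
      have := Complex.continuous_re.comp_continuousOn hc1
      refine this.congr (fun y hy => ?_)
      simp only [Function.comp]
      rw [hm y hy, add_sub_cancel_left, mul_div_cancel_right₀ _ Complex.two_pi_I_ne_zero]
      simp
    exact Int.isClosedEmbedding_coe_real.isEmbedding.continuousOn_iff.2 hc2
  rcases E.eq_empty_or_nonempty with rfl | ⟨a, ha⟩
  · exact ⟨0, by simp⟩
  refine ⟨m a, fun z hz => ?_⟩
  rw [hm z hz, hE.constant hmc hz ha]


theorem circleMap_eq_imp {u : ℂ} {ρ : ℝ} (hρ : 0 < ρ) {a b : ℝ} (h : circleMap u ρ a = circleMap u ρ b) :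
    ∃ n : ℤ, a = b + n * (2 * Real.pi) := by
  simp only [circleMap, add_right_inj] at h
  have hρ' : (ρ : ℂ) ≠ 0 := by exact_mod_cast hρ.ne'
  have h2 := mul_left_cancel₀ hρ' h
  rw [Complex.exp_eq_exp_iff_exists_int] at h2
  obtain ⟨n, hn⟩ := h2
  refine ⟨n, ?_⟩
  have := congrArg Complex.im hn
  simpa using this

/-- a circle point with parameter strictly outside the arc is not on the arc -/
theorem not_mem_arc {u : ℂ} {ρ : ℝ} (hρ : 0 < ρ) {α β γ t : ℝ} (h1 : α ≤ t) (h2 : t ≤ β)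
    (h3 : β < γ) (h4 : γ < α + 2 * Real.pi) : circleMap u ρ γ ≠ circleMap u ρ t := by
  intro h
  obtain ⟨n, hn⟩ := circleMap_eq_imp hρ h
  have hpi := Real.pi_pos
  have a1 : 0 < (n : ℝ) * (2 * Real.pi) := by linarith
  have a2 : (n : ℝ) * (2 * Real.pi) < 1 * (2 * Real.pi) := by linarith
  have b2 : (n : ℝ) < 1 := lt_of_mul_lt_mul_right a2 (by positivity)
  have b1 : (0 : ℝ) < n := pos_of_mul_pos_left a1 (by positivity)
  have c1 : (0:ℤ) < n := by exact_mod_cast b1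
  have c2 : n < (1:ℤ) := by exact_mod_cast b2
  omega

theorem seg_sphere {u p z : ℂ} {ρ : ℝ} (hρ : 0 < ρ) (hp : dist p u = ρ) (hz : z ∈ segment ℝ u p)
    (hzs : dist z u = ρ) : z = p := by
  rw [segment_eq_image_lineMap] at hz
  obtain ⟨t, ht, rfl⟩ := hz
  rw [dist_lineMap_left, dist_comm u p, hp, Real.norm_eq_abs, abs_of_nonneg ht.1] at hzs
  have : t = 1 := by
    have : (t - 1) * ρ = 0 := by linarith
    rcases mul_eq_zero.1 this with h | h <;> linarith
  rw [this]; simp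

theorem seg_closedBall {u p z : ℂ} {ρ : ℝ} (hρ : 0 < ρ) (hp : dist p u = ρ)
    (hz : z ∈ segment ℝ u p) : z ∈ Metric.closedBall u ρ := by
  apply (convex_closedBall u ρ).segment_subset (Metric.mem_closedBall_self hρ.le) _ hz
  rw [Metric.mem_closedBall, hp]

def Touch (A : Set ℂ) (u : ℂ) (ρ θ : ℝ) : Prop := A ∩ Metric.closedBall u ρ = {circleMap u ρ θ}

theorem dist_circleMap {u : ℂ} {ρ : ℝ} (hρ : 0 < ρ) (θ : ℝ) : dist (circleMap u ρ θ) u = ρ := by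
  exact circleMap_mem_sphere u hρ.le θ

theorem Touch.mem {A : Set ℂ} {u : ℂ} {ρ θ : ℝ} (h : Touch A u ρ θ) : circleMap u ρ θ ∈ A := by
  have : circleMap u ρ θ ∈ A ∩ Metric.closedBall u ρ := by rw [h]; rfl
  exact this.1

theorem Touch.eq {A : Set ℂ} {u : ℂ} {ρ θ : ℝ} (h : Touch A u ρ θ) {z : ℂ} (hz : z ∈ A)
    (hz' : z ∈ Metric.closedBall u ρ) : z = circleMap u ρ θ := by
  have : z ∈ A ∩ Metric.closedBall u ρ := ⟨hz, hz'⟩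
  rw [h] at this; exact this

theorem theta_log {A B C : Set ℂ} (hA : IsCompact A) (hB : IsCompact B) (hC : IsConnected C)
    (hAC : Disjoint A C) (hBC : Disjoint B C) {u v : ℂ} {ρ : ℝ} (hρ : 0 < ρ)
    (huv : Disjoint (Metric.closedBall u ρ) (Metric.closedBall v ρ))
    {α β γ α' β' γ' : ℝ} (tA : Touch A u ρ α) (tB : Touch B u ρ β) (tC : Touch C u ρ γ)
    (tA' : Touch A v ρ α') (tB' : Touch B v ρ β') (tC' : Touch C v ρ γ')
    (h1 : α < β) (h2 : β < γ) (h3 : γ < α + 2 * Real.pi)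
    (h1' : α' < β') (h2' : β' < γ') (h3' : γ' < α' + 2 * Real.pi) {l l' : ℂ → ℂ}
    (hl : ContinuousOn l (Metric.closedBall u ρ))
    (hl2 : ∀ z ∈ Metric.closedBall u ρ, Complex.exp (l z) = z - v)
    (hl' : ContinuousOn l' (Metric.closedBall v ρ))
    (hl2' : ∀ z ∈ Metric.closedBall v ρ, Complex.exp (l' z) = z - u) :
    ∃ G : ℂ → ℂ, ContinuousOn G (A ∪ B) ∧ (∀ z ∈ A ∪ B, Complex.exp (G z) = (z - u) / (z - v)) ∧
      G (circleMap u ρ β) - G (circleMap u ρ α) =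
        (β - α) * Complex.I - (l (circleMap u ρ β) - l (circleMap u ρ α)) ∧
      G (circleMap v ρ β') - G (circleMap v ρ α') =
        -((β' - α') * Complex.I) + (l' (circleMap v ρ β') - l' (circleMap v ρ α')) := by
  have hcm : ∀ (w : ℂ) (θ : ℝ), circleMap w ρ θ ∈ Metric.closedBall w ρ := by
    intro w θ; rw [Metric.mem_closedBall, dist_circleMap hρ]
  set S := C ∪ segment ℝ u (circleMap u ρ γ) ∪ segment ℝ v (circleMap v ρ γ') with hS
  set E := A ∪ B ∪ circleMap u ρ '' Icc α β ∪ circleMap v ρ '' Icc α' β' with hE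
  have hSconn : IsConnected S := by
    apply IsConnected.union _ _ ((convex_segment v _).isConnected ⟨v, left_mem_segment _ _ _⟩)
    · exact ⟨_, Or.inl tC'.mem, right_mem_segment _ _ _⟩
    · apply IsConnected.union _ hC ((convex_segment u _).isConnected ⟨u, left_mem_segment _ _ _⟩)
      exact ⟨_, tC.mem, right_mem_segment _ _ _⟩
  have hEc : IsCompact E :=
    ((hA.union hB).union (isCompact_Icc.image (continuous_circleMap u ρ))).union
      (isCompact_Icc.image (continuous_circleMap v ρ))
  -- general disjointness facts
  have gen : ∀ (w : ℂ) (a b c : ℝ), Touch A w ρ a → Touch B w ρ b → Touch C w ρ c → a < b → b < c →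
      c < a + 2 * Real.pi → (∀ z ∈ segment ℝ w (circleMap w ρ c), z ∉ A ∧ z ∉ B ∧
        z ∉ circleMap w ρ '' Icc a b) ∧ (∀ z ∈ C, z ∉ circleMap w ρ '' Icc a b) := by
    intro w a b c ta tb tc hab hbc hca
    have hne : ∀ t ∈ Icc a b, circleMap w ρ c ≠ circleMap w ρ t :=
      fun t ht => not_mem_arc hρ ht.1 ht.2 hbc hca
    have hon : ∀ z ∈ segment ℝ w (circleMap w ρ c), ∀ t ∈ Icc a b, z ≠ circleMap w ρ t := by
      rintro z hz t ht rfl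
      exact hne t ht (seg_sphere hρ (dist_circleMap hρ c) hz (dist_circleMap hρ t)).symm
    refine ⟨fun z hz => ⟨fun hzA => ?_, fun hzB => ?_, ?_⟩, ?_⟩
    · exact hon z hz a ⟨le_rfl, hab.le⟩ (ta.eq hzA (seg_closedBall hρ (dist_circleMap hρ c) hz))
    · exact hon z hz b ⟨hab.le, le_rfl⟩ (tb.eq hzB (seg_closedBall hρ (dist_circleMap hρ c) hz))
    · rintro ⟨t, ht, rfl⟩; exact hon _ hz t ht rfl
    · rintro z hz ⟨t, ht, rfl⟩
      exact hne t ht (tc.eq hz (hcm _ _)).symm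
  obtain ⟨g1, g2⟩ := gen u α β γ tA tB tC h1 h2 h3
  obtain ⟨g1', g2'⟩ := gen v α' β' γ' tA' tB' tC' h1' h2' h3'
  have hSE : Disjoint S E := by
    rw [Set.disjoint_left]
    rintro z ((hz | hz) | hz) (((hz' | hz') | hz') | hz')
    · exact Set.disjoint_left.1 hAC hz' hz
    · exact Set.disjoint_left.1 hBC hz' hz
    · exact g2 z hz hz'
    · exact g2' z hz hz'
    · exact (g1 z hz).1 hz'
    · exact (g1 z hz).2.1 hz'
    · exact (g1 z hz).2.2 hz'
    · obtain ⟨t, ht, rfl⟩ := hz'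
      exact Set.disjoint_left.1 huv (seg_closedBall hρ (dist_circleMap hρ _) hz) (hcm _ _)
    · exact (g1' z hz).1 hz'
    · exact (g1' z hz).2.1 hz'
    · obtain ⟨t, ht, rfl⟩ := hz'
      exact Set.disjoint_left.1 huv (hcm _ _) (seg_closedBall hρ (dist_circleMap hρ _) hz)
    · exact (g1' z hz).2.2 hz'
  obtain ⟨G, hG, hG2⟩ := hasLog_move hEc.isClosed hSconn.isPreconnected hSE
    (q1 := u) (q2 := v) (Or.inl (Or.inr (left_mem_segment _ _ _))) (Or.inr (left_mem_segment _ _ _))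
  have hρ0 : (ρ : ℂ) ≠ 0 := by exact_mod_cast hρ.ne'
  have hsub : ∀ (w : ℂ) (t : ℝ), circleMap w ρ t - w = Complex.exp (Complex.log ρ + t * Complex.I) := by
    intro w t
    rw [Complex.exp_add, Complex.exp_log hρ0]; simp [circleMap]
  refine ⟨G, hG.mono (fun z hz => Or.inl (Or.inl hz)), fun z hz => hG2 z (Or.inl (Or.inl hz)), ?_, ?_⟩
  · obtain ⟨n, hn⟩ := log_sub_const (E := Icc α β) isPreconnected_Icc
      (G := fun t : ℝ => G (circleMap u ρ t))
      (H := fun t : ℝ => (Complex.log ρ + t * Complex.I) - l (circleMap u ρ t))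
      (hG.comp (continuous_circleMap u ρ).continuousOn
        (fun t ht => Or.inl (Or.inr ⟨t, ht, rfl⟩)))
      ((by fun_prop : ContinuousOn (fun t : ℝ => (Complex.log ρ + t * Complex.I)) (Icc α β)).sub
        (hl.comp (continuous_circleMap u ρ).continuousOn (fun t _ => hcm u t)))
      (by
        intro t ht
        rw [hG2 _ (Or.inl (Or.inr ⟨t, ht, rfl⟩)), Complex.exp_sub, hl2 _ (hcm u t), ← hsub u t])
    have e1 := hn α ⟨le_rfl, h1.le⟩
    have e2 := hn β ⟨h1.le, le_rfl⟩
    rw [e1, e2]; ring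
  · obtain ⟨n, hn⟩ := log_sub_const (E := Icc α' β') isPreconnected_Icc
      (G := fun t : ℝ => G (circleMap v ρ t))
      (H := fun t : ℝ => l' (circleMap v ρ t) - (Complex.log ρ + t * Complex.I))
      (hG.comp (continuous_circleMap v ρ).continuousOn
        (fun t ht => Or.inr ⟨t, ht, rfl⟩))
      ((hl'.comp (continuous_circleMap v ρ).continuousOn (fun t _ => hcm v t)).sub
        (by fun_prop : ContinuousOn (fun t : ℝ => (Complex.log ρ + t * Complex.I)) (Icc α' β')))
      (by
        intro t ht
        rw [hG2 _ (Or.inr ⟨t, ht, rfl⟩), Complex.exp_sub, hl2' _ (hcm v t), ← hsub v t])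
    have e1 := hn α' ⟨le_rfl, h1'.le⟩
    have e2 := hn β' ⟨h1'.le, le_rfl⟩
    rw [e1, e2]; ring

theorem Touch.shift {A : Set ℂ} {u : ℂ} {ρ θ : ℝ} (h : Touch A u ρ θ) :
    Touch A u ρ (θ + 2 * Real.pi) := by
  rw [Touch, periodic_circleMap]; exact h

theorem theta_core {A B C : Set ℂ} (hA : IsCompact A) (hB : IsCompact B) (hC : IsCompact C)
    (cA : IsConnected A) (cB : IsConnected B) (cC : IsConnected C)
    (hAB : Disjoint A B) (hAC : Disjoint A C) (hBC : Disjoint B C) {u v : ℂ} {ρ : ℝ} (hρ : 0 < ρ)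
    (huv : Disjoint (Metric.closedBall u ρ) (Metric.closedBall v ρ))
    {α β γ α' β' γ' : ℝ} (tA : Touch A u ρ α) (tB : Touch B u ρ β) (tC : Touch C u ρ γ)
    (tA' : Touch A v ρ α') (tB' : Touch B v ρ β') (tC' : Touch C v ρ γ')
    (h1 : α < β) (h2 : β < γ) (h3 : γ < α + 2 * Real.pi)
    (h1' : α' < β') (h2' : β' < γ') (h3' : γ' < α' + 2 * Real.pi) : False := by
  have hfar : ∀ a b : ℂ, Disjoint (Metric.closedBall a ρ) (Metric.closedBall b ρ) →
      HasLog (Metric.closedBall a ρ) (fun z => z - b) := by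
    intro a b hab
    have hconn : IsPreconnected (Metric.closedBall b ρ) := (convex_closedBall b ρ).isPreconnected
    have hab2 : a - b ≠ 0 := by
      intro h; rw [sub_eq_zero] at h; subst h
      exact Set.disjoint_left.1 hab (Metric.mem_closedBall_self hρ.le) (Metric.mem_closedBall_self hρ.le)
    have : HasLog (Metric.closedBall a ρ) (fun z => (z - b) / (a - b)) := by
      apply hasLog_of_slit ((by fun_prop : ContinuousOn (fun z : ℂ => z - b) _).div_const _)
      intro z hz
      apply slit_of_near_one
      have : (z - b) / (a - b) - 1 = (z - a) / (a - b) := by field_simp; ring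
      rw [this, norm_div, div_lt_one (norm_pos_iff.2 hab2)]
      rw [Metric.mem_closedBall, dist_eq_norm] at hz
      refine hz.trans_lt ?_
      by_contra hle
      push Not at hle
      have hb2 : b ∉ Metric.closedBall a ρ := fun h => Set.disjoint_left.1 hab h (Metric.mem_closedBall_self hρ.le)
      apply hb2
      rw [Metric.mem_closedBall, dist_comm, dist_eq_norm]; exact hle
    exact (this.mul (hasLog_const _ hab2)).congr (fun z _ => by field_simp)
  obtain ⟨l, hl, hl2⟩ := hfar u v huv
  obtain ⟨l', hl', hl2'⟩ := hfar v u huv.symm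
  obtain ⟨G, g1, g2, g3, g4⟩ := theta_log hA hB cC hAC hBC hρ huv tA tB tC tA' tB' tC' h1 h2 h3 h1' h2' h3'
    hl hl2 hl' hl2'
  obtain ⟨H, k1, k2, k3, k4⟩ := theta_log hB hC cA hAB.symm hAC.symm hρ huv tB tC tA.shift tB' tC' tA'.shift
    h2 h3 (by linarith) h2' h3' (by linarith) hl hl2 hl' hl2'
  obtain ⟨I, i1, i2, i3, i4⟩ := theta_log hC hA cB hBC.symm hAB hρ huv tC tA.shift tB.shift tC' tA'.shift tB'.shift
    h3 (by linarith) (by linarith) h3' (by linarith) (by linarith) hl hl2 hl' hl2'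
  obtain ⟨a, ha⟩ := log_sub_const cA.isPreconnected (g1.mono subset_union_left) (i1.mono subset_union_right)
    (fun z hz => (g2 z (Or.inl hz)).trans (i2 z (Or.inr hz)).symm)
  obtain ⟨b, hb⟩ := log_sub_const cB.isPreconnected (k1.mono subset_union_left) (g1.mono subset_union_right)
    (fun z hz => (k2 z (Or.inl hz)).trans (g2 z (Or.inr hz)).symm)
  obtain ⟨c, hc⟩ := log_sub_const cC.isPreconnected (i1.mono subset_union_left) (k1.mono subset_union_right)
    (fun z hz => (i2 z (Or.inl hz)).trans (k2 z (Or.inr hz)).symm)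
  rw [periodic_circleMap] at i3 i4
  have a1 := ha _ tA.mem
  have a2 := ha _ tA'.mem
  have b1 := hb _ tB.mem
  have b2 := hb _ tB'.mem
  have c1 := hc _ tC.mem
  have c2 := hc _ tC'.mem
  have hpi := Complex.two_pi_I_ne_zero
  have e1 : (-(a + b + c : ℂ)) * (2 * Real.pi * Complex.I) = 1 * (2 * Real.pi * Complex.I) := by
    push_cast at *
    linear_combination g3 + k3 + i3 + a1 + b1 + c1
  have e2 : (-(a + b + c : ℂ)) * (2 * Real.pi * Complex.I) = (-1) * (2 * Real.pi * Complex.I) := by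
    push_cast at *
    linear_combination g4 + k4 + i4 + a2 + b2 + c2
  have e3 := mul_right_cancel₀ hpi (e1.symm.trans e2)
  norm_num at e3


section topo
variable {α : Type*} [TopologicalSpace α] [T2Space α]

theorem exists_clopen_avoid {F T : Set α} (hF : IsCompact F) {x : α} (hx : x ∈ F) (hT : IsClosed T)
    (hd : Disjoint (connectedComponentIn F x) T) :
    ∃ Q ⊆ F, x ∈ Q ∧ IsClosed Q ∧ IsClosed (F \ Q) ∧ Disjoint Q T := by
  haveI : CompactSpace F := isCompact_iff_compactSpace.1 hF
  have hcc : connectedComponentIn F x = Subtype.val '' connectedComponent (⟨x, hx⟩ : F) :=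
    connectedComponentIn_eq_image hx
  have hT' : IsCompact ((Subtype.val : F → α) ⁻¹' T) := (hT.preimage continuous_subtype_val).isCompact
  haveI : Nonempty { s : Set F // IsClopen s ∧ (⟨x, hx⟩ : F) ∈ s } := ⟨⟨univ, isClopen_univ, trivial⟩⟩
  obtain ⟨⟨Z, hZ, hxZ⟩, hZT⟩ := hT'.elim_directed_family_closed
    (fun s : { s : Set F // IsClopen s ∧ (⟨x, hx⟩ : F) ∈ s } => (s : Set F)) (fun s => s.2.1.1)
    (by
      rw [← connectedComponent_eq_iInter_isClopen]
      ext y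
      simp only [mem_inter_iff, mem_preimage, mem_empty_iff_false, iff_false, not_and]
      intro hy hyc
      exact Set.disjoint_left.1 hd (by rw [hcc]; exact ⟨y, hyc, rfl⟩) hy)
    (by
      rintro ⟨a, ha, hxa⟩ ⟨b, hb, hxb⟩
      exact ⟨⟨a ∩ b, ha.inter hb, hxa, hxb⟩, inter_subset_left, inter_subset_right⟩)
  refine ⟨Subtype.val '' Z, ?_, ⟨_, hxZ, rfl⟩, ?_, ?_, ?_⟩
  · rintro _ ⟨y, _, rfl⟩; exact y.2
  · exact (hZ.1.isCompact.image continuous_subtype_val).isClosed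
  · have : F \ Subtype.val '' Z = Subtype.val '' Zᶜ := by
      ext y; constructor
      · rintro ⟨hy, hy'⟩; exact ⟨⟨y, hy⟩, fun h => hy' ⟨_, h, rfl⟩, rfl⟩
      · rintro ⟨y, hy, rfl⟩
        refine ⟨y.2, ?_⟩
        rintro ⟨w, hw, hwy⟩
        exact hy (by rwa [← Subtype.val_injective hwy])
    rw [this]
    exact (hZ.2.isClosed_compl.isCompact.image continuous_subtype_val).isClosed
  · rw [Set.disjoint_left]
    rintro _ ⟨y, hy, rfl⟩ hyT
    have : y ∈ ((Subtype.val : F → α) ⁻¹' T) ∩ Z := ⟨hyT, hy⟩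
    rw [hZT] at this; exact this

theorem pc_split {S P Q : Set α} (hS : IsPreconnected S) (hP : IsClosed P) (hQ : IsClosed Q)
    (hSPQ : S ⊆ P ∪ Q) (hd : Disjoint P Q) {x : α} (hx : x ∈ S) (hxP : x ∈ P) : S ⊆ P := by
  rcases isPreconnected_iff_subset_of_disjoint_closed.1 hS P Q hP hQ hSPQ
    (by rw [hd.inter_eq, inter_empty]) with h | h
  · exact h
  · exact absurd (h hx) (Set.disjoint_left.1 hd hxP)

theorem sInter_chain_preconnected {c : Set (Set α)} (hc : IsChain (· ⊆ ·) c) (hne : c.Nonempty)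
    (hcomp : ∀ s ∈ c, IsCompact s) (hconn : ∀ s ∈ c, IsPreconnected s) : IsPreconnected (⋂₀ c) := by
  rw [isPreconnected_closed_iff]
  intro t t' ht ht' hsub h1 h2
  by_contra hcon
  rw [not_nonempty_iff_eq_empty] at hcon
  have hSc : IsClosed (⋂₀ c) := isClosed_sInter (fun s hs => (hcomp s hs).isClosed)
  obtain ⟨s0, hs0⟩ := hne
  have hScomp : IsCompact (⋂₀ c) := (hcomp s0 hs0).of_isClosed_subset hSc (sInter_subset_of_mem hs0)
  have hd : Disjoint (⋂₀ c ∩ t) (⋂₀ c ∩ t') := by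
    rw [Set.disjoint_left]
    rintro z ⟨hz, hz1⟩ ⟨_, hz2⟩
    have : z ∈ ⋂₀ c ∩ (t ∩ t') := ⟨hz, hz1, hz2⟩
    rw [hcon] at this; exact this
  obtain ⟨U, V, hU, hV, hUs, hVs, hUV⟩ :=
    SeparatedNhds.of_isCompact_isCompact (hScomp.inter_right ht) (hScomp.inter_right ht') hd
  haveI : Nonempty c := ⟨⟨s0, hs0⟩⟩
  obtain ⟨⟨s, hs⟩, hsUV⟩ := exists_subset_nhds_of_isCompact' (V := fun s : c => (s : Set α))
    (by
      rintro ⟨a, ha⟩ ⟨b, hb⟩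
      rcases hc.total ha hb with h | h
      · exact ⟨⟨a, ha⟩, subset_rfl, h⟩
      · exact ⟨⟨b, hb⟩, h, subset_rfl⟩)
    (fun s => hcomp _ s.2) (fun s => (hcomp _ s.2).isClosed) (U := U ∪ V)
    (by
      intro x hx
      rw [← sInter_eq_iInter] at hx
      apply (hU.union hV).mem_nhds
      rcases hsub hx with h | h
      · exact Or.inl (hUs ⟨hx, h⟩)
      · exact Or.inr (hVs ⟨hx, h⟩))
  obtain ⟨a, ha, hat⟩ := h1
  obtain ⟨b, hb, hbt⟩ := h2
  obtain ⟨z, _, hz1, hz2⟩ := hconn s hs U V hU hV hsUV ⟨a, mem_sInter.1 ha s hs, hUs ⟨ha, hat⟩⟩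
    ⟨b, mem_sInter.1 hb s hs, hVs ⟨hb, hbt⟩⟩
  exact Set.disjoint_left.1 hUV hz1 hz2

theorem minimal_continuum {β X Y : Set α} (hβ : IsCompact β) (hc : IsPreconnected β)
    (hX : IsClosed X) (hY : IsClosed Y) (hβX : (β ∩ X).Nonempty) (hβY : (β ∩ Y).Nonempty) :
    ∃ β' ⊆ β, IsCompact β' ∧ IsPreconnected β' ∧ (β' ∩ X).Nonempty ∧ (β' ∩ Y).Nonempty ∧
      ∀ γ ⊆ β', IsCompact γ → IsPreconnected γ → (γ ∩ X).Nonempty → (γ ∩ Y).Nonempty → β' ⊆ γ := by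
  obtain ⟨m, hm, hmin⟩ := zorn_superset_nonempty
    {γ : Set α | IsCompact γ ∧ IsPreconnected γ ∧ (γ ∩ X).Nonempty ∧ (γ ∩ Y).Nonempty} (by
      intro c hcS hch hne
      haveI : Nonempty c := hne.to_subtype
      have hdir : ∀ T : Set α, Directed (· ⊇ ·) (fun s : c => (s : Set α) ∩ T) := by
        rintro T ⟨a, ha⟩ ⟨b, hb⟩
        rcases hch.total ha hb with h | h
        · exact ⟨⟨a, ha⟩, subset_rfl, inter_subset_inter_left _ h⟩
        · exact ⟨⟨b, hb⟩, inter_subset_inter_left _ h, subset_rfl⟩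
      have hmeet : ∀ T : Set α, IsClosed T → (∀ s ∈ c, (s ∩ T).Nonempty) → (⋂₀ c ∩ T).Nonempty := by
        intro T hT hT2
        obtain ⟨z, hz⟩ := IsCompact.nonempty_iInter_of_directed_nonempty_isCompact_isClosed
          (fun s : c => (s : Set α) ∩ T) (hdir T) (fun s => hT2 s s.2)
          (fun s => (hcS s.2).1.inter_right hT) (fun s => (hcS s.2).1.isClosed.inter hT)
        rw [mem_iInter] at hz
        obtain ⟨s0, hs0⟩ := hne
        exact ⟨z, mem_sInter.2 (fun s hs => (hz ⟨s, hs⟩).1), (hz ⟨s0, hs0⟩).2⟩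
      obtain ⟨s0, hs0⟩ := hne
      refine ⟨⋂₀ c, ⟨?_, ?_, ?_, ?_⟩, fun s hs => sInter_subset_of_mem hs⟩
      · exact (hcS hs0).1.of_isClosed_subset (isClosed_sInter (fun s hs => (hcS hs).1.isClosed))
          (sInter_subset_of_mem hs0)
      · exact sInter_chain_preconnected hch ⟨s0, hs0⟩ (fun s hs => (hcS hs).1) (fun s hs => (hcS hs).2.1)
      · exact hmeet X hX (fun s hs => (hcS hs).2.2.1)
      · exact hmeet Y hY (fun s hs => (hcS hs).2.2.2)) β ⟨hβ, hc, hβX, hβY⟩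
  exact ⟨m, hm, hmin.1.1, hmin.1.2.1, hmin.1.2.2.1, hmin.1.2.2.2,
    fun γ hγ h1 h2 h3 h4 => hmin.2 ⟨h1, h2, h3, h4⟩ hγ⟩

/-- boundary bumping -/
theorem boundary_bump {β B T : Set α} (hβ : IsCompact β) (hc : IsPreconnected β) (hB : IsOpen B)
    (hT : IsClosed T) (hBT : B ⊆ T) {x : α} (hx : x ∈ β) (hxT : x ∉ T) (hne : (β ∩ B).Nonempty) :
    (connectedComponentIn (β \ B) x ∩ T).Nonempty := by
  by_contra hcon
  rw [not_nonempty_iff_eq_empty, ← disjoint_iff_inter_eq_empty] at hcon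
  obtain ⟨Q, hQ, hxQ, hQc, hQc', hQT⟩ := exists_clopen_avoid (hβ.diff hB) ⟨hx, fun h => hxT (hBT h)⟩ hT hcon
  have : β ⊆ Q := by
    apply pc_split hc hQc (Q := (β \ B) \ Q ∪ (β ∩ T)) (hQc'.union (hβ.isClosed.inter hT)) _ _ hx hxQ
    · intro y hy
      by_cases hyQ : y ∈ Q
      · exact Or.inl hyQ
      · by_cases hyB : y ∈ B
        · exact Or.inr (Or.inr ⟨hy, hBT hyB⟩)
        · exact Or.inr (Or.inl ⟨⟨hy, hyB⟩, hyQ⟩)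
    · rw [Set.disjoint_left]
      rintro y hy (h | h)
      · exact h.2 hy
      · exact Set.disjoint_left.1 hQT hy h.2
  obtain ⟨y, hy, hyB⟩ := hne
  exact (hQ (this hy)).2 hyB
end topo

theorem theta_orient {u : ℂ} {ρ : ℝ} (hρ : 0 < ρ) {a b c : ℂ} (ha : dist a u = ρ)
    (hb : dist b u = ρ) (hc : dist c u = ρ) (hab : a ≠ b) (hac : a ≠ c) (hbc : b ≠ c) :
    ∃ α β γ : ℝ, circleMap u ρ α = a ∧ circleMap u ρ β = b ∧ circleMap u ρ γ = c ∧
      ((α < β ∧ β < γ ∧ γ < α + 2 * Real.pi) ∨ (α < γ ∧ γ < β ∧ β < α + 2 * Real.pi)) := by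
  have hex : ∀ p, dist p u = ρ → ∃ θ, circleMap u ρ θ = p := by
    intro p hp
    have : p ∈ range (circleMap u ρ) := by
      rw [range_circleMap, abs_of_pos hρ]; exact hp
    exact this
  obtain ⟨α, rfl⟩ := hex a ha
  have hex2 : ∀ p, dist p u = ρ → circleMap u ρ α ≠ p →
      ∃ θ, circleMap u ρ θ = p ∧ α < θ ∧ θ < α + 2 * Real.pi := by
    intro p hp hne
    obtain ⟨θ, rfl⟩ := hex p hp
    have h1 : circleMap u ρ (toIocMod Real.two_pi_pos α θ) = circleMap u ρ θ := by
      rw [toIocMod, (periodic_circleMap u ρ).sub_zsmul_eq]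
    refine ⟨_, h1, (toIocMod_mem_Ioc Real.two_pi_pos α θ).1,
      lt_of_le_of_ne (toIocMod_mem_Ioc Real.two_pi_pos α θ).2 ?_⟩
    intro h
    rw [h, periodic_circleMap] at h1
    exact hne h1
  obtain ⟨β, rfl, hβ1, hβ2⟩ := hex2 b hb hab
  obtain ⟨γ, rfl, hγ1, hγ2⟩ := hex2 c hc hac
  refine ⟨α, β, γ, rfl, rfl, rfl, ?_⟩
  rcases lt_trichotomy β γ with h | h | h
  · exact Or.inl ⟨hβ1, h, hγ2⟩
  · exact absurd (by rw [h]) hbc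
  · exact Or.inr ⟨hγ1, h, hβ2⟩

theorem theta_pigeon {A B C : Set ℂ} (hA : IsCompact A) (hB : IsCompact B) (hC : IsCompact C)
    (cA : IsConnected A) (cB : IsConnected B) (cC : IsConnected C)
    (hAB : Disjoint A B) (hAC : Disjoint A C) (hBC : Disjoint B C) {u : Fin 3 → ℂ} {ρ : ℝ} (hρ : 0 < ρ)
    (huv : ∀ i j, i ≠ j → Disjoint (Metric.closedBall (u i) ρ) (Metric.closedBall (u j) ρ))
    (tA : ∀ i, ∃ p, dist p (u i) = ρ ∧ A ∩ Metric.closedBall (u i) ρ = {p})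
    (tB : ∀ i, ∃ p, dist p (u i) = ρ ∧ B ∩ Metric.closedBall (u i) ρ = {p})
    (tC : ∀ i, ∃ p, dist p (u i) = ρ ∧ C ∩ Metric.closedBall (u i) ρ = {p}) : False := by
  choose a ha ha' using tA
  choose b hb hb' using tB
  choose c hc hc' using tC
  have hor : ∀ i, (∃ α β γ : ℝ, Touch A (u i) ρ α ∧ Touch B (u i) ρ β ∧ Touch C (u i) ρ γ ∧
      α < β ∧ β < γ ∧ γ < α + 2 * Real.pi) ∨ (∃ α β γ : ℝ, Touch A (u i) ρ α ∧ Touch B (u i) ρ β ∧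
      Touch C (u i) ρ γ ∧ α < γ ∧ γ < β ∧ β < α + 2 * Real.pi) := by
    intro i
    have mem : ∀ (S : Set ℂ) p, S ∩ Metric.closedBall (u i) ρ = {p} → p ∈ S := by
      intro S p h
      have : p ∈ S ∩ Metric.closedBall (u i) ρ := by rw [h]; rfl
      exact this.1
    have ma := mem _ _ (ha' i)
    have mb := mem _ _ (hb' i)
    have mc := mem _ _ (hc' i)
    obtain ⟨α, β, γ, e1, e2, e3, h⟩ := theta_orient hρ (ha i) (hb i) (hc i)
      (fun h => Set.disjoint_left.1 hAB ma (h ▸ mb)) (fun h => Set.disjoint_left.1 hAC ma (h ▸ mc))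
      (fun h => Set.disjoint_left.1 hBC mb (h ▸ mc))
    have t1 : Touch A (u i) ρ α := by rw [Touch, e1]; exact ha' i
    have t2 : Touch B (u i) ρ β := by rw [Touch, e2]; exact hb' i
    have t3 : Touch C (u i) ρ γ := by rw [Touch, e3]; exact hc' i
    rcases h with h | h
    · exact Or.inl ⟨α, β, γ, t1, t2, t3, h⟩
    · exact Or.inr ⟨α, β, γ, t1, t2, t3, h⟩
  have pos : ∀ i j, i ≠ j → (∃ α β γ : ℝ, Touch A (u i) ρ α ∧ Touch B (u i) ρ β ∧ Touch C (u i) ρ γ ∧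
      α < β ∧ β < γ ∧ γ < α + 2 * Real.pi) → (∃ α β γ : ℝ, Touch A (u j) ρ α ∧ Touch B (u j) ρ β ∧
      Touch C (u j) ρ γ ∧ α < β ∧ β < γ ∧ γ < α + 2 * Real.pi) → False := by
    rintro i j hij ⟨α, β, γ, t1, t2, t3, h1, h2, h3⟩ ⟨α', β', γ', t1', t2', t3', h1', h2', h3'⟩
    exact theta_core hA hB hC cA cB cC hAB hAC hBC hρ (huv i j hij) t1 t2 t3 t1' t2' t3' h1 h2 h3 h1' h2' h3'
  have neg : ∀ i j, i ≠ j → (∃ α β γ : ℝ, Touch A (u i) ρ α ∧ Touch B (u i) ρ β ∧ Touch C (u i) ρ γ ∧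
      α < γ ∧ γ < β ∧ β < α + 2 * Real.pi) → (∃ α β γ : ℝ, Touch A (u j) ρ α ∧ Touch B (u j) ρ β ∧
      Touch C (u j) ρ γ ∧ α < γ ∧ γ < β ∧ β < α + 2 * Real.pi) → False := by
    rintro i j hij ⟨α, β, γ, t1, t2, t3, h1, h2, h3⟩ ⟨α', β', γ', t1', t2', t3', h1', h2', h3'⟩
    exact theta_core hA hC hB cA cC cB hAC hAB hBC.symm hρ (huv i j hij) t1 t3 t2 t1' t3' t2' h1 h2 h3 h1' h2' h3'
  rcases hor 0 with h0 | h0 <;> rcases hor 1 with h1 | h1 <;> rcases hor 2 with h2 | h2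
  · exact pos 0 1 (by decide) h0 h1
  · exact pos 0 1 (by decide) h0 h1
  · exact pos 0 2 (by decide) h0 h2
  · exact neg 1 2 (by decide) h1 h2
  · exact pos 1 2 (by decide) h1 h2
  · exact neg 0 2 (by decide) h0 h2
  · exact neg 0 1 (by decide) h0 h1
  · exact neg 0 1 (by decide) h0 h1


theorem cc_closed {α : Type*} [TopologicalSpace α] {F : Set α} (hF : IsClosed F) (x : α) :
    IsClosed (connectedComponentIn F x) := by
  by_cases hx : x ∈ F
  · apply isClosed_of_closure_subset
    apply IsPreconnected.subset_connectedComponentIn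
    · exact isPreconnected_connectedComponentIn.closure
    · exact subset_closure (mem_connectedComponentIn hx)
    · exact closure_minimal (connectedComponentIn_subset _ _) hF
  · rw [connectedComponentIn_eq_empty hx]; exact isClosed_empty

theorem theta_arms {u : Fin 3 → ℂ} {ρ : ℝ} (hρ : 0 < ρ)
    (huv : ∀ i j, i ≠ j → Disjoint (Metric.closedBall (u i) ρ) (Metric.closedBall (u j) ρ))
    {X : Fin 3 → Set ℂ} {a : Fin 3 → Fin 3 → Set ℂ}
    (hX : ∀ k, IsCompact (X k)) (cX : ∀ k, IsConnected (X k))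
    (ha : ∀ k i, IsCompact (a k i)) (ca : ∀ k i, IsConnected (a k i))
    (haX : ∀ k i, (X k ∩ a k i).Nonempty)
    (dXX : ∀ k l, k ≠ l → Disjoint (X k) (X l))
    (daX : ∀ k l i, k ≠ l → Disjoint (a k i) (X l))
    (daa : ∀ k l i j, k ≠ l → Disjoint (a k i) (a l j))
    (bX : ∀ k i, Disjoint (X k) (Metric.closedBall (u i) ρ))
    (ba : ∀ k i j, i ≠ j → Disjoint (a k i) (Metric.closedBall (u j) ρ))
    (ta : ∀ k i, ∃ p, dist p (u i) = ρ ∧ a k i ∩ Metric.closedBall (u i) ρ = {p}) : False := by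
  set A : Fin 3 → Set ℂ := fun k => X k ∪ ⋃ i, a k i with hA
  have comp : ∀ k, IsCompact (A k) := fun k => (hX k).union (isCompact_iUnion (ha k))
  have conn : ∀ k, IsConnected (A k) := by
    intro k
    have : A k = ⋃ i, (X k ∪ a k i) := by
      rw [hA]; simp only; rw [iUnion_union_distrib, iUnion_const]
    rw [this]
    refine ⟨?_, ?_⟩
    · obtain ⟨x, hx⟩ := (cX k).1
      exact ⟨x, mem_iUnion.2 ⟨0, Or.inl hx⟩⟩
    · obtain ⟨x, hx⟩ := (cX k).1
      exact isPreconnected_iUnion ⟨x, mem_iInter.2 (fun i => Or.inl hx)⟩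
        (fun i => ((cX k).union (haX k i) (ca k i)).2)
  have disj : ∀ k l, k ≠ l → Disjoint (A k) (A l) := by
    intro k l hkl
    simp only [hA, disjoint_union_left, disjoint_union_right, disjoint_iUnion_left,
      disjoint_iUnion_right]
    exact ⟨⟨dXX k l hkl, fun i => daX k l i hkl⟩, fun i => ⟨(daX l k i hkl.symm).symm,
      fun j => daa k l j i hkl⟩⟩
  have touch : ∀ k i, ∃ p, dist p (u i) = ρ ∧ A k ∩ Metric.closedBall (u i) ρ = {p} := by
    intro k i
    obtain ⟨p, hp, hp'⟩ := ta k i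
    refine ⟨p, hp, ?_⟩
    rw [← hp']
    ext w
    constructor
    · rintro ⟨hw | hw, hw2⟩
      · exact absurd hw2 (Set.disjoint_left.1 (bX k i) hw)
      · obtain ⟨j, hj⟩ := mem_iUnion.1 hw
        by_cases hij : j = i
        · subst hij; exact ⟨hj, hw2⟩
        · exact absurd hw2 (Set.disjoint_left.1 (ba k j i hij) hj)
    · rintro ⟨hw, hw2⟩
      exact ⟨Or.inr (mem_iUnion.2 ⟨i, hw⟩), hw2⟩
  exact theta_pigeon (comp 0) (comp 1) (comp 2) (conn 0) (conn 1) (conn 2) (disj 0 1 (by decide))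
    (disj 0 2 (by decide)) (disj 1 2 (by decide)) hρ huv (touch 0) (touch 1) (touch 2)

def cray (u e : ℂ) (a b : ℝ) : Set ℂ := (fun t : ℝ => u + t * e) '' Icc a b

theorem cray_compact (u e : ℂ) (a b : ℝ) : IsCompact (cray u e a b) :=
  isCompact_Icc.image (by fun_prop)

theorem cray_connected (u e : ℂ) {a b : ℝ} (h : a ≤ b) : IsConnected (cray u e a b) :=
  (isConnected_Icc h).image _ (by fun_prop)

theorem cray_dist {u e : ℂ} (he : ‖e‖ = 1) {t : ℝ} (ht : 0 ≤ t) : dist (u + t * e) u = t := by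
  simp [dist_eq_norm, he, abs_of_nonneg ht]

theorem cray_touch {u e : ℂ} (he : ‖e‖ = 1) {a b : ℝ} (ha : 0 < a) (h : a ≤ b) :
    cray u e a b ∩ Metric.closedBall u a = {u + a * e} := by
  ext w
  constructor
  · rintro ⟨⟨t, ht, rfl⟩, hw⟩
    simp only [Metric.mem_closedBall] at hw
    rw [cray_dist he (ha.le.trans ht.1)] at hw
    have : t = a := le_antisymm hw ht.1
    subst this; rfl
  · rintro rfl
    exact ⟨⟨a, ⟨le_rfl, h⟩, rfl⟩, by rw [Metric.mem_closedBall, cray_dist he ha.le]⟩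

theorem cray_disjoint {u e e' : ℂ} (he : ‖e‖ = 1) (he' : ‖e'‖ = 1) {a b a' b' : ℝ} (ha : 0 < a)
    (ha' : 0 < a') (hne : e ≠ e') : Disjoint (cray u e a b) (cray u e' a' b') := by
  rw [Set.disjoint_left]
  rintro w ⟨t, ht, rfl⟩ ⟨s, hs, hw⟩
  have h1 := cray_dist (u := u) he (ha.le.trans ht.1)
  have h2 := cray_dist (u := u) he' (ha'.le.trans hs.1)
  have h3 : t = s := by rw [← h1, ← h2]; simp only at hw; rw [hw]
  subst h3
  simp only [add_right_inj] at hw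
  have h0 : (t : ℂ) ≠ 0 := by exact_mod_cast (ha.trans_le ht.1).ne'
  exact hne (mul_left_cancel₀ h0 hw).symm

/-- The two arms of a minimal continuum cut at an inner point. -/
theorem arm_setup {β X Y : Set ℂ} {u : ℂ} {r : ℝ} (hβ : IsCompact β) (hc : IsPreconnected β)
    (hX : (β ∩ X).Nonempty) (hY : (β ∩ Y).Nonempty) (hu : u ∈ β) (hr : 0 < r)
    (hmin : ∀ γ ⊆ β, IsCompact γ → IsPreconnected γ → (γ ∩ X).Nonempty → (γ ∩ Y).Nonempty → β ⊆ γ)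
    (hXr : Disjoint X (Metric.closedBall u r)) (hYr : Disjoint Y (Metric.closedBall u r)) :
    ∃ κ κ' : Set ℂ, ∃ e e' : ℂ, κ ⊆ β \ Metric.ball u r ∧ κ' ⊆ β \ Metric.ball u r ∧
      IsCompact κ ∧ IsCompact κ' ∧ IsConnected κ ∧ IsConnected κ' ∧
      (κ ∩ X).Nonempty ∧ (κ' ∩ Y).Nonempty ∧ Disjoint κ Y ∧ Disjoint κ' X ∧ Disjoint κ κ' ∧
      ‖e‖ = 1 ∧ ‖e'‖ = 1 ∧ u + r * e ∈ κ ∧ u + r * e' ∈ κ' := by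
  obtain ⟨x, hxβ, hxX⟩ := hX
  obtain ⟨y, hyβ, hyY⟩ := hY
  set F := β \ Metric.ball u r with hF
  have hFc : IsCompact F := hβ.diff Metric.isOpen_ball
  have nb : ∀ S : Set ℂ, Disjoint S (Metric.closedBall u r) → ∀ w ∈ S, w ∉ Metric.closedBall u r :=
    fun S h w hw => Set.disjoint_left.1 h hw
  have hxF : x ∈ F := ⟨hxβ, fun h => nb X hXr x hxX (Metric.ball_subset_closedBall h)⟩
  have hyF : y ∈ F := ⟨hyβ, fun h => nb Y hYr y hyY (Metric.ball_subset_closedBall h)⟩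
  have hne : (β ∩ Metric.ball u r).Nonempty := ⟨u, hu, Metric.mem_ball_self hr⟩
  have ccomp : ∀ w, IsCompact (connectedComponentIn F w) := by
    intro w
    exact hFc.of_isClosed_subset (cc_closed hFc.isClosed w) (connectedComponentIn_subset _ _)
  have uni : ∀ w ∈ F, ∀ z, dist z u = r → z ∈ connectedComponentIn F w →
     ∃ e : ℂ, ‖e‖ = 1 ∧ u + r * e ∈ connectedComponentIn F w := by
    intro w hw z hz hzw
    refine ⟨(z - u) / r, ?_, ?_⟩
    · rw [norm_div, ← dist_eq_norm, hz]; simp [abs_of_pos hr, hr.ne']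
    · have : (r : ℂ) ≠ 0 := by exact_mod_cast hr.ne'
      rw [mul_div_cancel₀ _ this]; simpa using hzw
  have get : ∀ w ∈ F, w ∉ Metric.closedBall u r →
      ∃ e : ℂ, ‖e‖ = 1 ∧ u + r * e ∈ connectedComponentIn F w := by
    intro w hw hwr
    obtain ⟨z, hz1, hz2⟩ := boundary_bump hβ hc Metric.isOpen_ball Metric.isClosed_closedBall
      Metric.ball_subset_closedBall hw.1 hwr hne
    apply uni w hw z _ hz1
    have := (connectedComponentIn_subset _ _ hz1).2
    rw [Metric.mem_ball, not_lt] at this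
    exact le_antisymm hz2 this
  have nomeet : ∀ w, ¬ ((connectedComponentIn F w ∩ X).Nonempty ∧
      (connectedComponentIn F w ∩ Y).Nonempty) := by
    rintro w ⟨h1, h2⟩
    have := hmin _ ((connectedComponentIn_subset F w).trans sdiff_subset) (ccomp w)
      isPreconnected_connectedComponentIn h1 h2 hu
    exact (connectedComponentIn_subset _ _ this).2 (Metric.mem_ball_self hr)
  obtain ⟨e, he, heκ⟩ := get x hxF (nb X hXr x hxX)
  obtain ⟨e', he', heκ'⟩ := get y hyF (nb Y hYr y hyY)
  have hxx := mem_connectedComponentIn hxF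
  have hyy := mem_connectedComponentIn hyF
  refine ⟨_, _, e, e', connectedComponentIn_subset F x, connectedComponentIn_subset F y, ccomp x,
    ccomp y, isConnected_connectedComponentIn_iff.2 hxF, isConnected_connectedComponentIn_iff.2 hyF,
    ⟨x, hxx, hxX⟩, ⟨y, hyy, hyY⟩, ?_, ?_, ?_, he, he', heκ, heκ'⟩
  · by_contra h
    rw [Set.not_disjoint_iff_nonempty_inter] at h
    exact nomeet x ⟨⟨x, hxx, hxX⟩, h⟩
  · by_contra h
    rw [Set.not_disjoint_iff_nonempty_inter] at h
    exact nomeet y ⟨h, ⟨y, hyy, hyY⟩⟩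
  · rw [Set.disjoint_left]
    intro w hw hw'
    have h1 := connectedComponentIn_eq hw
    have h2 := connectedComponentIn_eq hw'
    exact nomeet x ⟨⟨x, hxx, hxX⟩, ⟨y, by rw [h1, ← h2]; exact hyy, hyY⟩⟩


theorem theta_access {β X Y N Ω : Set ℂ} (hβ : IsCompact β) (hc : IsPreconnected β)
    (hX : IsClosed X) (hY : IsClosed Y) (hN : IsClosed N) (hXY : Disjoint X Y)
    (hβX : (β ∩ X).Nonempty) (hβY : (β ∩ Y).Nonempty) (hβN : Disjoint β N)
    (hcl : β ⊆ closure Ω) (hd : Disjoint β Ω) :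
    ∃ z ∈ Ω, ∃ u ∈ β, u ∉ X ∧ u ∉ Y ∧ u ∉ N ∧ z ≠ u ∧
      ∀ w ∈ X ∪ Y ∪ N ∪ β, dist z u ≤ dist z w := by
  have h0 : ∃ u0 ∈ β, u0 ∉ X ∪ Y := by
    by_contra hcon
    push Not at hcon
    obtain ⟨x, hx, hxX⟩ := hβX
    obtain ⟨y, hy, hyY⟩ := hβY
    exact Set.disjoint_left.1 hXY (pc_split hc hX hY hcon hXY hx hxX hy) hyY
  obtain ⟨u0, hu0, hu0'⟩ := h0
  have hT : IsClosed (X ∪ Y ∪ N) := (hX.union hY).union hN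
  have hu0T : u0 ∉ X ∪ Y ∪ N := by
    rintro (h | h)
    · exact hu0' h
    · exact Set.disjoint_left.1 hβN hu0 h
  obtain ⟨ε, hε, hball⟩ := Metric.isOpen_iff.1 hT.isOpen_compl u0 hu0T
  obtain ⟨z, hz, hzu⟩ := Metric.mem_closure_iff.1 (hcl hu0) (ε / 2) (by positivity)
  obtain ⟨u, hu, humin⟩ := hβ.exists_isMinOn ⟨u0, hu0⟩ (f := fun w => dist z w) (by fun_prop)
  have h1 : dist z u ≤ dist z u0 := humin hu0
  rw [dist_comm] at hzu
  have h2 : dist u u0 < ε := by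
    have := dist_triangle u z u0
    rw [dist_comm u z] at this
    linarith
  have h3 : u ∉ X ∪ Y ∪ N := hball h2
  simp only [mem_union, not_or] at h3
  refine ⟨z, hz, u, hu, h3.1.1, h3.1.2, h3.2, ?_, ?_⟩
  · rintro rfl; exact Set.disjoint_left.1 hd hu hz
  · rintro w (hw | hw)
    · have : ¬ dist w u0 < ε := fun h => hball h hw
      have h4 := dist_triangle w z u0
      rw [dist_comm w z] at h4
      linarith
    · exact humin hw

theorem theta_min {X Y Ω : Set ℂ} {β : Fin 3 → Set ℂ} (hX : IsCompact X) (hY : IsCompact Y)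
    (cX : IsConnected X) (cY : IsConnected Y) (hXY : Disjoint X Y) (hβ : ∀ i, IsCompact (β i))
    (cβ : ∀ i, IsPreconnected (β i)) (dβ : ∀ i j, i ≠ j → Disjoint (β i) (β j))
    (hβX : ∀ i, (β i ∩ X).Nonempty) (hβY : ∀ i, (β i ∩ Y).Nonempty)
    (hmin : ∀ i, ∀ γ ⊆ β i, IsCompact γ → IsPreconnected γ → (γ ∩ X).Nonempty →
      (γ ∩ Y).Nonempty → β i ⊆ γ)
    (hΩ : IsOpen Ω) (cΩ : IsConnected Ω) (dX : Disjoint X Ω) (dY : Disjoint Y Ω)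
    (dΩ : ∀ i, Disjoint (β i) Ω) (hcl : ∀ i, β i ⊆ closure Ω) : False := by
  have acc : ∀ i, ∃ z ∈ Ω, ∃ u ∈ β i, u ∉ X ∧ u ∉ Y ∧ z ≠ u ∧
      ∀ w, (w ∈ X ∨ w ∈ Y ∨ ∃ j, w ∈ β j) → dist z u ≤ dist z w := by
    intro i
    obtain ⟨z, hz, u, hu, h1, h2, h3, h4, h5⟩ := theta_access (N := ⋃ j : {j // j ≠ i}, β j) (hβ i)
      (cβ i) hX.isClosed hY.isClosed
      (isCompact_iUnion (fun j : {j // j ≠ i} => hβ j)).isClosed hXY (hβX i) (hβY i)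
      (disjoint_iUnion_right.2 (fun j => dβ i j j.2.symm)) (hcl i) (dΩ i)
    refine ⟨z, hz, u, hu, h1, h2, h4, ?_⟩
    intro w hw
    apply h5
    rcases hw with hw | hw | ⟨j, hw⟩
    · exact Or.inl (Or.inl (Or.inl hw))
    · exact Or.inl (Or.inl (Or.inr hw))
    · by_cases hj : j = i
      · subst hj; exact Or.inr hw
      · exact Or.inl (Or.inr (mem_iUnion.2 ⟨⟨j, hj⟩, hw⟩))
  choose z hz u hu huX huY hzu hnear using acc
  have hpc : IsPathConnected Ω := hΩ.isConnected_iff_isPathConnected.1 cΩ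
  obtain ⟨γ, tt, hγ, hγz⟩ := hpc.exists_path_through_family' z hz
  set Λ : Set ℂ := range γ with hΛ
  have hΛc : IsCompact Λ := isCompact_range γ.continuous
  have cΛ : IsConnected Λ := isConnected_range γ.continuous
  have hΛΩ : Λ ⊆ Ω := by rintro _ ⟨t, rfl⟩; exact hγ t
  have hzΛ : ∀ i, z i ∈ Λ := by
    intro i
    exact ⟨tt i, hγz i⟩
  -- the segments
  have seg_near : ∀ i, ∀ w ∈ segment ℝ (z i) (u i), w ≠ u i → ∀ v,
      (v ∈ X ∨ v ∈ Y ∨ ∃ j, v ∈ β j) → w ≠ v := by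
    intro i w hw hwu v hv hwv
    subst hwv
    have h1 := hnear i w hv
    have h2 : dist (z i) w + dist w (u i) = dist (z i) (u i) := dist_add_dist_of_mem_segment hw
    have h3 := dist_pos.2 hwu
    linarith
  set N : Fin 3 → Set ℂ := fun i => X ∪ Y ∪ Λ ∪ ⋃ j : {j // j ≠ i}, (β j ∪ segment ℝ (z j) (u j))
    with hN
  have segc : ∀ a b : ℂ, IsCompact (segment ℝ a b) := by
    intro a b; rw [segment_eq_image_lineMap]
    exact isCompact_Icc.image (by exact AffineMap.lineMap_continuous)
  have hNc : ∀ i, IsClosed (N i) := fun i => (((hX.union hY).union hΛc).union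
    (isCompact_iUnion (fun j : {j // j ≠ i} => (hβ j).union (segc _ _)))).isClosed
  have huN : ∀ i, u i ∉ N i := by
    rintro i (((h | h) | h) | h)
    · exact huX i h
    · exact huY i h
    · exact Set.disjoint_left.1 (dΩ i) (hu i) (hΛΩ h)
    · obtain ⟨⟨j, hj⟩, h | h⟩ := mem_iUnion.1 h
      · exact Set.disjoint_left.1 (dβ i j hj.symm) (hu i) h
      · by_cases huu : u i = u j
        · exact Set.disjoint_left.1 (dβ i j hj.symm) (hu i) (huu ▸ hu j)
        · exact seg_near j _ h huu (u i) (Or.inr (Or.inr ⟨i, hu i⟩)) rfl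
  have hr : ∃ r > 0, ∀ i, Disjoint (N i) (Metric.closedBall (u i) (3 * r)) := by
    have : ∀ i, ∃ ε > 0, Metric.ball (u i) ε ⊆ (N i)ᶜ :=
      fun i => Metric.isOpen_iff.1 (hNc i).isOpen_compl (u i) (huN i)
    choose ε hε hball using this
    obtain ⟨i0, -, hi0⟩ := Finset.exists_min_image Finset.univ ε ⟨0, Finset.mem_univ _⟩
    refine ⟨ε i0 / 6, by have := hε i0; positivity, fun i => ?_⟩
    rw [Set.disjoint_right]
    intro w hw
    apply hball i
    rw [Metric.mem_closedBall] at hw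
    rw [Metric.mem_ball]
    have := hi0 i (Finset.mem_univ _)
    have := hε i0
    linarith
  obtain ⟨r, hr, hNr⟩ := hr
  have hNr' : ∀ i, Disjoint (N i) (Metric.closedBall (u i) r) := fun i =>
    (hNr i).mono_right (Metric.closedBall_subset_closedBall (by linarith))
  have dXr : ∀ i, Disjoint X (Metric.closedBall (u i) r) := fun i =>
    (hNr' i).mono_left (show X ⊆ N i from fun w hw => Or.inl (Or.inl (Or.inl hw)))
  have dYr : ∀ i, Disjoint Y (Metric.closedBall (u i) r) := fun i =>
    (hNr' i).mono_left (show Y ⊆ N i from fun w hw => Or.inl (Or.inl (Or.inr hw)))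
  have dΛr : ∀ i, Disjoint Λ (Metric.closedBall (u i) r) := fun i =>
    (hNr' i).mono_left (show Λ ⊆ N i from fun w hw => Or.inl (Or.inr hw))
  have dβr : ∀ i j, i ≠ j → Disjoint (β j) (Metric.closedBall (u i) r) := fun i j hij =>
    (hNr' i).mono_left (show β j ⊆ N i from fun w hw => Or.inr (mem_iUnion.2 ⟨⟨j, hij.symm⟩, Or.inl hw⟩))
  have dsr : ∀ i j, i ≠ j → Disjoint (segment ℝ (z j) (u j)) (Metric.closedBall (u i) r) :=
    fun i j hij =>
    (hNr' i).mono_left (show segment ℝ (z j) (u j) ⊆ N i from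
      fun w hw => Or.inr (mem_iUnion.2 ⟨⟨j, hij.symm⟩, Or.inr hw⟩))
  have drr : ∀ i j, i ≠ j → Disjoint (Metric.closedBall (u j) r) (Metric.closedBall (u i) r) := by
    intro i j hij
    rw [Set.disjoint_left]
    intro w hw hw'
    rw [Metric.mem_closedBall] at hw hw'
    have h1 : u j ∈ N i := Or.inr (mem_iUnion.2 ⟨⟨j, hij.symm⟩, Or.inl (hu j)⟩)
    apply Set.disjoint_left.1 (hNr i) h1
    rw [Metric.mem_closedBall]
    have := dist_triangle (u j) w (u i)
    rw [dist_comm (u j) w] at this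
    linarith
  -- arms
  have arms := fun i => arm_setup (hβ i) (cβ i) (hβX i) (hβY i) (hu i) hr (hmin i) (dXr i) (dYr i)
  choose κ κ' e e' hκ hκ' kκ kκ' cκ cκ' mκ mκ' dκY dκX dκκ he he' heκ heκ' using arms
  set s : Fin 3 → ℝ := fun i => dist (z i) (u i) with hs
  have hsr : ∀ i, r < s i := by
    intro i
    by_contra h
    exact Set.disjoint_left.1 (dΛr i) (hzΛ i) (by rw [Metric.mem_closedBall]; exact not_lt.1 h)
  have hs0 : ∀ i, 0 < s i := fun i => hr.trans (hsr i)
  set g : Fin 3 → ℂ := fun i => (z i - u i) / s i with hg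
  have hgn : ∀ i, ‖g i‖ = 1 := by
    intro i
    rw [hg]; simp only; rw [norm_div, ← dist_eq_norm]
    simp only [Complex.norm_real, Real.norm_eq_abs, abs_of_pos (hs0 i)]
    exact div_self (hs0 i).ne'
  have hzg : ∀ i, z i = u i + s i * g i := by
    intro i
    have : (s i : ℂ) ≠ 0 := by exact_mod_cast (hs0 i).ne'
    rw [hg]; simp only; rw [mul_div_cancel₀ _ this]; ring
  have hgseg : ∀ i, cray (u i) (g i) (r / 2) (s i) ⊆ segment ℝ (z i) (u i) := by
    rintro i w ⟨t, ht, rfl⟩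
    rw [segment_symm, segment_eq_image_lineMap]
    refine ⟨t / s i, ⟨div_nonneg (by linarith [ht.1]) (hs0 i).le, (div_le_one (hs0 i)).2 ht.2⟩, ?_⟩
    have : (s i : ℂ) ≠ 0 := by exact_mod_cast (hs0 i).ne'
    rw [AffineMap.lineMap_apply, hg]
    simp only [vsub_eq_sub, vadd_eq_add, Complex.real_smul]
    push_cast
    field_simp
    ring
  have hgM : ∀ i, ∀ w ∈ cray (u i) (g i) (r / 2) (s i), ∀ v,
      (v ∈ X ∨ v ∈ Y ∨ ∃ j, v ∈ β j) → w ≠ v := by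
    intro i w hw
    apply seg_near i w (hgseg i hw)
    rintro rfl
    obtain ⟨t, ht, htu⟩ := hw
    have := cray_dist (u := u i) (hgn i) (by linarith [ht.1] : 0 ≤ t)
    simp only at htu
    rw [htu, dist_self] at this
    linarith [ht.1]
  have hrayr : ∀ (v c : ℂ), ‖c‖ = 1 → cray v c (r / 2) r ⊆ Metric.closedBall v r := by
    rintro v c hc w ⟨t, ht, rfl⟩
    rw [Metric.mem_closedBall, cray_dist hc (by linarith [ht.1])]
    exact ht.2
  have hee : ∀ i, e i ≠ e' i := by
    intro i h
    exact Set.disjoint_left.1 (dκκ i) (heκ i) (h ▸ heκ' i)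
  have hqg : ∀ i c, (u i + r * c ∈ β i) → c ≠ g i := by
    rintro i c h rfl
    exact hgM i _ ⟨r, ⟨by linarith, (hsr i).le⟩, rfl⟩ _ (Or.inr (Or.inr ⟨i, h⟩)) rfl
  have hκβ : ∀ i, κ i ⊆ β i := fun i => (hκ i).trans sdiff_subset
  have hκβ' : ∀ i, κ' i ⊆ β i := fun i => (hκ' i).trans sdiff_subset
  have armray : ∀ i (S : Set ℂ) c, S ⊆ β i \ Metric.ball (u i) r → ‖c‖ = 1 → u i + r * c ∉ S →
      Disjoint S (cray (u i) c (r / 2) r) := by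
    intro i S c hS hc hcS
    rw [Set.disjoint_left]
    rintro w hw ⟨t, ht, rfl⟩
    have h1 := (hS hw).2
    rw [Metric.mem_ball] at h1
    simp only at h1 hw
    rw [cray_dist hc (by linarith [ht.1])] at h1
    have : t = r := le_antisymm ht.2 (not_lt.1 h1)
    subst this
    exact hcS hw
  set a : Fin 3 → Fin 3 → Set ℂ := ![fun i => κ i ∪ cray (u i) (e i) (r / 2) r,
    fun i => κ' i ∪ cray (u i) (e' i) (r / 2) r, fun i => cray (u i) (g i) (r / 2) (s i)] with ha
  have a0 : ∀ i, a 0 i = κ i ∪ cray (u i) (e i) (r / 2) r := fun i => rfl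
  have a1 : ∀ i, a 1 i = κ' i ∪ cray (u i) (e' i) (r / 2) r := fun i => rfl
  have a2 : ∀ i, a 2 i = cray (u i) (g i) (r / 2) (s i) := fun i => rfl
  have hr2 : 0 < r / 2 := by positivity
  have hr2' : r / 2 ≤ r := by linarith
  have sub0 : ∀ i, a 0 i ⊆ β i ∪ Metric.closedBall (u i) r := fun i =>
    union_subset_union (hκβ i) (hrayr _ _ (he i))
  have sub1 : ∀ i, a 1 i ⊆ β i ∪ Metric.closedBall (u i) r := fun i =>
    union_subset_union (hκβ' i) (hrayr _ _ (he' i))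
  have dΛβ : ∀ i, Disjoint (β i) Λ := fun i => (dΩ i).mono_right hΛΩ
  have dgβ : ∀ i j, Disjoint (cray (u i) (g i) (r / 2) (s i)) (β j) := by
    intro i j
    rw [Set.disjoint_left]
    intro w hw hw'
    exact hgM i w hw w (Or.inr (Or.inr ⟨j, hw'⟩)) rfl
  have dBB : ∀ i j, i ≠ j → Disjoint (β i ∪ Metric.closedBall (u i) r)
      (β j ∪ Metric.closedBall (u j) r) := by
    intro i j hij
    simp only [disjoint_union_left, disjoint_union_right]
    exact ⟨⟨dβ i j hij, (dβr i j hij).symm⟩, (dβr j i hij.symm), (drr i j hij).symm⟩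
  have dBg : ∀ i j, i ≠ j → Disjoint (β i ∪ Metric.closedBall (u i) r)
      (cray (u j) (g j) (r / 2) (s j)) := by
    intro i j hij
    rw [disjoint_union_left]
    exact ⟨(dgβ j i).symm, ((dsr i j hij).mono_left (hgseg j)).symm⟩
  have d01 : ∀ i j, Disjoint (a 0 i) (a 1 j) := by
    intro i j
    by_cases hij : i = j
    · subst hij
      rw [a0, a1]
      simp only [disjoint_union_left, disjoint_union_right]
      refine ⟨⟨dκκ i, ?_⟩, ?_, cray_disjoint (he i) (he' i) hr2 hr2 (hee i)⟩
      · exact (armray i _ _ (hκ' i) (he i) (fun h => Set.disjoint_left.1 (dκκ i) (heκ i) h)).symm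
      · exact armray i _ _ (hκ i) (he' i) (fun h => Set.disjoint_left.1 (dκκ i) h (heκ' i))
    · exact (dBB i j hij).mono (sub0 i) (sub1 j)
  have d02 : ∀ i j, Disjoint (a 0 i) (a 2 j) := by
    intro i j
    by_cases hij : i = j
    · subst hij
      rw [a0, a2, disjoint_union_left]
      exact ⟨((dgβ i i).mono_right (hκβ i)).symm,
        cray_disjoint (he i) (hgn i) hr2 hr2 (hqg i _ (hκβ i (heκ i)))⟩
    · exact (dBg i j hij).mono_left (sub0 i)
  have d12 : ∀ i j, Disjoint (a 1 i) (a 2 j) := by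
    intro i j
    by_cases hij : i = j
    · subst hij
      rw [a1, a2, disjoint_union_left]
      exact ⟨((dgβ i i).mono_right (hκβ' i)).symm,
        cray_disjoint (he' i) (hgn i) hr2 hr2 (hqg i _ (hκβ' i (heκ' i)))⟩
    · exact (dBg i j hij).mono_left (sub1 i)
  have dgX : ∀ i, Disjoint (a 2 i) X := by
    intro i
    rw [Set.disjoint_left]
    intro w hw hw'
    exact hgM i w hw w (Or.inl hw') rfl
  have dgY : ∀ i, Disjoint (a 2 i) Y := by
    intro i
    rw [Set.disjoint_left]
    intro w hw hw'
    exact hgM i w hw w (Or.inr (Or.inl hw')) rfl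
  have dΛB : ∀ i, Disjoint (β i ∪ Metric.closedBall (u i) r) Λ := fun i =>
    disjoint_union_left.2 ⟨dΛβ i, (dΛr i).symm⟩
  have touchE : ∀ i (S : Set ℂ) c, S ⊆ β i \ Metric.ball (u i) r → ‖c‖ = 1 →
      ∃ p, dist p (u i) = r / 2 ∧
        (S ∪ cray (u i) c (r / 2) r) ∩ Metric.closedBall (u i) (r / 2) = {p} := by
    intro i S c hS hc
    refine ⟨u i + (r / 2 : ℝ) * c, cray_dist hc hr2.le, ?_⟩
    rw [union_inter_distrib_right, cray_touch hc hr2 hr2']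
    have : S ∩ Metric.closedBall (u i) (r / 2) = ∅ := by
      ext w
      simp only [mem_inter_iff, mem_empty_iff_false, iff_false, not_and]
      intro hw hw'
      have h1 := (hS hw).2
      rw [Metric.mem_ball] at h1
      rw [Metric.mem_closedBall] at hw'
      linarith
    rw [this, empty_union]
  refine theta_arms (u := u) (ρ := r / 2) (X := ![X, Y, Λ]) (a := a) hr2 ?_ ?_ ?_ ?_ ?_ ?_ ?_ ?_ ?_
    ?_ ?_ ?_
  · intro i j hij
    exact (drr j i hij.symm).mono (Metric.closedBall_subset_closedBall hr2')
      (Metric.closedBall_subset_closedBall hr2')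
  · intro k; fin_cases k
    exacts [hX, hY, hΛc]
  · intro k; fin_cases k
    exacts [cX, cY, cΛ]
  · intro k i; fin_cases k
    exacts [(kκ i).union (cray_compact _ _ _ _), (kκ' i).union (cray_compact _ _ _ _),
      cray_compact _ _ _ _]
  · intro k i; fin_cases k
    exacts [(cκ i).union ⟨_, heκ i, ⟨r, ⟨hr2', le_rfl⟩, rfl⟩⟩ (cray_connected _ _ hr2'),
      (cκ' i).union ⟨_, heκ' i, ⟨r, ⟨hr2', le_rfl⟩, rfl⟩⟩ (cray_connected _ _ hr2'),
      cray_connected _ _ (hr2'.trans (hsr i).le)]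
  · intro k i; fin_cases k
    · obtain ⟨w, h1, h2⟩ := mκ i
      exact ⟨w, h2, Or.inl h1⟩
    · obtain ⟨w, h1, h2⟩ := mκ' i
      exact ⟨w, h2, Or.inl h1⟩
    · exact ⟨z i, hzΛ i, ⟨s i, ⟨hr2'.trans (hsr i).le, le_rfl⟩, (hzg i).symm⟩⟩
  · have hXL : Disjoint X Λ := dX.mono_right hΛΩ
    have hYL : Disjoint Y Λ := dY.mono_right hΛΩ
    intro k l hkl
    fin_cases k <;> fin_cases l
    exacts [absurd rfl hkl, hXY, hXL, hXY.symm, absurd rfl hkl, hYL, hXL.symm, hYL.symm,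
      absurd rfl hkl]
  · intro k l i hkl
    have h01 : Disjoint (a 0 i) Y := by
      rw [a0, disjoint_union_left]
      exact ⟨dκY i, ((dYr i).mono_right (hrayr _ _ (he i))).symm⟩
    have h10 : Disjoint (a 1 i) X := by
      rw [a1, disjoint_union_left]
      exact ⟨dκX i, ((dXr i).mono_right (hrayr _ _ (he' i))).symm⟩
    have h02 : Disjoint (a 0 i) Λ := (dΛB i).mono_left (sub0 i)
    have h12 : Disjoint (a 1 i) Λ := (dΛB i).mono_left (sub1 i)
    have := dgX i
    have := dgY i
    fin_cases k <;> fin_cases l <;> first | assumption | exact absurd rfl hkl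
  · intro k l i j hkl
    have h1 := d01 i j
    have h2 := d02 i j
    have h3 := d12 i j
    have h4 := (d01 j i).symm
    have h5 := (d02 j i).symm
    have h6 := (d12 j i).symm
    fin_cases k <;> fin_cases l <;> first | assumption | exact absurd rfl hkl
  · intro k i
    have sub := Metric.closedBall_subset_closedBall (x := u i) hr2'
    have h1 := (dXr i).mono_right sub
    have h2 := (dYr i).mono_right sub
    have h3 := (dΛr i).mono_right sub
    fin_cases k <;> assumption
  · intro k i j hij
    have sub : Metric.closedBall (u j) (r / 2) ⊆ β j ∪ Metric.closedBall (u j) r :=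
      (Metric.closedBall_subset_closedBall (x := u j) hr2').trans subset_union_right
    have h1 : Disjoint (a 0 i) _ := (dBB i j hij).mono (sub0 i) sub
    have h2 : Disjoint (a 1 i) _ := (dBB i j hij).mono (sub1 i) sub
    have h3 : Disjoint (a 2 i) _ := ((dBg j i hij.symm).mono_left sub).symm
    fin_cases k <;> assumption
  · intro k i
    have h1 := touchE i _ _ (hκ i) (he i)
    have h2 := touchE i _ _ (hκ' i) (he' i)
    have h3 : ∃ p, dist p (u i) = r / 2 ∧ a 2 i ∩ Metric.closedBall (u i) (r / 2) = {p} :=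
      ⟨_, cray_dist (hgn i) hr2.le, cray_touch (hgn i) hr2 (hr2'.trans (hsr i).le)⟩
    fin_cases k <;> assumption

theorem theta_lemma {X Y Ω : Set ℂ} {β : Fin 3 → Set ℂ} (hX : IsCompact X) (hY : IsCompact Y)
    (cX : IsConnected X) (cY : IsConnected Y) (hXY : Disjoint X Y) (hβ : ∀ i, IsCompact (β i))
    (cβ : ∀ i, IsPreconnected (β i)) (dβ : ∀ i j, i ≠ j → Disjoint (β i) (β j))
    (hβX : ∀ i, (β i ∩ X).Nonempty) (hβY : ∀ i, (β i ∩ Y).Nonempty)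
    (hΩ : IsOpen Ω) (cΩ : IsConnected Ω) (dX : Disjoint X Ω) (dY : Disjoint Y Ω)
    (dΩ : ∀ i, Disjoint (β i) Ω) (hcl : ∀ i, β i ⊆ closure Ω) : False := by
  have := fun i => minimal_continuum (hβ i) (cβ i) hX.isClosed hY.isClosed (hβX i) (hβY i)
  choose β' hsub hc hp h1 h2 h3 using this
  exact theta_min hX hY cX cY hXY hc hp (fun i j hij => (dβ i j hij).mono (hsub i) (hsub j)) h1 h2 h3
    hΩ cΩ dX dY (fun i => (dΩ i).mono_left (hsub i)) (fun i => (hsub i).trans (hcl i))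


/-- Metric form of local connectedness of a subset of the plane. -/
def LCn (K : Set ℂ) : Prop := ∀ x ∈ K, ∀ ε > 0, ∃ V ⊆ K ∩ Metric.ball x ε, IsPreconnected V ∧
  ∃ δ > 0, K ∩ Metric.ball x δ ⊆ V

theorem LCn.mem {K V : Set ℂ} {x : ℂ} (hx : x ∈ K) {δ : ℝ} (hδ : 0 < δ)
    (h : K ∩ Metric.ball x δ ⊆ V) : x ∈ V := h ⟨hx, Metric.mem_ball_self hδ⟩

theorem cc_relopen {K C : Set ℂ} (hK : LCn K) (hC : IsClosed C) (x : ℂ) :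
    ∃ U, IsOpen U ∧ connectedComponentIn (K \ C) x = U ∩ K := by
  have : ∀ y ∈ connectedComponentIn (K \ C) x, ∃ δ > 0,
      K ∩ Metric.ball y δ ⊆ connectedComponentIn (K \ C) x := by
    intro y hy
    have hyK := connectedComponentIn_subset _ _ hy
    obtain ⟨ε, hε, hball⟩ := Metric.isOpen_iff.1 hC.isOpen_compl y hyK.2
    obtain ⟨V, hV, hVc, δ, hδ, hVδ⟩ := hK y hyK.1 ε hε
    refine ⟨δ, hδ, hVδ.trans ?_⟩
    rw [connectedComponentIn_eq hy]
    apply hVc.subset_connectedComponentIn (LCn.mem hyK.1 hδ hVδ)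
    exact fun w hw => ⟨(hV hw).1, hball (hV hw).2⟩
  choose! δ hδ hsub using this
  refine ⟨⋃ y ∈ connectedComponentIn (K \ C) x, Metric.ball y (δ y),
    isOpen_biUnion (fun _ _ => Metric.isOpen_ball), ?_⟩
  apply Subset.antisymm
  · intro y hy
    exact ⟨mem_biUnion hy (Metric.mem_ball_self (hδ y hy)), (connectedComponentIn_subset _ _ hy).1⟩
  · rintro y ⟨hy, hyK⟩
    obtain ⟨w, hw, hyw⟩ := mem_iUnion₂.1 hy
    exact hsub w hw ⟨hyK, hyw⟩

theorem cc_closure_meets {K C : Set ℂ} (hK : LCn K) (hKc : IsClosed K) (hKp : IsPreconnected K)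
    (hC : IsClosed C) (hne : (K ∩ C).Nonempty) {x : ℂ} (hx : x ∈ K \ C) :
    (closure (connectedComponentIn (K \ C) x) ∩ C).Nonempty := by
  by_contra hcon
  rw [not_nonempty_iff_eq_empty] at hcon
  obtain ⟨U, hU, hUK⟩ := cc_relopen hK hC x
  have hx' := mem_connectedComponentIn hx
  have hclK : closure (connectedComponentIn (K \ C) x) ⊆ K :=
    closure_minimal ((connectedComponentIn_subset _ _).trans sdiff_subset) hKc
  have hcl : closure (connectedComponentIn (K \ C) x) ⊆ connectedComponentIn (K \ C) x := by
    apply isPreconnected_connectedComponentIn.closure.subset_connectedComponentIn (subset_closure hx')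
    intro w hw
    refine ⟨hclK hw, fun hwC => ?_⟩
    have : w ∈ (∅ : Set ℂ) := hcon ▸ ⟨hw, hwC⟩
    exact this
  have hKU : K ⊆ connectedComponentIn (K \ C) x := by
    apply pc_split hKp (isClosed_of_closure_subset hcl) (Q := K \ U) (hKc.sdiff hU) _ _ hx.1 hx'
    · intro y hy
      by_cases hyU : y ∈ U
      · left; rw [hUK]; exact ⟨hyU, hy⟩
      · exact Or.inr ⟨hy, hyU⟩
    · rw [Set.disjoint_left]
      intro y hy hy'
      rw [hUK] at hy
      exact hy'.2 hy.1
  obtain ⟨c, hcK, hcC⟩ := hne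
  exact (connectedComponentIn_subset _ _ (hKU hcK)).2 hcC

theorem cc_union_conn {K C : Set ℂ} (hK : LCn K) (hKc : IsClosed K) (hKp : IsPreconnected K)
    (hC : IsClosed C) (hCc : IsConnected C) (hCK : C ⊆ K) {x : ℂ} (hx : x ∈ K \ C) :
    IsPreconnected (connectedComponentIn (K \ C) x ∪ C) := by
  obtain ⟨c, hc⟩ := hCc.1
  obtain ⟨w, hw, hwC⟩ := cc_closure_meets hK hKc hKp hC ⟨c, hCK hc, hc⟩ hx
  have h1 : IsPreconnected (insert w (connectedComponentIn (K \ C) x)) :=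
    isPreconnected_connectedComponentIn.subset_closure (subset_insert _ _)
      (insert_subset hw subset_closure)
  have h2 := IsPreconnected.union w (mem_insert _ _) hwC h1 hCc.2
  have : connectedComponentIn (K \ C) x ∪ C = insert w (connectedComponentIn (K \ C) x) ∪ C := by
    rw [insert_union]; exact (insert_eq_of_mem (show w ∈ _ ∪ C from Or.inr hwC)).symm
  rw [this]; exact h2

theorem cc_eq_of_conn {F S : Set ℂ} (hS : IsPreconnected S) (hSF : S ⊆ F) {x y : ℂ} (hx : x ∈ S)
    (hy : y ∈ S) : connectedComponentIn F x = connectedComponentIn F y :=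
  connectedComponentIn_eq (hS.subset_connectedComponentIn hx hSF hy)

section counting
variable {K : Set ℂ} {C : ℕ → Set ℂ} {c : ℕ → ℂ}

theorem cc_star (hK : LCn K) (hKc : IsClosed K) (hKp : IsPreconnected K)
    (hC : ∀ i, IsClosed (C i)) (hCc : ∀ i, IsConnected (C i)) (hCK : ∀ i, C i ⊆ K)
    (hd : ∀ i j, i ≠ j → Disjoint (C i) (C j)) (hc : ∀ i, c i ∈ C i) {i l : ℕ} (hil : i ≠ l) {x : ℂ}
    (hx : x ∈ K) (hxl : x ∉ C l) (h : x ∈ C i ∨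
      connectedComponentIn (K \ C i) x ≠ connectedComponentIn (K \ C i) (c l)) :
    connectedComponentIn (K \ C l) x = connectedComponentIn (K \ C l) (c i) := by
  have hCil : C i ⊆ K \ C l := fun w hw => ⟨hCK i hw, Set.disjoint_left.1 (hd i l hil) hw⟩
  by_cases hxi : x ∈ C i
  · exact cc_eq_of_conn (hCc i).2 hCil hxi (hc i)
  · have h := h.resolve_left hxi
    have hxK : x ∈ K \ C i := ⟨hx, hxi⟩
    apply cc_eq_of_conn (cc_union_conn hK hKc hKp (hC i) (hCc i) (hCK i) hxK) _
      (Or.inl (mem_connectedComponentIn hxK)) (Or.inr (hc i))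
    rintro w (hw | hw)
    · refine ⟨(connectedComponentIn_subset _ _ hw).1, fun hwl => h ?_⟩
      rw [connectedComponentIn_eq hw]
      exact cc_eq_of_conn (hCc l).2 (show C l ⊆ K \ C i from fun v hv => ⟨hCK l hv,
        Set.disjoint_left.1 (hd l i hil.symm) hv⟩) hwl (hc l)
    · exact hCil hw

open Classical in
/-- Number of components of `K \ C` that meet `S`. -/
noncomputable def valc (K C : Set ℂ) (S : Finset ℂ) : ℕ :=
  ((S.filter (fun s => s ∉ C)).image (fun s => connectedComponentIn (K \ C) s)).card

open Classical in
theorem count_end (hK : LCn K) (hKc : IsClosed K) (hKp : IsPreconnected K)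
    (hC : ∀ i, IsClosed (C i)) (hCc : ∀ i, IsConnected (C i)) (hCK : ∀ i, C i ⊆ K)
    (hd : ∀ i j, i ≠ j → Disjoint (C i) (C j)) (hc : ∀ i, c i ∈ C i) (I : Finset ℕ)
    (hI : 1 < I.card) : ∃ i ∈ I, ∃ j ∈ I, j ≠ i ∧ ∀ l ∈ I, l ≠ i →
      connectedComponentIn (K \ C i) (c l) = connectedComponentIn (K \ C i) (c j) := by
  set P : Finset (ℕ × ℕ) := I.offDiag with hP
  set n : ℕ × ℕ → ℕ := fun q => (I.filter (fun l => l ≠ q.1 ∧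
    connectedComponentIn (K \ C q.1) (c l) = connectedComponentIn (K \ C q.1) (c q.2))).card with hn
  have hPne : P.Nonempty := by
    obtain ⟨a, ha, b, hb, hab⟩ := Finset.one_lt_card.1 hI
    exact ⟨(a, b), Finset.mem_offDiag.2 ⟨ha, hb, hab⟩⟩
  obtain ⟨⟨i, j⟩, hij, hmax⟩ := Finset.exists_max_image P n hPne
  obtain ⟨hi, hj, hne⟩ := Finset.mem_offDiag.1 hij
  simp only at hi hj hne
  refine ⟨i, hi, j, hj, hne.symm, ?_⟩
  by_contra hcon
  push Not at hcon
  obtain ⟨l, hl, hli, hlne⟩ := hcon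
  have h1 := hmax (l, i) (Finset.mem_offDiag.2 ⟨hl, hi, hli⟩)
  have h2 : n (i, j) < n (l, i) := by
    apply Finset.card_lt_card
    rw [Finset.ssubset_iff_of_subset]
    · refine ⟨i, ?_, ?_⟩
      · simp [hi, hli.symm]
      · simp
    · intro m hm
      simp only [Finset.mem_filter] at hm ⊢
      obtain ⟨hmI, hmi, hmeq⟩ := hm
      have hml : m ≠ l := by rintro rfl; exact hlne hmeq
      refine ⟨hmI, hml, ?_⟩
      apply cc_star hK hKc hKp hC hCc hCK hd hc hli.symm (hCK m (hc m))
        (Set.disjoint_left.1 (hd m l hml) (hc m))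
      right
      rw [hmeq]; exact hlne.symm
  omega

open Classical in
theorem count_main (hK : LCn K) (hKc : IsClosed K) (hKp : IsPreconnected K)
    (hC : ∀ i, IsClosed (C i)) (hCc : ∀ i, IsConnected (C i)) (hCK : ∀ i, C i ⊆ K)
    (hd : ∀ i j, i ≠ j → Disjoint (C i) (C j)) (k : ℕ) : ∀ (n : ℕ) (I : Finset ℕ), I.card = n + 1 →
    ∀ S : Finset ℂ, (S : Set ℂ) ⊆ K → (∀ i ∈ I, k + 2 ≤ valc K (C i) S) →
      (n + 1) * k + 2 ≤ S.card := by
  choose c hc using fun i => (hCc i).1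
  intro n
  induction n with
  | zero =>
    intro I hI S hS hv
    obtain ⟨i, rfl⟩ := Finset.card_eq_one.1 hI
    have h1 := hv i (Finset.mem_singleton_self i)
    have h2 : valc K (C i) S ≤ S.card :=
      Finset.card_image_le.trans (Finset.card_le_card (Finset.filter_subset _ _))
    omega
  | succ n ih =>
    intro I hI S hS hv
    obtain ⟨i, hi, j, hj, hji, hall⟩ := count_end hK hKc hKp hC hCc hCK hd hc I (by omega)
    set D := connectedComponentIn (K \ C i) (c j) with hD
    set Rm := S.filter (fun s => s ∉ C i ∧ connectedComponentIn (K \ C i) s ≠ D) with hRm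
    set S' := insert (c i) (S \ Rm) with hS'
    have hcard : k + 1 ≤ Rm.card := by
      have h1 := hv i hi
      have h2 : (S.filter (fun s => s ∉ C i)).image (fun s => connectedComponentIn (K \ C i) s) ⊆
          insert D (Rm.image (fun s => connectedComponentIn (K \ C i) s)) := by
        intro E hE
        obtain ⟨s, hs, rfl⟩ := Finset.mem_image.1 hE
        obtain ⟨hs1, hs2⟩ := Finset.mem_filter.1 hs
        rw [Finset.mem_insert]
        by_cases hE : connectedComponentIn (K \ C i) s = D
        · exact Or.inl hE
        · exact Or.inr (Finset.mem_image.2 ⟨s, Finset.mem_filter.2 ⟨hs1, hs2, hE⟩, rfl⟩)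
      have h3 := Finset.card_le_card h2
      have h4 := Finset.card_insert_le D (Rm.image (fun s => connectedComponentIn (K \ C i) s))
      have h5 := Finset.card_image_le (s := Rm) (f := fun s => connectedComponentIn (K \ C i) s)
      unfold valc at h1
      omega
    have hRS : Rm ⊆ S := Finset.filter_subset _ _
    have hS'card : S'.card + k ≤ S.card := by
      have h1 : S'.card ≤ (S \ Rm).card + 1 := Finset.card_insert_le (c i) (S \ Rm)
      have h2 := Finset.card_sdiff_add_card_eq_card hRS
      omega
    have hIH := ih (I.erase i) (by rw [Finset.card_erase_of_mem hi]; omega) S' (by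
      intro s hs
      rcases Finset.mem_insert.1 hs with rfl | hs
      · exact hCK i (hc i)
      · exact hS (Finset.mem_sdiff.1 hs).1) (by
      intro l hl
      obtain ⟨hli, hlI⟩ := Finset.mem_erase.1 hl
      refine (hv l hlI).trans (Finset.card_le_card ?_)
      intro E hE
      obtain ⟨s, hs, rfl⟩ := Finset.mem_image.1 hE
      obtain ⟨hs1, hs2⟩ := Finset.mem_filter.1 hs
      by_cases hsR : s ∈ Rm
      · obtain ⟨-, hs3, hs4⟩ := Finset.mem_filter.1 hsR
        refine Finset.mem_image.2 ⟨c i, Finset.mem_filter.2 ⟨Finset.mem_insert_self _ _,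
          Set.disjoint_left.1 (hd i l hli.symm) (hc i)⟩, ?_⟩
        symm
        apply cc_star hK hKc hKp hC hCc hCK hd hc hli.symm (hS hs1) hs2
        right
        rw [hall l hlI hli]; exact hs4
      · exact Finset.mem_image.2 ⟨s, Finset.mem_filter.2 ⟨Finset.mem_insert_of_mem
          (Finset.mem_sdiff.2 ⟨hs1, hsR⟩), hs2⟩, rfl⟩)
    nlinarith
end counting


theorem poly_growth (p : Polynomial ℂ) (hd : 2 ≤ p.natDegree) {f : ℂ → ℂ}
    (hf : ∀ z, f z = p.eval z) :
    ∃ A : ℝ, 1 ≤ A ∧ (∀ z, ‖f z‖ ≤ A * (max ‖z‖ 1) ^ p.natDegree) ∧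
      ∀ z, A ≤ ‖z‖ → ‖z‖ ^ p.natDegree ≤ A * ‖f z‖ := by
  have hp0 : p ≠ 0 := by rintro rfl; simp at hd
  have hrev : ∀ z : ℂ, z ≠ 0 → f z = p.reverse.eval z⁻¹ * z ^ p.natDegree := by
    intro z hz
    have := invertibleOfNonzero hz
    have := Polynomial.eval₂_reverse_mul_pow (RingHom.id ℂ) z p
    rw [invOf_eq_inv] at this
    rw [hf]; exact this.symm
  have hc1 : Continuous fun z : ℂ => p.eval z := p.continuous
  have hc2 : Continuous fun z : ℂ => p.reverse.eval z := p.reverse.continuous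
  obtain ⟨A1, hA1⟩ := (isCompact_closedBall (0 : ℂ) 1).exists_bound_of_continuousOn hc1.continuousOn
  obtain ⟨A2, hA2⟩ := (isCompact_closedBall (0 : ℂ) 1).exists_bound_of_continuousOn hc2.continuousOn
  set l := p.leadingCoeff with hl
  have hl0 : 0 < ‖l‖ := norm_pos_iff.2 (Polynomial.leadingCoeff_ne_zero.2 hp0)
  have h0 : p.reverse.eval 0 = l := by
    rw [← Polynomial.coeff_zero_eq_eval_zero, Polynomial.coeff_zero_reverse]
  obtain ⟨δ, hδ, hδ'⟩ := Metric.continuous_iff.1 hc2 0 (‖l‖ / 2) (by positivity)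
  rw [h0] at hδ'
  have hb1 : 0 ≤ A1 := (norm_nonneg _).trans (hA1 0 (by simp))
  have hb2 : 0 ≤ A2 := (norm_nonneg _).trans (hA2 0 (by simp))
  have e1 : 0 < 2 / δ := by positivity
  have e2 : 0 < 2 / ‖l‖ := by positivity
  refine ⟨1 + A1 + A2 + 2 / δ + 2 / ‖l‖, by linarith, ?_, ?_⟩
  · intro z
    by_cases hz : ‖z‖ ≤ 1
    · rw [max_eq_right hz, one_pow, mul_one, hf]
      have := hA1 z (by simpa using hz)
      linarith
    · push Not at hz
      rw [max_eq_left hz.le, hrev z (by rintro rfl; simp at hz; linarith), norm_mul, norm_pow]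
      gcongr
      have := hA2 z⁻¹ (by simpa using inv_le_one_of_one_le₀ hz.le)
      linarith
  · intro z hz
    have hz0 : 0 < ‖z‖ := by linarith
    have hne : z ≠ 0 := norm_pos_iff.1 hz0
    rw [hrev z hne, norm_mul, norm_pow]
    have h1 : ‖z⁻¹‖ < δ := by
      rw [norm_inv, inv_lt_comm₀ hz0 hδ]
      have : δ⁻¹ ≤ 2 / δ := by rw [div_eq_mul_inv]; nlinarith [inv_pos.2 hδ]
      linarith
    have h2 := hδ' z⁻¹ (by simpa using h1)
    have h3 : ‖l‖ / 2 ≤ ‖p.reverse.eval z⁻¹‖ := by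
      have := norm_sub_norm_le l (p.reverse.eval z⁻¹)
      rw [dist_eq_norm, norm_sub_rev] at h2
      linarith
    have h4 : 1 ≤ (1 + A1 + A2 + 2 / δ + 2 / ‖l‖) * ‖p.reverse.eval z⁻¹‖ := by
      calc (1 : ℝ) = (2 / ‖l‖) * (‖l‖ / 2) := by field_simp
        _ ≤ _ := by gcongr; linarith
    have : 0 ≤ ‖z‖ ^ p.natDegree := by positivity
    nlinarith

section dyn
variable {p : Polynomial ℂ} {f : ℂ → ℂ}

theorem poly_escape (hd : 2 ≤ p.natDegree) (hf : ∀ z, f z = p.eval z) :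
    ∃ R : ℝ, 1 ≤ R ∧ ∀ z, R ≤ ‖z‖ → 2 * ‖z‖ ≤ ‖f z‖ := by
  obtain ⟨A, hA, -, h2⟩ := poly_growth p hd hf
  refine ⟨2 * A, by linarith, fun z hz => ?_⟩
  have h3 := h2 z (by linarith)
  have h4 : ‖z‖ ^ 2 ≤ ‖z‖ ^ p.natDegree := pow_le_pow_right₀ (by linarith) hd
  have h5 : (2 * A) * ‖z‖ ≤ A * ‖f z‖ := by nlinarith [norm_nonneg z]
  have h6 : 0 < A := by linarith
  nlinarith

theorem iterate_escape {R : ℝ} (hR : 1 ≤ R) (h : ∀ z, R ≤ ‖z‖ → 2 * ‖z‖ ≤ ‖f z‖) {z : ℂ}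
    (hz : R ≤ ‖z‖) (n : ℕ) : 2 ^ n * ‖z‖ ≤ ‖f^[n] z‖ := by
  induction n with
  | zero => simp
  | succ n ih =>
    rw [iterate_succ_apply']
    have h1 : (1 : ℝ) ≤ 2 ^ n := one_le_pow₀ (by norm_num)
    have := h (f^[n] z) (by nlinarith)
    rw [pow_succ]; linarith

theorem escape_not_mem {R : ℝ} (hR : 1 ≤ R) (h : ∀ z, R ≤ ‖z‖ → 2 * ‖z‖ ≤ ‖f z‖) {z : ℂ} {m : ℕ}
    (hz : R ≤ ‖f^[m] z‖) : z ∉ filledJulia f := by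
  intro hzK
  have hzK' : Bornology.IsBounded (range fun n => f^[n] z) := hzK
  obtain ⟨B, hB⟩ := hzK'.exists_norm_le
  obtain ⟨n, hn⟩ := pow_unbounded_of_one_lt B (by norm_num : (1 : ℝ) < 2)
  have h1 := iterate_escape hR h hz n
  rw [← iterate_add_apply] at h1
  have h2 := hB _ ⟨n + m, rfl⟩
  simp only at h2
  have : (0 : ℝ) < 2 ^ n := by positivity
  nlinarith

theorem filled_eq {R : ℝ} (hR : 1 ≤ R) (h : ∀ z, R ≤ ‖z‖ → 2 * ‖z‖ ≤ ‖f z‖) :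
    filledJulia f = {z | ∀ n, ‖f^[n] z‖ ≤ R} := by
  ext z
  constructor
  · intro hz n
    by_contra hcon
    exact escape_not_mem hR h (le_of_lt (not_le.1 hcon)) hz
  · intro hz
    show Bornology.IsBounded (range fun n => f^[n] z)
    rw [isBounded_iff_forall_norm_le]
    exact ⟨R, by rintro _ ⟨n, rfl⟩; exact hz n⟩

theorem poly_cont (hf : ∀ z, f z = p.eval z) : Continuous f := by
  have : f = fun z => p.eval z := funext hf
  rw [this]; exact p.continuous

theorem poly_diff (hf : ∀ z, f z = p.eval z) : Differentiable ℂ f := by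
  have : f = fun z => p.eval z := funext hf
  rw [this]; exact p.differentiable

theorem iter_diff (hf : ∀ z, f z = p.eval z) (n : ℕ) : Differentiable ℂ f^[n] :=
  (poly_diff hf).iterate n

theorem filled_compact (hd : 2 ≤ p.natDegree) (hf : ∀ z, f z = p.eval z) :
    IsCompact (filledJulia f) := by
  obtain ⟨R, hR, h⟩ := poly_escape hd hf
  rw [filled_eq hR h]
  refine (isCompact_closedBall (0 : ℂ) R).of_isClosed_subset ?_ ?_
  · rw [ofPred_forall]
    exact isClosed_iInter fun n =>
      isClosed_le (((poly_cont hf).iterate n).norm) continuous_const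
  · intro z hz
    simpa using hz 0

theorem filled_preimage : f ⁻¹' filledJulia f = filledJulia f := by
  ext z
  show Bornology.IsBounded (range fun n => f^[n] (f z)) ↔ Bornology.IsBounded (range fun n => f^[n] z)
  have : range (fun n => f^[n] z) = insert z (range fun n => f^[n] (f z)) := by
    ext w
    constructor
    · rintro ⟨n, rfl⟩
      cases n with
      | zero => exact Or.inl rfl
      | succ n => exact Or.inr ⟨n, by simp⟩
    · rintro (rfl | ⟨n, rfl⟩)
      · exact ⟨0, rfl⟩
      · exact ⟨n + 1, by simp⟩
  rw [this, Bornology.isBounded_insert]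

theorem poly_open (hd : 2 ≤ p.natDegree) (hf : ∀ z, f z = p.eval z) : IsOpenMap f := by
  have han : AnalyticOnNhd ℂ f univ := (poly_diff hf).differentiableOn.analyticOnNhd isOpen_univ
  rcases han.is_constant_or_isOpenMap with ⟨w, hw⟩ | h
  · exfalso
    have : p = Polynomial.C w := by
      apply Polynomial.funext
      intro z; rw [← hf, hw]; simp
    rw [this] at hd; simp at hd
  · exact h

theorem julia_preimage (hd : 2 ≤ p.natDegree) (hf : ∀ z, f z = p.eval z) :
    f ⁻¹' frontier (filledJulia f) = frontier (filledJulia f) := by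
  rw [(poly_open hd hf).preimage_frontier_eq_frontier_preimage (poly_cont hf), filled_preimage]

theorem ext_connected {R : ℝ} (hR : 0 < R) : IsConnected {z : ℂ | R < ‖z‖} := by
  have : {z : ℂ | R < ‖z‖} = Complex.exp '' {w | Real.log R < w.re} := by
    ext z
    constructor
    · intro hz
      have hz' : R < ‖z‖ := hz
      have h0 : z ≠ 0 := norm_pos_iff.1 (hR.trans hz')
      refine ⟨Complex.log z, ?_, Complex.exp_log h0⟩
      show Real.log R < _
      rw [Complex.log_re]
      exact Real.log_lt_log hR hz'
    · rintro ⟨w, hw, rfl⟩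
      show R < _
      rw [Complex.norm_exp]
      exact (Real.log_lt_iff_lt_exp hR).1 hw
  rw [this]
  have hc : IsConnected {w : ℂ | Real.log R < w.re} := by
    refine ⟨⟨(Real.log R + 1 : ℝ), ?_⟩, (convex_halfSpace_re_gt _).isPreconnected⟩
    show Real.log R < Complex.re _
    rw [Complex.ofReal_re]; linarith
  exact hc.image _ Complex.continuous_exp.continuousOn

theorem basin_connected (hd : 2 ≤ p.natDegree) (hf : ∀ z, f z = p.eval z) :
    IsConnected (filledJulia f)ᶜ := by
  obtain ⟨R, hR, h⟩ := poly_escape hd hf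
  have hK := filled_eq hR h
  have hKo : IsOpen (filledJulia f)ᶜ := (filled_compact hd hf).isClosed.isOpen_compl
  have hext : {z : ℂ | R < ‖z‖} ⊆ (filledJulia f)ᶜ := fun z hz =>
    escape_not_mem (m := 0) hR h (le_of_lt hz)
  obtain ⟨x0, hx0⟩ := (ext_connected (lt_of_lt_of_le one_pos hR)).1
  refine ⟨⟨x0, hext hx0⟩, ?_⟩
  apply isPreconnected_of_forall x0
  intro y hy
  refine ⟨connectedComponentIn (filledJulia f)ᶜ y, connectedComponentIn_subset _ _, ?_,
    mem_connectedComponentIn hy, isPreconnected_connectedComponentIn⟩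
  set U := connectedComponentIn (filledJulia f)ᶜ y with hU
  have hUo : IsOpen U := hKo.connectedComponentIn
  suffices hmeet : ∃ z ∈ U, R < ‖z‖ by
    obtain ⟨z, hzU, hz⟩ := hmeet
    have := (ext_connected (lt_of_lt_of_le one_pos hR)).2.subset_connectedComponentIn hz hext hx0
    rw [hU, connectedComponentIn_eq hzU]; exact this
  by_contra hcon
  push Not at hcon
  have hUb : Bornology.IsBounded U := isBounded_iff_forall_norm_le.2 ⟨R, hcon⟩
  apply hy
  rw [hK]
  intro n
  apply Complex.norm_le_of_forall_mem_frontier_norm_le hUb (iter_diff hf n).diffContOnCl (C := R) _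
    (subset_closure (mem_connectedComponentIn hy))
  intro w hw
  by_contra hwR
  push Not at hwR
  have hwK : w ∈ (filledJulia f)ᶜ := escape_not_mem hR h hwR.le
  rw [hUo.frontier_eq] at hw
  apply hw.2
  have hins : IsPreconnected (insert w U) :=
    isPreconnected_connectedComponentIn.subset_closure (subset_insert _ _)
      (insert_subset hw.1 subset_closure)
  exact hins.subset_connectedComponentIn (Or.inr (mem_connectedComponentIn hy))
    (insert_subset hwK (connectedComponentIn_subset _ _)) (mem_insert _ _)

theorem hit_frontier {K : Set ℂ} (hK : IsClosed K) {w z : ℂ} (hw : w ∈ K) (hz : z ∈ frontier K) :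
    ∃ T ⊆ K ∩ segment ℝ w z, IsPreconnected T ∧ w ∈ T ∧ (T ∩ frontier K).Nonempty := by
  have segc : IsCompact (segment ℝ w z) := by
    rw [segment_eq_image_lineMap]
    exact isCompact_Icc.image (by exact AffineMap.lineMap_continuous)
  set F := K ∩ segment ℝ w z with hF
  have hFc : IsCompact F := segc.inter_left hK
  have hwF : w ∈ F := ⟨hw, left_mem_segment ℝ w z⟩
  refine ⟨connectedComponentIn F w, connectedComponentIn_subset _ _,
    isPreconnected_connectedComponentIn, mem_connectedComponentIn hwF, ?_⟩
  by_contra hcon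
  rw [not_nonempty_iff_eq_empty, ← disjoint_iff_inter_eq_empty] at hcon
  obtain ⟨Q, hQF, hwQ, hQc, hQc', hQd⟩ := exists_clopen_avoid hFc hwF isClosed_frontier hcon
  have hQi : ∀ x ∈ Q, x ∈ interior K := by
    intro x hx
    by_contra hxi
    exact Set.disjoint_left.1 hQd hx ⟨subset_closure (hQF hx).1, hxi⟩
  have hsub : segment ℝ w z ⊆ Q := by
    apply pc_split (convex_segment w z).isPreconnected hQc
      (Q := (F \ Q) ∪ (interior K)ᶜ) (hQc'.union isOpen_interior.isClosed_compl) _ _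
      (left_mem_segment ℝ w z) hwQ
    · intro x hx
      by_cases hxQ : x ∈ Q
      · exact Or.inl hxQ
      · right
        by_cases hxi : x ∈ interior K
        · exact Or.inl ⟨⟨interior_subset hxi, hx⟩, hxQ⟩
        · exact Or.inr hxi
    · rw [Set.disjoint_left]
      rintro x hx (hx' | hx')
      · exact hx'.2 hx
      · exact hx' (hQi x hx)
  exact Set.disjoint_left.1 hQd (hsub (right_mem_segment ℝ w z)) hz

theorem filled_conn {K : Set ℂ} (hK : IsClosed K) (hJ : IsConnected (frontier K)) :
    IsConnected K := by
  have hJK : frontier K ⊆ K := hK.frontier_subset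
  obtain ⟨z, hz⟩ := hJ.1
  refine ⟨⟨z, hJK hz⟩, isPreconnected_of_forall z ?_⟩
  intro w hw
  obtain ⟨T, hT, hTc, hwT, x, hxT, hxJ⟩ := hit_frontier hK hw hz
  exact ⟨T ∪ frontier K, union_subset (hT.trans inter_subset_left) hJK, Or.inr hz, Or.inl hwT,
    IsPreconnected.union x hxT hxJ hTc hJ.2⟩

theorem lcn_of_lc {J : Set ℂ} (h : LocallyConnectedSpace J) : LCn J := by
  intro x hx ε hε
  rw [locallyConnectedSpace_iff_connected_subsets] at h
  obtain ⟨V, hV, hVc, hVs⟩ := h ⟨x, hx⟩ (Metric.ball ⟨x, hx⟩ ε) (Metric.ball_mem_nhds _ hε)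
  obtain ⟨δ, hδ, hδV⟩ := Metric.mem_nhds_iff.1 hV
  refine ⟨Subtype.val '' V, ?_, hVc.image _ continuous_subtype_val.continuousOn, δ, hδ, ?_⟩
  · rintro _ ⟨y, hy, rfl⟩
    exact ⟨y.2, hVs hy⟩
  · rintro y ⟨hyJ, hy⟩
    exact ⟨⟨y, hyJ⟩, hδV hy, rfl⟩

theorem filled_lcn {K : Set ℂ} (hK : IsClosed K) (hJ : LCn (frontier K)) : LCn K := by
  have hJK : frontier K ⊆ K := hK.frontier_subset
  intro z hz ε hε
  by_cases hzi : z ∈ interior K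
  · obtain ⟨δ, hδ, hb⟩ := Metric.isOpen_iff.1 isOpen_interior z hzi
    refine ⟨Metric.ball z (min δ ε), ?_, (convex_ball _ _).isPreconnected, min δ ε,
      lt_min hδ hε, inter_subset_right⟩
    intro w hw
    exact ⟨interior_subset (hb (Metric.ball_subset_ball (min_le_left _ _) hw)),
      Metric.ball_subset_ball (min_le_right _ _) hw⟩
  · have hzJ : z ∈ frontier K := ⟨subset_closure hz, hzi⟩
    obtain ⟨V, hV, hVc, δ, hδ, hVδ⟩ := hJ z hzJ ε hε
    have hzV : z ∈ V := LCn.mem hzJ hδ hVδ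
    set δ' := min δ ε
    have hδ' : 0 < δ' := lt_min hδ hε
    refine ⟨V ∪ (K ∩ Metric.ball z δ'), ?_, ?_, δ', hδ', subset_union_right⟩
    · apply union_subset
      · exact fun w hw => ⟨hJK (hV hw).1, (hV hw).2⟩
      · exact inter_subset_inter_right _ (Metric.ball_subset_ball (min_le_right _ _))
    · apply isPreconnected_of_forall z
      rintro w (hw | ⟨hwK, hwb⟩)
      · exact ⟨V, subset_union_left, hzV, hw, hVc⟩
      · obtain ⟨T, hT, hTc, hwT, x, hxT, hxJ⟩ := hit_frontier hK hwK hzJ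
        have hTb : T ⊆ K ∩ Metric.ball z δ' := fun y hy => ⟨(hT hy).1,
          (convex_ball z δ').segment_subset hwb (Metric.mem_ball_self hδ') (hT hy).2⟩
        have hxV : x ∈ V := hVδ ⟨hxJ, Metric.ball_subset_ball (min_le_left _ _) (hTb hxT).2⟩
        exact ⟨T ∪ V, union_subset (hTb.trans subset_union_right) subset_union_left, Or.inr hzV,
          Or.inl hwT, IsPreconnected.union x hxT hxV hTc hVc⟩
end dyn


theorem holo_root {h : ℂ → ℂ} {x : ℂ} {r : ℝ} (hr : 0 < r) (hh : DifferentiableOn ℂ h (Metric.ball x r))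
    (h0 : ∀ z ∈ Metric.ball x r, h z ≠ 0) (e : ℝ) :
    ∃ H : ℂ → ℂ, DifferentiableOn ℂ H (Metric.ball x r) ∧
      ∀ z ∈ Metric.ball x r, ‖H z‖ = ‖h z‖ ^ e := by
  have hx : x ∈ Metric.ball x r := Metric.mem_ball_self hr
  have ho : IsOpen (Metric.ball x r) := Metric.isOpen_ball
  have hq : DifferentiableOn ℂ (fun z => deriv h z / h z) (Metric.ball x r) :=
    (hh.deriv ho).div hh h0
  obtain ⟨g, hgx, hg⟩ := hq.isExactOn_ball.with_val_at x (Complex.log (h x))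
  have hd : ∀ z ∈ Metric.ball x r, HasDerivAt (fun z => h z * Complex.exp (-g z)) 0 z := by
    intro z hz
    have h1 : HasDerivAt h (deriv h z) z := ((hh z hz).differentiableAt (ho.mem_nhds hz)).hasDerivAt
    have h2 := h1.mul (hg z hz).neg.cexp
    refine h2.congr_deriv ?_
    have := h0 z hz
    field_simp
    ring
  have hconst : ∀ z ∈ Metric.ball x r, Complex.exp (g z) = h z := by
    intro z hz
    have h1 := ho.is_const_of_deriv_eq_zero (convex_ball x r).isPreconnected
      (fun w hw => (hd w hw).differentiableAt.differentiableWithinAt)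
      (fun w hw => (hd w hw).deriv) hz hx
    rw [hgx, Complex.exp_neg, Complex.exp_neg, Complex.exp_log (h0 x hx),
      mul_inv_cancel₀ (h0 x hx)] at h1
    have h2 := Complex.exp_ne_zero (g z)
    field_simp at h1
    exact h1.symm
  refine ⟨fun z => Complex.exp (e * g z), ?_, ?_⟩
  · have : DifferentiableOn ℂ g (Metric.ball x r) :=
      fun z hz => (hg z hz).differentiableAt.differentiableWithinAt
    exact (this.const_mul _).cexp
  · intro z hz
    rw [← hconst z hz, Complex.norm_exp, Complex.norm_exp, ← Real.exp_mul]
    congr 1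
    simp [mul_comm]

theorem ultra_limit {H : ℕ → ℂ → ℂ} {x : ℂ} {r M : ℝ}
    (hol : ∀ n, DifferentiableOn ℂ (H n) (Metric.ball x r))
    (bd : ∀ n, ∀ z ∈ Metric.ball x r, ‖H n z‖ ≤ M) :
    ∃ G : ℂ → ℂ, DifferentiableOn ℂ G (Metric.ball x r) ∧ ∀ z ∈ Metric.ball x r,
      Filter.Tendsto (fun n => H n z) (Filter.hyperfilter ℕ : Filter ℕ) (𝓝 (G z)) := by
  have hlim : ∀ z ∈ Metric.ball x r, ∃ w, Filter.Tendsto (fun n => H n z)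
      (Filter.hyperfilter ℕ : Filter ℕ) (𝓝 w) := by
    intro z hz
    obtain ⟨w, -, hw⟩ := isCompact_iff_ultrafilter_le_nhds.1 (isCompact_closedBall (0 : ℂ) M)
      ((Filter.hyperfilter ℕ).map (fun n => H n z)) (by
        rw [Filter.le_principal_iff]
        show _ ∈ Filter.map (fun n => H n z) (Filter.hyperfilter ℕ : Filter ℕ)
        rw [Filter.mem_map]
        exact Filter.univ_mem' (fun n => by simpa using bd n z hz))
    exact ⟨w, hw⟩
  choose! G hG using hlim
  refine ⟨G, ?_, hG⟩
  have hlu : TendstoLocallyUniformlyOn H G (Filter.hyperfilter ℕ : Filter ℕ) (Metric.ball x r) := by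
    rw [Metric.tendstoLocallyUniformlyOn_iff]
    intro ε hε z0 hz0
    obtain ⟨ρ0, hρ0, hb⟩ := Metric.isOpen_iff.1 Metric.isOpen_ball z0 hz0
    set ρ := ρ0 / 3 with hρ
    have hρpos : 0 < ρ := by positivity
    have hM : 0 ≤ M := (norm_nonneg _).trans (bd 0 z0 hz0)
    have hlip : ∀ n, ∀ z ∈ Metric.ball z0 ρ, ‖H n z - H n z0‖ ≤ M / ρ * ‖z - z0‖ := by
      intro n z hz
      have hsub : ∀ w ∈ Metric.ball z0 ρ, Metric.closedBall w ρ ⊆ Metric.ball x r := by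
        intro w hw
        refine Subset.trans ?_ hb
        intro v hv
        rw [Metric.mem_closedBall] at hv
        rw [Metric.mem_ball] at hw ⊢
        have := dist_triangle v w z0
        linarith
      apply (convex_ball z0 ρ).norm_image_sub_le_of_norm_hasDerivWithin_le
        (f' := deriv (H n)) _ _ (Metric.mem_ball_self hρpos) hz
      · intro w hw
        have : w ∈ Metric.ball x r := hsub w hw (Metric.mem_closedBall_self hρpos.le)
        exact ((hol n w this).differentiableAt (Metric.isOpen_ball.mem_nhds this)).hasDerivAt.hasDerivWithinAt
      · intro w hw
        apply Complex.norm_deriv_le_of_forall_mem_sphere_norm_le hρpos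
        · exact ((hol n).mono (hsub w hw)).diffContOnCl_ball subset_rfl
        · intro v hv
          exact bd n v (hsub w hw (Metric.sphere_subset_closedBall hv))
    set L := M / ρ + 1 with hL
    have hLpos : 0 < L := by positivity
    set δ := min ρ (ε / (4 * L)) with hδ
    have hδpos : 0 < δ := lt_min hρpos (by positivity)
    have hsm : ∀ n, ∀ z ∈ Metric.ball z0 δ, ‖H n z - H n z0‖ ≤ ε / 4 := by
      intro n z hz
      have h1 := hlip n z (Metric.ball_subset_ball (min_le_left _ _) hz)
      have h2 : ‖z - z0‖ ≤ ε / (4 * L) := by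
        rw [Metric.mem_ball, dist_eq_norm] at hz
        exact hz.le.trans (min_le_right _ _)
      calc _ ≤ M / ρ * ‖z - z0‖ := h1
        _ ≤ L * (ε / (4 * L)) := by gcongr; linarith
        _ = ε / 4 := by field_simp
    have hzr : ∀ z ∈ Metric.ball z0 δ, z ∈ Metric.ball x r := by
      intro z hz
      apply hb
      apply Metric.ball_subset_ball _ hz
      exact (min_le_left _ _).trans (by linarith)
    have hG' : ∀ z ∈ Metric.ball z0 δ, ‖G z - G z0‖ ≤ ε / 4 := by
      intro z hz
      exact le_of_tendsto ((hG z (hzr z hz)).sub (hG z0 hz0)).norm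
        (Filter.Eventually.of_forall (fun n => hsm n z hz))
    refine ⟨Metric.ball z0 δ, mem_nhdsWithin_of_mem_nhds (Metric.ball_mem_nhds _ hδpos), ?_⟩
    have := (Metric.tendsto_nhds.1 (hG z0 hz0)) (ε / 4) (by positivity)
    filter_upwards [this] with n hn z hz
    have h1 := hsm n z hz
    have h2 := hG' z hz
    rw [← dist_eq_norm] at h1 h2
    have h3 := dist_triangle (G z) (G z0) (H n z)
    have h4 := dist_triangle (G z0) (H n z0) (H n z)
    rw [dist_comm (G z0) (H n z0), dist_comm (H n z0) (H n z)] at h4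
    linarith
  exact hlu.differentiableOn (Filter.Eventually.of_forall hol) Metric.isOpen_ball

theorem rpow_seq_tendsto {d : ℕ} (hd : 2 ≤ d) {c : ℝ} (hc : 0 < c) :
    Filter.Tendsto (fun n : ℕ => c ^ ((1 / (d : ℝ) ^ (n + 1) : ℝ)))
      (Filter.hyperfilter ℕ : Filter ℕ) (𝓝 1) := by
  have h1 : Filter.Tendsto (fun n : ℕ => (1 / (d : ℝ) ^ n : ℝ)) Filter.atTop (𝓝 0) := by
    simp_rw [one_div, ← inv_pow]
    apply tendsto_pow_atTop_nhds_zero_of_lt_one (by positivity)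
    apply inv_lt_one_of_one_lt₀
    exact_mod_cast (by omega : 1 < d)
  have h2 := (Real.continuousAt_const_rpow hc.ne' (b := 0)).tendsto.comp
    (h1.comp (Filter.tendsto_add_atTop_nat 1))
  rw [Real.rpow_zero] at h2
  exact h2.mono_left Nat.hyperfilter_le_atTop

theorem iter_upper {f : ℂ → ℂ} {d : ℕ} (hd : 2 ≤ d) {A : ℝ} (hA : 1 ≤ A)
    (h : ∀ z, ‖f z‖ ≤ A * (max ‖z‖ 1) ^ d) (z : ℂ) (n : ℕ) :
    A * max ‖f^[n] z‖ 1 ≤ (A * max ‖z‖ 1) ^ (d ^ n) := by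
  induction n with
  | zero => simp
  | succ n ih =>
    rw [iterate_succ_apply']
    set M := max ‖f^[n] z‖ 1
    have hM : 1 ≤ M := le_max_right _ _
    have h1 : 1 ≤ M ^ d := one_le_pow₀ hM
    have h2 : max ‖f (f^[n] z)‖ 1 ≤ A * M ^ d := max_le (h _) (by nlinarith)
    have h3 : A ^ 2 ≤ A ^ d := pow_le_pow_right₀ hA hd
    calc A * max ‖f (f^[n] z)‖ 1 ≤ A * (A * M ^ d) := by gcongr
      _ = A ^ 2 * M ^ d := by ring
      _ ≤ A ^ d * M ^ d := by gcongr
      _ = (A * M) ^ d := by rw [mul_pow]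
      _ ≤ ((A * max ‖z‖ 1) ^ d ^ n) ^ d := by gcongr
      _ = _ := by rw [← pow_mul, pow_succ]

theorem iter_lower {f : ℂ → ℂ} {d : ℕ} (hd : 2 ≤ d) {A : ℝ} (hA : 1 ≤ A)
    (h : ∀ z, A ≤ ‖z‖ → ‖z‖ ^ d ≤ A * ‖f z‖) {z : ℂ} (hz : A ≤ ‖z‖) (n : ℕ) :
    (‖z‖ / A) ^ (d ^ n) ≤ ‖f^[n] z‖ / A := by
  have hA0 : 0 < A := by linarith
  induction n with
  | zero => simp
  | succ n ih =>
    rw [iterate_succ_apply']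
    set w := f^[n] z
    have h1 : 1 ≤ (‖z‖ / A) ^ (d ^ n) := one_le_pow₀ ((one_le_div hA0).2 hz)
    have h2 : A ≤ ‖w‖ := (one_le_div hA0).1 (h1.trans ih)
    have h3 : A ^ 2 ≤ A ^ d := pow_le_pow_right₀ hA hd
    calc (‖z‖ / A) ^ (d ^ (n + 1)) = ((‖z‖ / A) ^ d ^ n) ^ d := by rw [← pow_mul, pow_succ]
      _ ≤ (‖w‖ / A) ^ d := by gcongr
      _ = ‖w‖ ^ d / A ^ d := by rw [div_pow]
      _ ≤ ‖w‖ ^ d / A ^ 2 := by gcongr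
      _ ≤ (A * ‖f w‖) / A ^ 2 := by gcongr; exact h w h2
      _ = ‖f w‖ / A := by field_simp

theorem pow_root {d : ℕ} (hd : 2 ≤ d) {y : ℝ} (hy : 0 ≤ y) (m k : ℕ) :
    (y ^ (d ^ k)) ^ (1 / (d : ℝ) ^ (m + k)) = y ^ (1 / (d : ℝ) ^ m) := by
  rw [← Real.rpow_natCast, ← Real.rpow_mul hy]
  congr 1
  have : (d : ℝ) ≠ 0 := by positivity
  push_cast
  rw [pow_add]
  field_simp

theorem lemE {p : Polynomial ℂ} {f : ℂ → ℂ} (hd : 2 ≤ p.natDegree) (hf : ∀ z, f z = p.eval z)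
    {W : Set ℂ} (hW : IsOpen W) (hWJ : (W ∩ frontier (filledJulia f)).Nonempty) {a b : ℂ}
    (hab : a ≠ b) : ∃ n, a ∈ f^[n + 1] '' W ∨ b ∈ f^[n + 1] '' W := by
  by_contra hcon
  push Not at hcon
  obtain ⟨x, hxW, hxJ⟩ := hWJ
  obtain ⟨r, hr, hrW⟩ := Metric.isOpen_iff.1 hW x hxW
  set D := Metric.ball x r with hD
  have hDo : IsOpen D := Metric.isOpen_ball
  have hxD : x ∈ D := Metric.mem_ball_self hr
  have hDc : IsPreconnected D := (convex_ball x r).isPreconnected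
  obtain ⟨A, hA, hup, hlo⟩ := poly_growth p hd hf
  obtain ⟨R, hR, hesc⟩ := poly_escape hd hf
  set d := p.natDegree with hdd
  set e : ℕ → ℝ := fun n => 1 / (d : ℝ) ^ (n + 1) with he
  have he0 : ∀ n, 0 ≤ e n := fun n => by positivity
  have he1 : ∀ n, e n ≤ 1 := fun n => by
    rw [he]; simp only
    rw [div_le_one (by positivity)]
    exact one_le_pow₀ (by exact_mod_cast (by omega : 1 ≤ d))
  have hKcl : IsClosed (filledJulia f) := (filled_compact hd hf).isClosed
  have hxK : x ∈ filledJulia f := hKcl.frontier_subset hxJ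
  have hne : ∀ c, (c = a ∨ c = b) → ∀ n, ∀ z ∈ D, f^[n + 1] z - c ≠ 0 := by
    rintro c (rfl | rfl) n z hz h0
    · exact (hcon n).1 ⟨z, hrW hz, sub_eq_zero.1 h0⟩
    · exact (hcon n).2 ⟨z, hrW hz, sub_eq_zero.1 h0⟩
  -- the limit functions
  have main : ∀ c, (c = a ∨ c = b) → ∃ (G : ℂ → ℂ), DifferentiableOn ℂ G D ∧
      ∀ z ∈ D, Filter.Tendsto (fun n => ‖f^[n + 1] z - c‖ ^ (e n))
        (Filter.hyperfilter ℕ : Filter ℕ) (𝓝 ‖G z‖) := by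
    intro c hc
    have hroot := fun n => holo_root hr (h := fun z => f^[n + 1] z - c)
      (((iter_diff hf (n + 1)).differentiableOn).sub_const c) (hne c hc n) (e n)
    choose H hH hHn using hroot
    obtain ⟨G, hG, hGl⟩ := ultra_limit (M := (1 + ‖c‖) * (A * (‖x‖ + r + 1))) hH (by
      intro n z hz
      rw [hHn n z hz]
      have hM : max ‖z‖ 1 ≤ ‖x‖ + r + 1 := by
        have h1 : ‖z‖ ≤ ‖x‖ + ‖z - x‖ := by
          have := norm_add_le x (z - x); rwa [add_sub_cancel] at this
        rw [Metric.mem_ball, dist_eq_norm] at hz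
        exact max_le (by linarith) (by linarith [norm_nonneg x])
      have h1 := iter_upper hd hA hup z (n + 1)
      set Y := A * max ‖z‖ 1 with hY
      have hY1 : 1 ≤ Y := by
        have : 1 ≤ max ‖z‖ 1 := le_max_right _ _
        nlinarith
      have h2 : ‖f^[n + 1] z‖ ≤ Y ^ (d ^ (n + 1)) := by
        have h3 : ‖f^[n + 1] z‖ ≤ max ‖f^[n + 1] z‖ 1 := le_max_left _ _
        have h4 : 1 ≤ max ‖f^[n + 1] z‖ 1 := le_max_right _ _
        nlinarith
      have h3 : 1 ≤ Y ^ (d ^ (n + 1)) := one_le_pow₀ hY1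
      have h4 : ‖f^[n + 1] z - c‖ ≤ (1 + ‖c‖) * Y ^ (d ^ (n + 1)) := by
        have := norm_sub_le (f^[n + 1] z) c
        nlinarith [norm_nonneg c]
      calc ‖f^[n + 1] z - c‖ ^ e n ≤ ((1 + ‖c‖) * Y ^ (d ^ (n + 1))) ^ e n :=
            Real.rpow_le_rpow (norm_nonneg _) h4 (he0 n)
        _ = (1 + ‖c‖) ^ e n * Y := by
            rw [Real.mul_rpow (by positivity) (by positivity)]
            have := pow_root hd (by linarith : 0 ≤ Y) 0 (n + 1)
            simp only [zero_add, pow_zero, div_one, Real.rpow_one] at this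
            rw [this]
        _ ≤ (1 + ‖c‖) * (A * (‖x‖ + r + 1)) := by
            have h5 : (1 + ‖c‖) ^ e n ≤ 1 + ‖c‖ := by
              calc (1 + ‖c‖) ^ e n ≤ (1 + ‖c‖) ^ (1 : ℝ) :=
                    Real.rpow_le_rpow_of_exponent_le (by linarith [norm_nonneg c]) (he1 n)
                _ = _ := Real.rpow_one _
            have h6 : Y ≤ A * (‖x‖ + r + 1) := by rw [hY]; gcongr
            exact mul_le_mul h5 h6 (by linarith) (by positivity))
    refine ⟨G, hG, fun z hz => ?_⟩
    refine ((hGl z hz).norm).congr (fun n => hHn n z hz)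
  obtain ⟨Ga, hGa, hla⟩ := main a (Or.inl rfl)
  obtain ⟨Gb, hGb, hlb⟩ := main b (Or.inr rfl)
  have hroot1 : ∀ c : ℝ, 0 < c → Filter.Tendsto (fun n : ℕ => c ^ (e n))
      (Filter.hyperfilter ℕ : Filter ℕ) (𝓝 1) := fun c hc => rpow_seq_tendsto hd hc
  -- on the filled Julia set
  have hKle : ‖Ga x‖ ≤ 1 := by
    have hx2 := hxK
    rw [filled_eq hR hesc] at hx2
    refine le_of_tendsto_of_tendsto (hla x hxD) (hroot1 (R + ‖a‖) (by positivity))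
      (Filter.Eventually.of_forall fun n => ?_)
    apply Real.rpow_le_rpow (norm_nonneg _) _ (he0 n)
    exact (norm_sub_le _ _).trans (by linarith [hx2 (n + 1)])
  -- the maximum is at least one
  have hmax : ∀ z ∈ D, 1 ≤ max ‖Ga z‖ ‖Gb z‖ := by
    intro z hz
    have hη : 0 < ‖a - b‖ / 2 := by
      have := norm_pos_iff.2 (sub_ne_zero.2 hab); positivity
    refine le_of_tendsto_of_tendsto (hroot1 _ hη) ((hla z hz).max (hlb z hz))
      (Filter.Eventually.of_forall fun n => ?_)
    have h1 : ‖a - b‖ ≤ ‖f^[n + 1] z - a‖ + ‖f^[n + 1] z - b‖ := by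
      have := norm_sub_le (f^[n + 1] z - b) (f^[n + 1] z - a)
      rw [sub_sub_sub_cancel_left] at this
      linarith
    rcases le_total (‖a - b‖ / 2) ‖f^[n + 1] z - a‖ with h | h
    · exact (Real.rpow_le_rpow hη.le h (he0 n)).trans (le_max_left _ _)
    · exact (Real.rpow_le_rpow hη.le (by linarith : _ ≤ ‖f^[n + 1] z - b‖) (he0 n)).trans
        (le_max_right _ _)
  -- outside the filled Julia set
  have hout : ∀ z ∈ D, z ∉ filledJulia f → 1 < ‖Ga z‖ ∧ ‖Ga z‖ = ‖Gb z‖ := by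
    intro z hz hzK
    have hbig : ∃ m, ∀ k, max R (2 * A) * 2 ^ k ≤ ‖f^[k + m] z‖ := by
      have h1 : ∃ m0, R < ‖f^[m0] z‖ := by
        rw [filled_eq hR hesc] at hzK
        by_contra h
        push Not at h
        exact hzK h
      obtain ⟨m0, hm0⟩ := h1
      obtain ⟨j, hj⟩ := pow_unbounded_of_one_lt (max R (2 * A)) (by norm_num : (1 : ℝ) < 2)
      refine ⟨j + m0, fun k => ?_⟩
      have h2 := iterate_escape hR hesc hm0.le (k + j)
      rw [← iterate_add_apply, add_assoc, pow_add] at h2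
      have h3 : (0 : ℝ) < 2 ^ k := by positivity
      have h5 : 2 ^ k * max R (2 * A) ≤ 2 ^ k * 2 ^ j := by gcongr
      have h6 : (2 : ℝ) ^ k * 2 ^ j * 1 ≤ 2 ^ k * 2 ^ j * ‖f^[m0] z‖ := by gcongr; linarith
      linarith
    obtain ⟨m, hm⟩ := hbig
    have htop : ∀ B : ℝ, ∀ᶠ n in Filter.atTop, B ≤ ‖f^[n + 1] z‖ := by
      intro B
      obtain ⟨j, hj⟩ := pow_unbounded_of_one_lt B (by norm_num : (1 : ℝ) < 2)
      filter_upwards [Filter.eventually_ge_atTop (j + m)] with n hn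
      have h1 := hm (n + 1 - m)
      rw [Nat.sub_add_cancel (by omega)] at h1
      have h2 : (2 : ℝ) ^ j ≤ 2 ^ (n + 1 - m) := pow_le_pow_right₀ (by norm_num) (by omega)
      have h3 : 1 ≤ max R (2 * A) := le_max_of_le_left hR
      have h4 : (0 : ℝ) < 2 ^ (n + 1 - m) := by positivity
      nlinarith
    have htop' : ∀ B : ℝ, ∀ᶠ n in (Filter.hyperfilter ℕ : Filter ℕ), B ≤ ‖f^[n + 1] z‖ :=
      fun B => (htop B).filter_mono Nat.hyperfilter_le_atTop
    have hcmp : ∀ c c' : ℂ, ∀ G G' : ℝ,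
        Filter.Tendsto (fun n => ‖f^[n + 1] z - c‖ ^ (e n))
        (Filter.hyperfilter ℕ : Filter ℕ) (𝓝 G) →
        Filter.Tendsto (fun n => ‖f^[n + 1] z - c'‖ ^ (e n))
        (Filter.hyperfilter ℕ : Filter ℕ) (𝓝 G') → G ≤ G' := by
      intro c c' G G' h h'
      have h2 := (hroot1 (1 + ‖c' - c‖) (by positivity)).mul h'
      rw [one_mul] at h2
      refine le_of_tendsto_of_tendsto h h2 ?_
      filter_upwards [htop' (1 + ‖c'‖)] with n hn
      rw [← Real.mul_rpow (by positivity) (norm_nonneg _)]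
      apply Real.rpow_le_rpow (norm_nonneg _) _ (he0 n)
      have h3 : 1 ≤ ‖f^[n + 1] z - c'‖ := by
        have := norm_sub_norm_le (f^[n + 1] z) c'; linarith
      have h4 : ‖f^[n + 1] z - c‖ ≤ ‖f^[n + 1] z - c'‖ + ‖c' - c‖ := by
        have := norm_add_le (f^[n + 1] z - c') (c' - c)
        rwa [sub_add_sub_cancel] at this
      nlinarith [norm_nonneg (c' - c)]
    refine ⟨?_, le_antisymm (hcmp a b _ _ (hla z hz) (hlb z hz)) (hcmp b a _ _ (hlb z hz) (hla z hz))⟩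
    set q := ‖f^[m] z‖ / A with hq
    have hA0 : 0 < A := by linarith
    have hmA : 2 * A ≤ ‖f^[m] z‖ := by
      have := hm 0
      simp only [pow_zero, mul_one, zero_add] at this
      exact (le_max_right _ _).trans this
    have hq2 : 2 ≤ q := (le_div_iff₀ hA0).2 hmA
    have hgt : 1 < q ^ (1 / (d : ℝ) ^ m) := Real.one_lt_rpow (by linarith) (by positivity)
    refine lt_of_lt_of_le hgt ?_
    have h2 := (hroot1 (1 / 2) (by norm_num)).mul_const (q ^ (1 / (d : ℝ) ^ m))
    rw [one_mul] at h2
    refine le_of_tendsto_of_tendsto h2 (hla z hz) ?_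
    filter_upwards [htop' (2 * ‖a‖), Filter.Eventually.filter_mono Nat.hyperfilter_le_atTop
      (Filter.eventually_ge_atTop m)] with n hn hnm
    have h3 := iter_lower hd hA hlo (by linarith : A ≤ ‖f^[m] z‖) (n + 1 - m)
    rw [← iterate_add_apply, Nat.sub_add_cancel (by omega)] at h3
    have h4 : q ^ d ^ (n + 1 - m) ≤ ‖f^[n + 1] z‖ := by
      refine h3.trans (div_le_self (norm_nonneg _) hA)
    have h5 : 1 / 2 * q ^ d ^ (n + 1 - m) ≤ ‖f^[n + 1] z - a‖ := by
      have := norm_sub_norm_le (f^[n + 1] z) a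
      linarith
    have h6 := Real.rpow_le_rpow (by positivity) h5 (he0 n)
    rw [Real.mul_rpow (by norm_num) (by positivity)] at h6
    have h7 := pow_root hd (by linarith : 0 ≤ q) m (n + 1 - m)
    rw [Nat.add_sub_cancel' (by omega)] at h7
    rw [← h7]; exact h6
  -- a point outside
  obtain ⟨y, hyD, hyK⟩ : ∃ y ∈ D, y ∉ filledJulia f := by
    have : x ∈ closure (filledJulia f)ᶜ := by
      rw [frontier_eq_closure_inter_closure] at hxJ; exact hxJ.2
    obtain ⟨y, h1, h2⟩ := mem_closure_iff.1 this D hDo hxD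
    exact ⟨y, h1, h2⟩
  obtain ⟨s, hs, hsD⟩ := Metric.isOpen_iff.1 (hDo.inter hKcl.isOpen_compl) y ⟨hyD, hyK⟩
  set B := Metric.ball y s with hB
  have hyB : y ∈ B := Metric.mem_ball_self hs
  have hGb0 : ∀ z ∈ B, Gb z ≠ 0 := by
    intro z hz h0
    have := hout z (hsD hz).1 (hsD hz).2
    rw [this.2, h0, norm_zero] at this
    linarith [this.1]
  have hquot : ∀ z ∈ B, ‖Ga z / Gb z‖ = 1 := by
    intro z hz
    rw [norm_div, (hout z (hsD hz).1 (hsD hz).2).2]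
    exact div_self (norm_ne_zero_iff.2 (hGb0 z hz))
  have hBD : B ⊆ D := fun z hz => (hsD hz).1
  have hconst := Complex.eqOn_of_isPreconnected_of_isMaxOn_norm (f := fun z => Ga z / Gb z)
    (convex_ball y s).isPreconnected Metric.isOpen_ball ((hGa.mono hBD).div (hGb.mono hBD) hGb0) hyB
    (by
      intro z hz
      show ‖Ga z / Gb z‖ ≤ ‖Ga y / Gb y‖
      rw [hquot z hz, hquot y hyB])
  set lam := Ga y / Gb y with hlam
  have hEq : EqOn Ga (fun z => lam * Gb z) D := by
    apply (hGa.analyticOnNhd hDo).eqOn_of_preconnected_of_eventuallyEq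
      ((hGb.const_mul lam).analyticOnNhd hDo) hDc hyD
    filter_upwards [Metric.isOpen_ball.mem_nhds hyB] with z hz
    have h1 : Ga z / Gb z = lam := hconst hz
    rw [← h1, div_mul_cancel₀ _ (hGb0 z hz)]
  have hge : ∀ z ∈ D, 1 ≤ ‖Ga z‖ := by
    intro z hz
    have h1 := hmax z hz
    have h2 : ‖Ga z‖ = ‖Gb z‖ := by
      rw [hEq hz]; simp only; rw [norm_mul, hlam, hquot y hyB, one_mul]
    rwa [← h2, max_self] at h1
  have hGa0 : ∀ z ∈ D, Ga z ≠ 0 := fun z hz h0 => by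
    have := hge z hz; rw [h0, norm_zero] at this; linarith
  have hfin := Complex.norm_eqOn_of_isPreconnected_of_isMaxOn (f := fun z => (Ga z)⁻¹) hDc hDo
    (hGa.inv hGa0) hxD (by
      intro z hz
      show ‖(Ga z)⁻¹‖ ≤ ‖(Ga x)⁻¹‖
      rw [norm_inv, norm_inv]
      exact inv_anti₀ (by linarith [hge x hxD]) (hKle.trans (hge z hz)))
  have h1 : ‖(Ga y)⁻¹‖ = ‖(Ga x)⁻¹‖ := hfin hyD
  rw [norm_inv, norm_inv, inv_inj] at h1
  linarith [(hout y hyD hyK).1]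


theorem closed_nbhd {J : Set ℂ} (hJ : LCn J) (hJc : IsCompact J) {x : ℂ} (hx : x ∈ J) {ε : ℝ}
    (hε : 0 < ε) : ∃ V ⊆ J ∩ Metric.closedBall x ε, IsCompact V ∧ IsConnected V ∧ x ∈ V ∧
      ∃ δ > 0, J ∩ Metric.ball x δ ⊆ V := by
  obtain ⟨V, hV, hVc, δ, hδ, h⟩ := hJ x hx ε hε
  have hxV : x ∈ V := h ⟨hx, Metric.mem_ball_self hδ⟩
  have hsub : closure V ⊆ J ∩ Metric.closedBall x ε := by
    apply closure_minimal _ (hJc.isClosed.inter Metric.isClosed_closedBall)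
    exact fun z hz => ⟨(hV hz).1, Metric.ball_subset_closedBall (hV hz).2⟩
  exact ⟨closure V, hsub, hJc.of_isClosed_subset isClosed_closure fun z hz => (hsub hz).1,
    ⟨⟨x, subset_closure hxV⟩, hVc.closure⟩, subset_closure hxV, δ, hδ, h.trans subset_closure⟩

theorem frontier_sub_closure_compl (K : Set ℂ) : frontier K ⊆ closure Kᶜ := by
  rw [frontier_eq_closure_inter_closure]; exact inter_subset_right

theorem nullity {K : Set ℂ} (hK : IsCompact K) (hKc : IsConnected Kᶜ) (hJ : LCn (frontier K))
    {C : ℕ → Set ℂ} (hC : ∀ i, IsCompact (C i)) (cC : ∀ i, IsPreconnected (C i))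
    (hCJ : ∀ i, C i ⊆ frontier K) (hd : ∀ i j, i ≠ j → Disjoint (C i) (C j)) {ε : ℝ} (hε : 0 < ε) :
    ∃ N, ∀ n ≥ N, ∀ x ∈ C n, ∀ y ∈ C n, dist x y < ε := by
  by_contra hcon
  push Not at hcon
  choose n hn x hx y hy hxy using hcon
  have hJK : frontier K ⊆ K := hK.isClosed.frontier_subset
  have hJc : IsCompact (frontier K) := hK.of_isClosed_subset isClosed_frontier hJK
  obtain ⟨⟨a, b⟩, ⟨ha, hb⟩, φ, hφ, hlim⟩ := (hJc.prod hJc).tendsto_subseq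
    (x := fun k => (x k, y k)) (fun k => ⟨hCJ _ (hx k), hCJ _ (hy k)⟩)
  simp only at ha hb
  have hla : Filter.Tendsto (fun k => x (φ k)) Filter.atTop (𝓝 a) :=
    (continuous_fst.tendsto _).comp hlim
  have hlb : Filter.Tendsto (fun k => y (φ k)) Filter.atTop (𝓝 b) :=
    (continuous_snd.tendsto _).comp hlim
  have hab : ε ≤ dist a b := ge_of_tendsto' (hla.dist hlb) fun k => hxy _
  obtain ⟨X, hX, hXc, cX, -, δ1, hδ1, hX1⟩ := closed_nbhd hJ hJc ha (by positivity : 0 < ε / 3)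
  obtain ⟨Y, hY, hYc, cY, -, δ2, hδ2, hY1⟩ := closed_nbhd hJ hJc hb (by positivity : 0 < ε / 3)
  have hXY : Disjoint X Y := by
    rw [Set.disjoint_left]
    intro z hz hz'
    have h1 := (hX hz).2; have h2 := (hY hz').2
    rw [Metric.mem_closedBall] at h1 h2
    have := dist_triangle_left a b z
    linarith
  have hev : ∀ᶠ k in Filter.atTop, x (φ k) ∈ X ∧ y (φ k) ∈ Y := by
    filter_upwards [hla (Metric.ball_mem_nhds a hδ1), hlb (Metric.ball_mem_nhds b hδ2)] with k h1 h2
    exact ⟨hX1 ⟨hCJ _ (hx _), h1⟩, hY1 ⟨hCJ _ (hy _), h2⟩⟩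
  obtain ⟨k0, hk0⟩ := Filter.eventually_atTop.1 hev
  have hstep : ∀ m, ∃ k ≥ k0, m < n (φ k) := fun m =>
    ⟨max k0 (m + 1), le_max_left _ _, by
      have h1 := hn (φ (max k0 (m + 1)))
      have h2 := hφ.id_le (max k0 (m + 1))
      have h3 := le_max_right k0 (m + 1)
      simp only [id_eq] at h2
      omega⟩
  obtain ⟨k1, h1, -⟩ := hstep 0
  obtain ⟨k2, h2, h12⟩ := hstep (n (φ k1))
  obtain ⟨k3, h3, h23⟩ := hstep (n (φ k2))
  set kk : Fin 3 → ℕ := ![k1, k2, k3] with hkk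
  have hkk0 : ∀ i, k0 ≤ kk i := by
    intro i; fin_cases i <;> simp [*]
  have hinj : ∀ i j, i ≠ j → n (φ (kk i)) ≠ n (φ (kk j)) := by
    intro i j hij
    fin_cases i <;> fin_cases j <;> simp [hkk] at hij ⊢ <;> omega
  have hKd : ∀ S ⊆ frontier K, Disjoint S Kᶜ := fun S hS =>
    (disjoint_compl_right (a := K)).mono_left (hS.trans hJK)
  exact theta_lemma hXc hYc cX cY hXY (β := fun i => C (n (φ (kk i)))) (fun i => hC _)
    (fun i => cC _) (fun i j hij => hd _ _ (hinj i j hij))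
    (fun i => ⟨_, hx _, (hk0 _ (hkk0 i)).1⟩) (fun i => ⟨_, hy _, (hk0 _ (hkk0 i)).2⟩)
    hK.isClosed.isOpen_compl hKc (hKd _ fun z hz => (hX hz).1) (hKd _ fun z hz => (hY hz).1)
    (fun i => hKd _ (hCJ _)) (fun i => (hCJ _).trans (frontier_sub_closure_compl K))

theorem cc_joined {K C : Set ℂ} (hK : LCn K) (hKc : IsCompact K) (hC : IsClosed C) {x y z : ℂ}
    (hy : y ∈ connectedComponentIn (K \ C) x) (hz : z ∈ connectedComponentIn (K \ C) x) :
    ∃ Γ ⊆ connectedComponentIn (K \ C) x, IsCompact Γ ∧ IsConnected Γ ∧ y ∈ Γ ∧ z ∈ Γ := by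
  set D := connectedComponentIn (K \ C) x with hD
  have hDp : IsPreconnected D := isPreconnected_connectedComponentIn
  obtain ⟨U, hU, hDU⟩ := cc_relopen hK hC x
  rw [← hD] at hDU
  refine hDp.induction₂ (fun y z => ∃ Γ ⊆ D, IsCompact Γ ∧ IsConnected Γ ∧ y ∈ Γ ∧ z ∈ Γ)
    ?_ ?_ ?_ hy hz
  · intro w hw
    have hw2 := hw
    rw [hDU] at hw2
    obtain ⟨r, hr, hrU⟩ := Metric.isOpen_iff.1 hU w hw2.1
    obtain ⟨V, hV, hVc, cV, hwV, δ, hδ, hVδ⟩ := closed_nbhd hK hKc hw2.2 (half_pos hr)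
    filter_upwards [inter_mem_nhdsWithin D (Metric.ball_mem_nhds w hδ)] with v hv
    refine ⟨V, ?_, hVc, cV, hwV, hVδ ⟨?_, hv.2⟩⟩
    · rw [hDU]
      exact fun u hu => ⟨hrU (Metric.closedBall_subset_ball (half_lt_self hr) (hV hu).2),
        (hV hu).1⟩
    · have := hv.1; rw [hDU] at this; exact this.2
  · rintro a b c _ _ _ ⟨Γ, h1, h2, h3, h4, h5⟩ ⟨Γ', g1, g2, g3, g4, g5⟩
    exact ⟨Γ ∪ Γ', union_subset h1 g1, h2.union g2, h3.union ⟨b, h5, g4⟩ g3, Or.inl h4, Or.inr g5⟩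
  · rintro a b _ _ ⟨Γ, h1, h2, h3, h4, h5⟩
    exact ⟨Γ, h1, h2, h3, h5, h4⟩

theorem more_comps {K : Set ℂ} (hK : IsCompact K) (hKc : IsConnected Kᶜ) (hKl : LCn K)
    (hJ : LCn (frontier K)) {C : Set ℂ} (hC : IsCompact C) (cC : IsConnected C)
    (hCJ : C ⊆ frontier K) (hC2 : C.Nontrivial)
    (hno : ∀ W : Set ℂ, IsOpen W → (W ∩ frontier K).Nonempty → ¬ (W ∩ frontier K ⊆ C))
    (T : Finset ℂ) : ∃ y ∈ frontier K \ C, ∀ t ∈ T, y ∉ connectedComponentIn (K \ C) t := by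
  by_contra hcon
  push Not at hcon
  have hJK : frontier K ⊆ K := hK.isClosed.frontier_subset
  have hJc : IsCompact (frontier K) := hK.of_isClosed_subset isClosed_frontier hJK
  have hcov : C ⊆ ⋃ t ∈ T, closure (connectedComponentIn (K \ C) t ∩ frontier K) := by
    rw [← Finset.closure_biUnion]
    intro c hc
    rw [mem_closure_iff]
    intro W hW hcW
    have h1 := hno W hW ⟨c, hcW, hCJ hc⟩
    obtain ⟨y, hy, hyC⟩ := Set.not_subset.1 h1
    obtain ⟨t, ht, hyt⟩ := hcon y ⟨hy.2, hyC⟩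
    exact ⟨y, hy.1, mem_iUnion₂.2 ⟨t, ht, hyt, hy.2⟩⟩
  have hinf : C.Infinite := cC.isPreconnected.infinite_of_nontrivial hC2
  obtain ⟨t, ht, htinf⟩ : ∃ t ∈ T,
      (C ∩ closure (connectedComponentIn (K \ C) t ∩ frontier K)).Infinite := by
    by_contra h
    push Not at h
    apply hinf
    refine (T.finite_toSet.biUnion (t := fun t =>
      C ∩ closure (connectedComponentIn (K \ C) t ∩ frontier K)) fun t ht => ?_).subset ?_
    · exact h t ht
    · intro c hc
      obtain ⟨t, ht, h2⟩ := mem_iUnion₂.1 (hcov hc)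
      exact mem_iUnion₂.2 ⟨t, ht, hc, h2⟩
  set D := connectedComponentIn (K \ C) t with hD
  have hDsub : D ⊆ K \ C := connectedComponentIn_subset _ _
  obtain ⟨F, hF, hFc⟩ := htinf.exists_subset_card_eq 3
  let e := F.equivFinOfCardEq hFc
  set x : Fin 3 → ℂ := fun i => (e.symm i : ℂ) with hx
  have hxF : ∀ i, x i ∈ C ∩ closure (D ∩ frontier K) := fun i => hF (e.symm i).2
  have hxi : Injective x := fun i j h => e.symm.injective (Subtype.ext h)
  obtain ⟨ε, hε, hsep⟩ : ∃ ε > 0, ∀ i j, i ≠ j → ε ≤ dist (x i) (x j) := by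
    have h01 := dist_pos.2 (hxi.ne (show (0 : Fin 3) ≠ 1 by decide))
    have h02 := dist_pos.2 (hxi.ne (show (0 : Fin 3) ≠ 2 by decide))
    have h12 := dist_pos.2 (hxi.ne (show (1 : Fin 3) ≠ 2 by decide))
    refine ⟨min (dist (x 0) (x 1)) (min (dist (x 0) (x 2)) (dist (x 1) (x 2))),
      lt_min h01 (lt_min h02 h12), ?_⟩
    intro i j hij
    fin_cases i <;> fin_cases j <;> simp at hij ⊢ <;> simp [dist_comm (x 1) (x 0),
      dist_comm (x 2) (x 0), dist_comm (x 2) (x 1)]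
  have hβ := fun i => closed_nbhd hJ hJc (hCJ (hxF i).1) (by positivity : 0 < ε / 3)
  choose β hβJ hβc cβ hxβ δ hδ hβδ using hβ
  have hy : ∀ i, ∃ y ∈ D ∩ frontier K, y ∈ β i := by
    intro i
    obtain ⟨y, hy, hy2⟩ := Metric.mem_closure_iff.1 (hxF i).2 (δ i) (hδ i)
    exact ⟨y, hy, hβδ i ⟨hy.2, by rwa [Metric.mem_ball, dist_comm]⟩⟩
  choose y hyD hyβ using hy
  obtain ⟨Γ1, h1, h1c, c1, h10, h11⟩ := cc_joined hKl hK hC.isClosed (hyD 0).1 (hyD 1).1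
  obtain ⟨Γ2, h2, h2c, c2, h20, h21⟩ := cc_joined hKl hK hC.isClosed (hyD 0).1 (hyD 2).1
  have hΓD : Γ1 ∪ Γ2 ⊆ D := union_subset h1 h2
  have hyΓ : ∀ i, y i ∈ Γ1 ∪ Γ2 := by
    intro i; fin_cases i
    · exact Or.inl h10
    · exact Or.inl h11
    · exact Or.inr h21
  have hKd : ∀ S ⊆ K, Disjoint S Kᶜ := fun S hS =>
    (disjoint_compl_right (a := K)).mono_left hS
  have hβJ' : ∀ i, β i ⊆ frontier K := fun i z hz => (hβJ i hz).1
  refine theta_lemma hC (h1c.union h2c) cC (c1.union ⟨y 0, h10, h20⟩ c2) ?_ hβc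
    (fun i => (cβ i).isPreconnected) ?_ (fun i => ⟨x i, hxβ i, (hxF i).1⟩)
    (fun i => ⟨y i, hyβ i, hyΓ i⟩) hK.isClosed.isOpen_compl hKc (hKd _ (hCJ.trans hJK))
    (hKd _ fun z hz => (hDsub (hΓD hz)).1) (fun i => hKd _ ((hβJ' i).trans hJK))
    (fun i => (hβJ' i).trans (frontier_sub_closure_compl K))
  · rw [Set.disjoint_left]
    exact fun z hz hz' => (hDsub (hΓD hz')).2 hz
  · intro i j hij
    rw [Set.disjoint_left]
    intro z hz hz'
    have h1 := (hβJ i hz).2; have h2 := (hβJ j hz').2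
    rw [Metric.mem_closedBall] at h1 h2
    have := dist_triangle_left (x i) (x j) z
    linarith [hsep i j hij]

open Classical in
theorem many_comps {K : Set ℂ} (hK : IsCompact K) (hKc : IsConnected Kᶜ) (hKl : LCn K)
    (hJ : LCn (frontier K)) {C : Set ℂ} (hC : IsCompact C) (cC : IsConnected C)
    (hCJ : C ⊆ frontier K) (hC2 : C.Nontrivial)
    (hno : ∀ W : Set ℂ, IsOpen W → (W ∩ frontier K).Nonempty → ¬ (W ∩ frontier K ⊆ C))
    (k : ℕ) : ∃ T : Finset ℂ, T.card = k ∧ (∀ t ∈ T, t ∈ frontier K \ C) ∧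
      ∀ s ∈ T, ∀ t ∈ T, connectedComponentIn (K \ C) s = connectedComponentIn (K \ C) t → s = t := by
  have hJK : frontier K ⊆ K := hK.isClosed.frontier_subset
  induction k with
  | zero => exact ⟨∅, by simp⟩
  | succ k ih =>
    obtain ⟨T, hT, h1, h2⟩ := ih
    obtain ⟨y, hy, hyT⟩ := more_comps hK hKc hKl hJ hC cC hCJ hC2 hno T
    have hyy : y ∈ connectedComponentIn (K \ C) y := mem_connectedComponentIn ⟨hJK hy.1, hy.2⟩
    have hyn : y ∉ T := fun h => hyT y h hyy
    refine ⟨insert y T, by rw [Finset.card_insert_of_notMem hyn, hT], ?_, ?_⟩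
    · intro t ht
      rcases Finset.mem_insert.1 ht with rfl | ht
      · exact hy
      · exact h1 t ht
    · intro s hs t ht hst
      rcases Finset.mem_insert.1 hs with h3 | h3 <;> rcases Finset.mem_insert.1 ht with h4 | h4
      · rw [h3, h4]
      · rw [h3] at hst; exact absurd (hst ▸ hyy) (hyT t h4)
      · rw [h4] at hst; exact absurd (hst.symm ▸ hyy) (hyT s h3)
      · exact h2 s h3 t h4 hst


theorem lemZ {K : Set ℂ} (hK : IsCompact K) (hKl : LCn K) {η : ℝ} (hη : 0 < η) :
    ∃ Z : Finset ℂ, (↑Z : Set ℂ) ⊆ K ∧ ∀ (C : Set ℂ) (w : ℂ), w ∈ K \ C →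
      (∀ z ∈ Z, z ∉ connectedComponentIn (K \ C) w) → ∃ c ∈ C, dist w c < η := by
  have h := fun x : K => hKl x.1 x.2 (η / 2) (by positivity)
  choose V hV hVc δ hδ hVδ using h
  obtain ⟨T, hT⟩ := hK.elim_finite_subcover (fun x : K => Metric.ball x.1 (δ x))
    (fun x => Metric.isOpen_ball)
    (fun x hx => mem_iUnion.2 ⟨⟨x, hx⟩, Metric.mem_ball_self (hδ _)⟩)
  classical
  refine ⟨T.image Subtype.val, ?_, ?_⟩
  · intro z hz
    obtain ⟨x, -, rfl⟩ := Finset.mem_image.1 hz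
    exact x.2
  · intro C w hw hmiss
    obtain ⟨x, hxT, hwx⟩ := mem_iUnion₂.1 (hT hw.1)
    have hwV : w ∈ V x := hVδ x ⟨hw.1, hwx⟩
    have hxV : x.1 ∈ V x := hVδ x ⟨x.2, Metric.mem_ball_self (hδ _)⟩
    by_contra hcon
    push Not at hcon
    refine hmiss x.1 (Finset.mem_image_of_mem _ hxT) ?_
    refine (hVc x).subset_connectedComponentIn hwV ?_ hxV
    intro u hu
    refine ⟨(hV x hu).1, fun huC => ?_⟩
    have h1 := hcon u huC
    have h2 := (hV x hu).2
    have h3 := (hV x hwV).2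
    rw [Metric.mem_ball] at h2 h3
    have := dist_triangle_right w u x
    linarith

theorem exists_mth_chart {f : ℂ → ℂ} {c : ℂ} (hf : AnalyticAt ℂ f c)
    (hnc : ¬ ∀ᶠ z in 𝓝 c, f z = f c) :
    ∃ (m : ℕ) (ψ : ℂ → ℂ) (a : ℂ), m ≠ 0 ∧ a ≠ 0 ∧ HasStrictDerivAt ψ a c ∧ ψ c = 0 ∧
      ∀ᶠ z in 𝓝 c, f z - f c = ψ z ^ m := by
  have h1 : AnalyticAt ℂ (fun z => f z - f c) c := hf.sub analyticAt_const
  have h2 : ¬ ∀ᶠ z in 𝓝 c, f z - f c = 0 := by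
    simpa only [sub_eq_zero] using hnc
  obtain ⟨m, g, hg, hg0, hgm⟩ := h1.exists_eventuallyEq_pow_smul_nonzero_iff.2 h2
  have hm : m ≠ 0 := by
    rintro rfl
    have := hgm.self_of_nhds
    simp at this
    exact hg0 this.symm
  obtain ⟨a, ha⟩ := IsAlgClosed.exists_pow_nat_eq (g c) (Nat.pos_of_ne_zero hm)
  have ha0 : a ≠ 0 := by rintro rfl; rw [zero_pow hm] at ha; exact hg0 ha.symm
  have hq : AnalyticAt ℂ (fun z => g z / g c) c := hg.div analyticAt_const hg0
  have hslit : g c / g c ∈ Complex.slitPlane := by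
    rw [div_self hg0]; exact Complex.one_mem_slitPlane
  have hl : AnalyticAt ℂ (fun z => a * Complex.exp (Complex.log (g z / g c) / m)) c :=
    analyticAt_const.mul ((hq.clog hslit).div analyticAt_const (by exact_mod_cast hm)).cexp
  set k : ℂ → ℂ := fun z => a * Complex.exp (Complex.log (g z / g c) / m) with hk
  have hψ : AnalyticAt ℂ (fun z => (z - c) * k z) c :=
    (analyticAt_id.sub analyticAt_const).mul hl
  have hkc : k c = a := by simp [hk, div_self hg0]
  have hder : HasDerivAt (fun z => (z - c) * k z) a c := by
    have := ((hasDerivAt_id c).sub_const c).mul hl.differentiableAt.hasDerivAt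
    have h3 : (1 * k c + (id c - c) * deriv k c) = a := by simp [hkc]
    exact h3 ▸ this
  refine ⟨m, fun z => (z - c) * k z, a, hm, ha0, ?_, by simp, ?_⟩
  · have := hψ.hasStrictDerivAt
    rwa [hder.deriv] at this
  · have hne : ∀ᶠ z in 𝓝 c, g z ≠ 0 := hg.continuousAt.eventually_ne hg0
    filter_upwards [hgm, hne] with z hz hz0
    rw [hz, smul_eq_mul, mul_pow, hk]
    simp only
    rw [mul_pow, ha, ← Complex.exp_nat_mul, mul_div_cancel₀ _ (by exact_mod_cast hm : (m : ℂ) ≠ 0),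
      Complex.exp_log (div_ne_zero hz0 hg0), mul_div_cancel₀ _ hg0]

theorem loc_homeo {ψ : ℂ → ℂ} {a c : ℂ} (h : HasStrictDerivAt ψ a c) (ha : a ≠ 0) :
    ∃ e : OpenPartialHomeomorph ℂ ℂ, ⇑e = ψ ∧ c ∈ e.source := by
  have h2 := h.hasStrictFDerivAt_equiv ha
  exact ⟨h2.toOpenPartialHomeomorph _, h2.toOpenPartialHomeomorph_coe,
    h2.mem_toOpenPartialHomeomorph_source⟩

theorem loc_sec {f : ℂ → ℂ} {c : ℂ} (hf : AnalyticAt ℂ f c) (hfc : Continuous f)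
    (hnc : ¬ ∀ᶠ z in 𝓝 c, f z = f c) :
    ∃ r > 0, ∃ ρ > 0, ∀ C Y : Set ℂ, IsConnected C → C ⊆ Metric.ball c r → f '' C ⊆ Y →
      Y ⊆ Metric.ball (f c) ρ → (deriv f c = 0 → HasLog Y (fun w => w - f c)) →
      ∃ σ : ℂ → ℂ, ContinuousOn σ Y ∧ (∀ w ∈ Y, f (σ w) = w) ∧ ∀ x ∈ C, σ (f x) = x := by
  by_cases hder : deriv f c = 0
  swap
  · obtain ⟨e, he, hce⟩ := loc_homeo hf.hasStrictDerivAt hder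
    obtain ⟨r, hr, hrs⟩ := Metric.isOpen_iff.1 e.open_source c hce
    obtain ⟨ρ, hρ, hρt⟩ := Metric.isOpen_iff.1 e.open_target (e c) (e.map_source hce)
    refine ⟨r, hr, ρ, hρ, fun C Y _ hCr _ hY _ => ⟨e.symm, ?_, ?_, ?_⟩⟩
    · exact e.continuousOn_symm.mono (hY.trans (by rw [← he]; exact hρt))
    · intro w hw
      rw [← he]
      exact e.right_inv (hρt (by rw [he]; exact hY hw))
    · intro x hx
      rw [← he]
      exact e.left_inv (hrs (hCr hx))
  obtain ⟨m, ψ, a, hm, ha, hψ, hψc, hev⟩ := exists_mth_chart hf hnc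
  have hm' : (m : ℂ) ≠ 0 := by exact_mod_cast hm
  obtain ⟨e, he, hce⟩ := loc_homeo hψ ha
  obtain ⟨N, hN, hNo, hcN⟩ := eventually_nhds_iff.1 hev
  obtain ⟨r, hr, hrs⟩ := Metric.isOpen_iff.1 (e.open_source.inter hNo) c ⟨hce, hcN⟩
  have hopen := e.isOpen_inter_preimage_symm hNo
  have h0 : (0 : ℂ) ∈ e.target ∩ e.symm ⁻¹' N := by
    have h1 : e c = 0 := by rw [he, hψc]
    refine ⟨h1 ▸ e.map_source hce, ?_⟩
    rw [mem_preimage, ← h1, e.left_inv hce]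
    exact hcN
  obtain ⟨ρ, hρ, hρs⟩ := Metric.isOpen_iff.1 hopen 0 h0
  refine ⟨r, hr, ρ ^ m, by positivity, fun C Y hC hCr hCY hY hlog => ?_⟩
  obtain ⟨L, hL, hLe⟩ := hlog hder
  set E : ℂ → ℂ := fun w => Complex.exp (L w / m) with hE
  have hEm : ∀ w ∈ Y, E w ^ m = w - f c := fun w hw => by
    rw [hE]; simp only
    rw [← Complex.exp_nat_mul, mul_div_cancel₀ _ hm', hLe w hw]
  have hEc : ContinuousOn E Y := (hL.div_const _).cexp
  have hE0 : ∀ w, E w ≠ 0 := fun w => Complex.exp_ne_zero _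
  have hψm : ∀ x ∈ C, E (f x) ^ m = ψ x ^ m := fun x hx => by
    rw [hEm _ (hCY ⟨x, hx, rfl⟩), hN x (hrs (hCr hx)).2]
  have hψ0 : ∀ x ∈ C, ψ x ≠ 0 := fun x hx h => by
    have := hψm x hx
    rw [h, zero_pow hm] at this
    exact hE0 _ (pow_eq_zero_iff hm |>.1 this)
  have hψC : ContinuousOn ψ C := by
    rw [← he]; exact e.continuousOn.mono fun x hx => (hrs (hCr hx)).1
  set q : ℂ → ℂ := fun x => E (f x) / ψ x with hq
  have hqc : ContinuousOn q C :=
    (hEc.comp hfc.continuousOn fun x hx => hCY ⟨x, hx, rfl⟩).div hψC hψ0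
  have hq1 : ∀ x ∈ C, q x ^ m = 1 := fun x hx => by
    rw [hq]; simp only
    rw [div_pow, hψm x hx, div_self (pow_ne_zero _ (hψ0 x hx))]
  have hfin : (q '' C).Finite := by
    have h1 : {z : ℂ | z ^ m = 1}.Finite := by
      have h2 := (Polynomial.X ^ m - 1 : Polynomial ℂ).rootSet_finite ℂ
      refine h2.subset ?_
      intro z hz
      rw [Polynomial.mem_rootSet]
      refine ⟨Polynomial.X_pow_sub_C_ne_zero (Nat.pos_of_ne_zero hm) (1 : ℂ), ?_⟩
      have hz1 : z ^ m = 1 := hz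
      simp [hz1]
    refine h1.subset ?_
    rintro _ ⟨x, hx, rfl⟩
    exact hq1 x hx
  have hsub : (q '' C).Subsingleton := by
    by_contra h
    exact (hC.isPreconnected.image q hqc).infinite_of_nontrivial (Set.not_subsingleton_iff.1 h) hfin
  obtain ⟨x0, hx0⟩ := hC.nonempty
  set ζ := q x0 with hζ
  have hζ1 : ζ ^ m = 1 := hq1 x0 hx0
  have hζ0 : ζ ≠ 0 := by intro h; rw [h, zero_pow hm] at hζ1; exact zero_ne_one hζ1
  have hζq : ∀ x ∈ C, E (f x) = ζ * ψ x := fun x hx => by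
    have h1 : q x = ζ := hsub ⟨x, hx, rfl⟩ ⟨x0, hx0, rfl⟩
    rw [← h1, hq]; simp only
    rw [div_mul_cancel₀ _ (hψ0 x hx)]
  have hmap : ∀ w ∈ Y, ζ⁻¹ * E w ∈ Metric.ball (0 : ℂ) ρ := fun w hw => by
    rw [mem_ball_zero_iff]
    refine lt_of_pow_lt_pow_left₀ m hρ.le ?_
    rw [← norm_pow, mul_pow, inv_pow, hζ1, inv_one, one_mul, hEm w hw, ← dist_eq_norm]
    exact hY hw
  refine ⟨fun w => e.symm (ζ⁻¹ * E w), ?_, ?_, ?_⟩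
  · exact e.continuousOn_symm.comp (hEc.const_mul _) fun w hw => (hρs (hmap w hw)).1
  · intro w hw
    have h1 := hρs (hmap w hw)
    have h2 := hN _ h1.2
    rw [← he, e.right_inv h1.1, mul_pow, inv_pow, hζ1, inv_one, one_mul, hEm w hw] at h2
    exact sub_left_injective h2
  · intro x hx
    simp only
    rw [hζq x hx, inv_mul_cancel_left₀ hζ0, ← he, e.left_inv (hrs (hCr hx)).1]

theorem unif_sec {f : ℂ → ℂ} (hf : ∀ c, AnalyticAt ℂ f c) (hnc : ∀ c, ¬ ∀ᶠ z in 𝓝 c, f z = f c)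
    {K : Set ℂ} (hK : IsCompact K) :
    ∃ δ > 0, ∃ η > 0, ∀ C Y : Set ℂ, IsConnected C → (C ∩ K).Nonempty →
      (∀ x ∈ C, ∀ y ∈ C, dist x y < δ) → f '' C ⊆ Y →
      (∀ w ∈ Y, ∃ v ∈ f '' C, dist w v < η) →
      (∀ c, deriv f c = 0 → HasLog Y (fun w => w - f c)) →
      ∃ σ : ℂ → ℂ, ContinuousOn σ Y ∧ (∀ w ∈ Y, f (σ w) = w) ∧ ∀ x ∈ C, σ (f x) = x := by
  have hfc : Continuous f := continuous_iff_continuousAt.2 fun c => (hf c).continuousAt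
  refine hK.induction_on (p := fun K => ∃ δ > 0, ∃ η > 0, ∀ C Y : Set ℂ, IsConnected C →
      (C ∩ K).Nonempty →
      (∀ x ∈ C, ∀ y ∈ C, dist x y < δ) → f '' C ⊆ Y →
      (∀ w ∈ Y, ∃ v ∈ f '' C, dist w v < η) →
      (∀ c, deriv f c = 0 → HasLog Y (fun w => w - f c)) →
      ∃ σ : ℂ → ℂ, ContinuousOn σ Y ∧ (∀ w ∈ Y, f (σ w) = w) ∧ ∀ x ∈ C, σ (f x) = x) ?_ ?_ ?_ ?_
  · exact ⟨1, one_pos, 1, one_pos, fun C Y _ h => by simp at h⟩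
  · rintro s t hst ⟨δ, hδ, η, hη, h⟩
    exact ⟨δ, hδ, η, hη, fun C Y hC hCs => h C Y hC (hCs.mono (inter_subset_inter_right _ hst))⟩
  · rintro s t ⟨δ, hδ, η, hη, h⟩ ⟨δ', hδ', η', hη', h'⟩
    refine ⟨min δ δ', lt_min hδ hδ', min η η', lt_min hη hη', ?_⟩
    rintro C Y hC ⟨x, hx, hxs | hxt⟩ hd hCY hY hlog
    · refine h C Y hC ⟨x, hx, hxs⟩ (fun u hu v hv => (hd u hu v hv).trans_le (min_le_left _ _)) hCY
        (fun w hw => ?_) hlog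
      obtain ⟨v, hv, h2⟩ := hY w hw
      exact ⟨v, hv, h2.trans_le (min_le_left _ _)⟩
    · refine h' C Y hC ⟨x, hx, hxt⟩ (fun u hu v hv => (hd u hu v hv).trans_le (min_le_right _ _)) hCY
        (fun w hw => ?_) hlog
      obtain ⟨v, hv, h2⟩ := hY w hw
      exact ⟨v, hv, h2.trans_le (min_le_right _ _)⟩
  · intro c _
    obtain ⟨r, hr, ρ, hρ, h⟩ := loc_sec (hf c) hfc (hnc c)
    obtain ⟨r', hr', hrr⟩ := Metric.continuousAt_iff.1 (hf c).continuousAt (ρ / 2) (by positivity)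
    have hs : 0 < min r r' / 2 := by have := lt_min hr hr'; positivity
    refine ⟨Metric.ball c (min r r' / 2), mem_nhdsWithin_of_mem_nhds (Metric.ball_mem_nhds c hs),
      min r r' / 2, hs, ρ / 2, by positivity, ?_⟩
    rintro C Y hC ⟨x, hx, hxs⟩ hd hCY hY hlog
    have hCb : ∀ y ∈ C, dist y c < min r r' := fun y hy => by
      have h1 := hd y hy x hx
      rw [Metric.mem_ball] at hxs
      linarith [dist_triangle y x c]
    refine h C Y hC (fun y hy => (hCb y hy).trans_le (min_le_left _ _)) hCY (fun w hw => ?_)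
      (hlog c)
    obtain ⟨_, ⟨y, hy, rfl⟩, h2⟩ := hY w hw
    have h3 := hrr ((hCb y hy).trans_le (min_le_right _ _))
    rw [Metric.mem_ball]
    linarith [dist_triangle w (f y) (f c)]


theorem claim_one {K : Set ℂ} (hK : IsCompact K) (hKl : LCn K) (hKp : IsPreconnected K)
    {f : ℂ → ℂ} (hf : Continuous f) (hfK : f ⁻¹' K = K) {C : Set ℂ} (hC : IsCompact C)
    (cC : IsConnected C) (hCK : C ⊆ K) {S' : Finset ℂ} {Y : Set ℂ}
    (hY : Y = K \ ⋃ s ∈ S', connectedComponentIn (K \ f '' C) s)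
    {σ : ℂ → ℂ} (hσ : ContinuousOn σ Y) (hσ1 : ∀ w ∈ Y, f (σ w) = w) (hσ2 : ∀ x ∈ C, σ (f x) = x)
    (hloc : ∀ x, f x ∈ Y → ∃ M ∈ 𝓝 x, InjOn f M)
    {N : Set ℂ} (hN : IsOpen N) (hCN : C ⊆ N) (hNi : InjOn f N) {s : ℂ} (hs : s ∈ K \ C)
    (hsS : f s ∈ S') :
    ∃ s' ∈ S', (closure (f '' (connectedComponentIn (K \ C) s ∩ N) ∩
      connectedComponentIn (K \ f '' C) s') ∩ f '' C).Nonempty := by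
  by_contra hcon
  push Not at hcon
  set D := connectedComponentIn (K \ C) s with hD
  set C' := f '' C with hC'
  have hC'c : IsCompact C' := hC.image hf
  have hfK' : ∀ z, f z ∈ K ↔ z ∈ K := fun z => by
    rw [← mem_preimage, hfK]
  have hC'K : C' ⊆ K := by
    rintro _ ⟨x, hx, rfl⟩; exact (hfK' x).2 (hCK hx)
  have hDsub : D ⊆ K \ C := connectedComponentIn_subset _ _
  have hYmem : ∀ w, w ∈ Y ↔ w ∈ K ∧ ∀ s' ∈ S', w ∉ connectedComponentIn (K \ C') s' := by
    intro w; rw [hY]; simp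
  have hC'Y : C' ⊆ Y := fun w hw => (hYmem w).2 ⟨hC'K hw, fun s' _ h =>
    (connectedComponentIn_subset _ _ h).2 hw⟩
  have hYc : IsCompact Y := by
    choose U hU hUK using fun s => cc_relopen hKl hC'c.isClosed s
    have h2 : Y = K ∩ ⋂ s ∈ S', (U s)ᶜ := by
      ext w; rw [hYmem]
      simp only [hUK, mem_inter_iff, mem_iInter, mem_compl_iff]
      tauto
    rw [h2]
    exact hK.inter_right (isClosed_biInter fun s _ => (hU s).isClosed_compl)
  obtain ⟨c0, hc0D, hc0C⟩ := cc_closure_meets hKl hK.isClosed hKp hC.isClosed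
    (cC.nonempty.mono fun z hz => ⟨hCK hz, hz⟩) hs
  -- a point of D in the image of the section
  have hmeet : ∃ x ∈ D, x ∈ σ '' Y := by
    have hfc0 : f c0 ∈ C' := ⟨c0, hc0C, rfl⟩
    have hA : ∀ᶠ z in 𝓝 c0, ∀ s' ∈ S', f z ∉ closure (f '' (D ∩ N) ∩
        connectedComponentIn (K \ C') s') := by
      rw [Filter.eventually_all_finset]
      intro s' hs'
      refine hf.continuousAt.eventually (isClosed_closure.isOpen_compl.mem_nhds ?_)
      intro h
      have := hcon s' hs'
      exact (this ▸ (⟨h, hfc0⟩ : f c0 ∈ closure _ ∩ C') : f c0 ∈ (∅ : Set ℂ))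
    have hB : ∀ᶠ z in 𝓝 c0, f z ∈ Y → σ (f z) ∈ N := by
      have h1 : σ ⁻¹' N ∈ 𝓝[Y] (f c0) := by
        apply hσ _ (hC'Y hfc0)
        rw [hσ2 c0 hc0C]
        exact hN.mem_nhds (hCN hc0C)
      rw [mem_nhdsWithin_iff_eventually] at h1
      exact hf.continuousAt.eventually h1
    obtain ⟨x, ⟨⟨h1, h2⟩, h3⟩, hxD⟩ := mem_closure_iff_nhds.1 hc0D _
      (Filter.inter_mem (Filter.inter_mem hA hB) (hN.mem_nhds (hCN hc0C)))
    have hfY : f x ∈ Y := (hYmem _).2 ⟨(hfK' x).2 (hDsub hxD).1, fun s' hs' h =>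
      h1 s' hs' (subset_closure ⟨⟨x, ⟨hxD, h3⟩, rfl⟩, h⟩)⟩
    exact ⟨x, hxD, f x, hfY, hNi (h2 hfY) h3 (hσ1 _ hfY)⟩
  -- relative openness
  have hopen : ∀ x ∈ σ '' Y \ C, ∃ U, IsOpen U ∧ x ∈ U ∧ U ∩ K ⊆ σ '' Y := by
    rintro x ⟨⟨w, hw, rfl⟩, hxC⟩
    have hwC : w ∉ C' := by
      rintro ⟨c, hc, rfl⟩
      exact hxC (by rw [hσ2 c hc]; exact hc)
    have hfw : f (σ w) = w := hσ1 w hw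
    obtain ⟨M, hM, hMi⟩ := hloc (σ w) (by rw [hfw]; exact hw)
    obtain ⟨Uw, hUw, hUwK⟩ := cc_relopen hKl hC'c.isClosed w
    have hwK : w ∈ K \ C' := ⟨((hYmem w).1 hw).1, hwC⟩
    have hwUw : w ∈ Uw := by
      have := mem_connectedComponentIn hwK
      rw [hUwK] at this; exact this.1
    have h1 : σ ⁻¹' M ∈ 𝓝[Y] w := hσ w hw hM
    rw [mem_nhdsWithin_iff_eventually] at h1
    have h2 : ∀ᶠ z in 𝓝 (σ w), (f z ∈ Y → σ (f z) ∈ M) ∧ f z ∈ Uw ∧ z ∈ M := by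
      refine Filter.Eventually.and ?_ (Filter.Eventually.and ?_ hM)
      · have := hf.continuousAt (x := σ w)
        rw [ContinuousAt, hfw] at this
        exact this.eventually h1
      · have := hf.continuousAt (x := σ w)
        rw [ContinuousAt, hfw] at this
        exact this.eventually (hUw.mem_nhds hwUw)
    obtain ⟨U, hU, hUo, hxU⟩ := eventually_nhds_iff.1 h2
    refine ⟨U, hUo, hxU, ?_⟩
    rintro z ⟨hzU, hzK⟩
    obtain ⟨g1, g2, g3⟩ := hU z hzU
    have hfzK : f z ∈ K := (hfK' z).2 hzK
    have hfz : f z ∈ connectedComponentIn (K \ C') w := by rw [hUwK]; exact ⟨g2, hfzK⟩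
    have hfY : f z ∈ Y := (hYmem _).2 ⟨hfzK, fun s' hs' h => by
      have e1 := connectedComponentIn_eq h
      have e2 := connectedComponentIn_eq hfz
      have := mem_connectedComponentIn hwK
      rw [e2, ← e1] at this
      exact ((hYmem w).1 hw).2 s' hs' this⟩
    exact ⟨f z, hfY, hMi (g1 hfY) g3 (hσ1 _ hfY)⟩
  choose! U hU hxU hUK using hopen
  have hDσ : D ⊆ σ '' Y := by
    have hDp : IsPreconnected D := isPreconnected_connectedComponentIn
    by_contra hno
    obtain ⟨z, hzD, hz⟩ := Set.not_subset.1 hno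
    obtain ⟨x, hxD, hx⟩ := hmeet
    have hcl : IsClosed (σ '' Y) := (hYc.image_of_continuousOn hσ).isClosed
    obtain ⟨v, hvD, hvU, hv⟩ := hDp (⋃ x ∈ σ '' Y \ C, U x) (σ '' Y)ᶜ
      (isOpen_biUnion hU) hcl.isOpen_compl (by
        intro v hv
        by_cases h : v ∈ σ '' Y
        · exact Or.inl (mem_iUnion₂.2 ⟨v, ⟨h, (hDsub hv).2⟩, hxU v ⟨h, (hDsub hv).2⟩⟩)
        · exact Or.inr h)
      ⟨x, hxD, mem_iUnion₂.2 ⟨x, ⟨hx, (hDsub hxD).2⟩, hxU x ⟨hx, (hDsub hxD).2⟩⟩⟩ ⟨z, hzD, hz⟩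
    obtain ⟨y, hy, hvy⟩ := mem_iUnion₂.1 hvU
    exact hv (hUK y hy ⟨hvy, (hDsub hvD).1⟩)
  obtain ⟨w, hw, hws⟩ := hDσ (mem_connectedComponentIn hs)
  have hfs : f s = w := by rw [← hws, hσ1 w hw]
  have hwC : w ∉ C' := by
    rintro ⟨c, hc, rfl⟩
    rw [hσ2 c hc] at hws
    exact hs.2 (hws ▸ hc)
  exact ((hYmem w).1 hw).2 w (hfs ▸ hsS) (mem_connectedComponentIn ⟨((hYmem w).1 hw).1, hwC⟩)

theorem int_close {a b : ℤ} (h : ‖(a : ℂ) * (2 * Real.pi * Complex.I) - b * (2 * Real.pi * Complex.I)‖ < 1) :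
    a = b := by
  have h1 : (a : ℂ) * (2 * Real.pi * Complex.I) - b * (2 * Real.pi * Complex.I) =
      ((a - b : ℤ) : ℂ) * (2 * Real.pi * Complex.I) := by push_cast; ring
  rw [h1, norm_mul, Complex.norm_intCast] at h
  have h2 : ‖(2 * Real.pi * Complex.I : ℂ)‖ = 2 * Real.pi := by
    simp [abs_of_pos Real.pi_pos]
  rw [h2] at h
  by_contra hne
  have h3 : (1 : ℝ) ≤ |((a - b : ℤ) : ℝ)| := by
    exact_mod_cast Int.one_le_abs (sub_ne_zero.2 hne)
  have := Real.pi_gt_three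
  nlinarith

theorem claim_two {K : Set ℂ} (hK : IsCompact K) (hKc : IsPreconnected Kᶜ) (hKl : LCn K)
    {f : ℂ → ℂ} (hf : Continuous f) (hfo : IsOpenMap f) (hfK : f ⁻¹' K = K) {C : Set ℂ}
    (hC : IsCompact C) (cC : IsConnected C) (hCK : C ⊆ K)
    {N : Set ℂ} (hN : IsOpen N) (hCN : C ⊆ N) (hNi : InjOn f N) {x₁ x₂ y : ℂ}
    (hne : connectedComponentIn (K \ C) x₁ ≠ connectedComponentIn (K \ C) x₂)
    (h1 : (closure (f '' (connectedComponentIn (K \ C) x₁ ∩ N) ∩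
      connectedComponentIn (K \ f '' C) y) ∩ f '' C).Nonempty)
    (h2 : (closure (f '' (connectedComponentIn (K \ C) x₂ ∩ N) ∩
      connectedComponentIn (K \ f '' C) y) ∩ f '' C).Nonempty) : False := by
  classical
  set D1 := connectedComponentIn (K \ C) x₁ with hD1
  set D2 := connectedComponentIn (K \ C) x₂ with hD2
  set C' := f '' C with hC'
  set D' := connectedComponentIn (K \ C') y with hD'
  set Q1 := f '' (D1 ∩ N) with hQ1
  have hC'c : IsCompact C' := hC.image hf
  have hfK' : ∀ z, f z ∈ K ↔ z ∈ K := fun z => by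
    rw [← mem_preimage, hfK]
  have hC'K : C' ⊆ K := by
    rintro _ ⟨x, hx, rfl⟩; exact (hfK' x).2 (hCK hx)
  have hD'sub : D' ⊆ K \ C' := connectedComponentIn_subset _ _
  obtain ⟨U', hU', hU'K⟩ := cc_relopen hKl hC'c.isClosed y
  rw [← hD'] at hU'K
  obtain ⟨δ, hδ, hδN⟩ := hC'c.exists_cthickening_subset_open (hfo N hN) (image_mono hCN)
  obtain ⟨ρ, hρ0, hρ1, -⟩ := exists_continuous_zero_one_of_isClosed
    (s := (Metric.thickening δ C')ᶜ) (t := Metric.cthickening (δ / 2) C')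
    Metric.isOpen_thickening.isClosed_compl Metric.isClosed_cthickening (by
      rw [disjoint_compl_left_iff_subset]
      exact Metric.cthickening_subset_thickening' hδ (half_lt_self hδ) C')
  set u : ℂ → ℝ := fun w => if w ∈ Q1 ∩ D' then ρ w else 0 with hu
  have huc : ContinuousOn u D' := by
    intro w hw
    by_cases hwN : w ∈ f '' N
    · obtain ⟨x, hxN, rfl⟩ := hwN
      have hxK : x ∈ K \ C := ⟨(hfK' x).1 (hD'sub hw).1, fun h => (hD'sub hw).2 ⟨x, h, rfl⟩⟩
      obtain ⟨U, hU, hUK⟩ := cc_relopen hKl hC.isClosed x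
      have hxE := mem_connectedComponentIn hxK
      have hxU : x ∈ U := by rw [hUK] at hxE; exact hxE.1
      have hnh : f '' (U ∩ N) ∈ 𝓝[D'] (f x) := mem_nhdsWithin_of_mem_nhds
        ((hfo _ (hU.inter hN)).mem_nhds ⟨x, ⟨hxU, hxN⟩, rfl⟩)
      by_cases hE : x ∈ D1
      · have hED : D1 = connectedComponentIn (K \ C) x := connectedComponentIn_eq hE
        have key : ∀ w' ∈ f '' (U ∩ N) ∩ D', u w' = ρ w' := by
          rintro _ ⟨⟨x', hx', rfl⟩, hw'⟩
          refine if_pos ⟨⟨x', ⟨?_, hx'.2⟩, rfl⟩, hw'⟩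
          rw [hED, hUK]
          exact ⟨hx'.1, (hfK' x').1 (hD'sub hw').1⟩
        refine ρ.continuous.continuousWithinAt.congr_of_eventuallyEq ?_
          (key _ ⟨mem_of_mem_nhdsWithin hw hnh, hw⟩)
        filter_upwards [hnh, self_mem_nhdsWithin] with w' g1 g2 using key w' ⟨g1, g2⟩
      · have key : ∀ w' ∈ f '' (U ∩ N) ∩ D', u w' = 0 := by
          rintro _ ⟨⟨x', hx', rfl⟩, hw'⟩
          refine if_neg ?_
          rintro ⟨⟨z, hz, hzx⟩, -⟩
          have hzx' : z = x' := hNi hz.2 hx'.2 hzx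
          have hx'E : x' ∈ connectedComponentIn (K \ C) x := by
            rw [hUK]; exact ⟨hx'.1, (hfK' x').1 (hD'sub hw').1⟩
          have e1 := connectedComponentIn_eq hx'E
          have e2 : D1 = _ := connectedComponentIn_eq (hzx' ▸ hz.1)
          rw [e1, ← e2] at hxE
          exact hE hxE
        refine (continuousWithinAt_const (b := (0 : ℝ))).congr_of_eventuallyEq ?_
          (key _ ⟨mem_of_mem_nhdsWithin hw hnh, hw⟩)
        filter_upwards [hnh, self_mem_nhdsWithin] with w' g1 g2 using key w' ⟨g1, g2⟩
    · have hwt : w ∉ Metric.cthickening δ C' := fun h => hwN (hδN h)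
      have key : ∀ w' ∈ (Metric.cthickening δ C')ᶜ, u w' = 0 := by
        intro w' hw'
        have : ρ w' = 0 := hρ0 (fun h => hw' (Metric.thickening_subset_cthickening _ _ h))
        simp [hu, this]
      refine (continuousWithinAt_const (b := (0 : ℝ))).congr_of_eventuallyEq ?_ (key _ hwt)
      filter_upwards [mem_nhdsWithin_of_mem_nhds
        (Metric.isClosed_cthickening.isOpen_compl.mem_nhds hwt)] with w' g1 using key w' g1
  set T : ℂ := 2 * Real.pi * Complex.I with hT
  have hT1 : Complex.exp T = 1 := Complex.exp_two_pi_mul_I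
  have hnear : ∀ w ∈ Metric.thickening (δ / 2) C', Complex.exp (u w * T) = 1 := by
    intro w hw
    have : ρ w = 1 := hρ1 (Metric.thickening_subset_cthickening _ _ hw)
    simp only [hu]
    split_ifs
    · rw [this]; simpa using hT1
    · simp
  have hCt : C' ⊆ Metric.thickening (δ / 2) C' := Metric.self_subset_thickening (half_pos hδ) _
  have hh : ContinuousOn (fun w => Complex.exp (u w * T)) K := by
    intro w hw
    by_cases hwC : w ∈ C'
    · refine (continuousWithinAt_const (b := (1 : ℂ))).congr_of_eventuallyEq ?_
        (hnear w (hCt hwC))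
      filter_upwards [mem_nhdsWithin_of_mem_nhds
        (Metric.isOpen_thickening.mem_nhds (hCt hwC))] with w' g1 using hnear w' g1
    by_cases hwD : w ∈ D'
    · have hnh : D' ∈ 𝓝[K] w := by
        rw [hU'K] at hwD ⊢
        rw [inter_comm]
        exact inter_mem_nhdsWithin K (hU'.mem_nhds hwD.1)
      have : ContinuousWithinAt (fun w => Complex.exp (u w * T)) D' w :=
        (((Complex.continuous_ofReal.continuousAt.comp_continuousWithinAt (huc w hwD)).mul
          continuousWithinAt_const)).cexp
      exact this.mono_of_mem_nhdsWithin hnh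
    · obtain ⟨U, hU, hUK⟩ := cc_relopen hKl hC'c.isClosed w
      have hwE := mem_connectedComponentIn (show w ∈ K \ C' from ⟨hw, hwC⟩)
      have key : ∀ w' ∈ connectedComponentIn (K \ C') w, Complex.exp (u w' * T) = 1 := by
        intro w' hw'
        have : u w' = 0 := by
          refine if_neg ?_
          rintro ⟨-, h⟩
          have e1 := connectedComponentIn_eq hw'
          have e2 : D' = _ := connectedComponentIn_eq h
          rw [e1, ← e2] at hwE
          exact hwD hwE
        rw [this]; simp
      have hnh : connectedComponentIn (K \ C') w ∈ 𝓝[K] w := by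
        rw [hUK] at hwE ⊢
        rw [inter_comm]
        exact inter_mem_nhdsWithin K (hU.mem_nhds hwE.1)
      refine (continuousWithinAt_const (b := (1 : ℂ))).congr_of_eventuallyEq ?_ (key w hwE)
      filter_upwards [hnh] with w' g1 using key w' g1
  obtain ⟨L, hL, hLe⟩ := hasLog_of_connected_compl hK hKc hh fun z _ => Complex.exp_ne_zero _
  obtain ⟨n, hn⟩ := log_sub_const (E := D') isPreconnected_connectedComponentIn
    (hL.mono fun w hw => (hD'sub hw).1) (H := fun w => (u w : ℂ) * T)
    ((Complex.continuous_ofReal.comp_continuousOn huc).mul continuousOn_const)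
    (fun w hw => hLe w (hD'sub hw).1)
  obtain ⟨l, hl⟩ := log_sub_const (E := C') (cC.image f hf.continuousOn).isPreconnected
    (hL.mono hC'K) (H := fun w => 0) continuousOn_const
    (fun w hw => by rw [hLe w (hC'K hw), Complex.exp_zero]; exact hnear w (hCt hw))
  have hlim : ∀ (B : Set ℂ) (a : ℝ), B ⊆ D' → (closure B ∩ C').Nonempty →
      (∀ w ∈ B, w ∈ Metric.thickening (δ / 2) C' → u w = a) →
      ∃ w, L w = (a : ℂ) * T + n * T ∧ ‖L w - l * T‖ < 1 := by
    rintro B a hB ⟨c, hcB, hcC⟩ hBu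
    have h3 := hL c (hC'K hcC) (Metric.ball_mem_nhds _ one_pos)
    rw [Filter.mem_map, mem_nhdsWithin_iff_eventually] at h3
    obtain ⟨w, ⟨g1, g2⟩, g3⟩ := mem_closure_iff_nhds.1 hcB _
      (Filter.inter_mem h3 (Metric.isOpen_thickening.mem_nhds (hCt hcC)))
    refine ⟨w, ?_, ?_⟩
    · rw [hn w (hB g3), hBu w g3 g2]
    · have g4 := g1 (hD'sub (hB g3)).1
      rw [mem_preimage, mem_ball_iff_norm, hl c hcC, zero_add] at g4
      exact g4
  obtain ⟨w1, e1, b1⟩ := hlim _ 1 inter_subset_right h1 (fun w hw hwt => by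
    have : ρ w = 1 := hρ1 (Metric.thickening_subset_cthickening _ _ hwt)
    rw [← this]; exact if_pos hw)
  obtain ⟨w2, e2, b2⟩ := hlim _ 0 inter_subset_right h2 (fun w hw hwt => by
    refine if_neg ?_
    rintro ⟨⟨z, hz, hzw⟩, -⟩
    obtain ⟨z', hz', hzw'⟩ := hw.1
    have hzz : z = z' := hNi hz.2 hz'.2 (hzw.trans hzw'.symm)
    have g1 : D1 = _ := connectedComponentIn_eq hz.1
    have g2 : D2 = _ := connectedComponentIn_eq hz'.1
    exact hne (by rw [g1, g2, hzz]))
  have r1 : (1 + n : ℤ) = l := int_close (by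
    rw [e1, hT] at b1; push_cast at b1 ⊢; rw [add_mul]; exact b1)
  have r2 : n = l := int_close (by
    rw [e2, hT] at b2; simpa using b2)
  omega

open Classical in
theorem step_val {K : Set ℂ} (hK : IsCompact K) (hKc : IsPreconnected Kᶜ) (hKl : LCn K)
    (hKp : IsPreconnected K)
    {f : ℂ → ℂ} (hf : Continuous f) (hfo : IsOpenMap f) (hfK : f ⁻¹' K = K) {C : Set ℂ}
    (hC : IsCompact C) (cC : IsConnected C) (hCK : C ⊆ K) {S S' : Finset ℂ} (hS : ↑S ⊆ K)
    (hSS : ∀ s ∈ S, f s ∈ S') {Y : Set ℂ}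
    (hY : Y = K \ ⋃ s ∈ S', connectedComponentIn (K \ f '' C) s)
    {σ : ℂ → ℂ} (hσ : ContinuousOn σ Y) (hσ1 : ∀ w ∈ Y, f (σ w) = w) (hσ2 : ∀ x ∈ C, σ (f x) = x)
    (hloc : ∀ x, f x ∈ Y → ∃ M ∈ 𝓝 x, InjOn f M) :
    valc K C S ≤ valc K (f '' C) S' := by
  have hCY : ∀ x ∈ C, f x ∈ Y := fun x hx => by
    rw [hY]
    refine ⟨?_, ?_⟩
    · rw [← mem_preimage, hfK]; exact hCK hx
    · intro h
      obtain ⟨s, hs, h2⟩ := mem_iUnion₂.1 h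
      exact (connectedComponentIn_subset _ _ h2).2 ⟨x, hx, rfl⟩
  have hinj : InjOn f C := fun a ha b hb hab => by
    rw [← hσ2 a ha, ← hσ2 b hb, hab]
  obtain ⟨N, hN, hCN, hNi⟩ := hinj.exists_isOpen_superset hC
    (fun x _ => hf.continuousAt) (fun x hx => hloc x (hCY x hx))
  have key : ∀ D ∈ (S.filter (· ∉ C)).image (connectedComponentIn (K \ C) ·), ∃ D' ∈
      (S'.filter (· ∉ f '' C)).image (connectedComponentIn (K \ f '' C) ·),
      ∃ y, D' = connectedComponentIn (K \ f '' C) y ∧ (closure (f '' (D ∩ N) ∩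
      connectedComponentIn (K \ f '' C) y) ∩ f '' C).Nonempty := by
    intro D hD
    obtain ⟨s, hs, rfl⟩ := Finset.mem_image.1 hD
    obtain ⟨hs, hsC⟩ := Finset.mem_filter.1 hs
    obtain ⟨s', hs', h⟩ := claim_one hK hKl hKp hf hfK hC cC hCK hY hσ hσ1 hσ2 hloc hN hCN hNi
      ⟨hS hs, hsC⟩ (hSS s hs)
    refine ⟨_, Finset.mem_image_of_mem _ (Finset.mem_filter.2 ⟨hs', ?_⟩), s', rfl, h⟩
    obtain ⟨z, hz, -⟩ := h
    obtain ⟨w, hw⟩ := closure_nonempty_iff.1 ⟨z, hz⟩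
    exact (connectedComponentIn_nonempty_iff.1 ⟨w, hw.2⟩).2
  choose! F hF y hy hFy using key
  refine Finset.card_le_card_of_injOn F hF ?_
  intro D1 h1 D2 h2 h12
  by_contra hne
  have g1 := hFy D1 h1
  have g2 := hFy D2 h2
  rw [← hy D1 h1] at g1
  rw [← hy D2 h2, ← h12, hy D1 h1] at g2
  rw [hy D1 h1] at g1
  obtain ⟨x1, -, rfl⟩ := Finset.mem_image.1 h1
  obtain ⟨x2, -, rfl⟩ := Finset.mem_image.1 h2
  exact claim_two hK hKc hKl hf hfo hfK hC cC hCK hN hCN hNi hne g1 g2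


theorem rest_compact {K C : Set ℂ} (hK : IsCompact K) (hKl : LCn K) (hC : IsClosed C)
    (S : Finset ℂ) : IsCompact (K \ ⋃ s ∈ S, connectedComponentIn (K \ C) s) := by
  choose U hU hUK using fun s => cc_relopen hKl hC s
  have h2 : K \ ⋃ s ∈ S, connectedComponentIn (K \ C) s = K ∩ ⋂ s ∈ S, (U s)ᶜ := by
    ext w
    simp only [hUK, mem_inter_iff, mem_iInter, mem_compl_iff, mem_sdiff, mem_iUnion]
    grind
  rw [h2]
  exact hK.inter_right (isClosed_biInter fun s _ => (hU s).isClosed_compl)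

theorem hole_unique {K : Set ℂ} (hK : IsCompact K) (hKl : LCn K) (hKp : IsPreconnected K)
    {C C' : Set ℂ} (hC : IsClosed C) (cC : C.Nonempty) (hCJ : C ⊆ frontier K)
    (hCJ' : C' ⊆ frontier K) (hd : Disjoint C C') {v : ℂ} (hv : v ∈ K \ C) (hv' : v ∈ K \ C')
    (h : ¬ (connectedComponentIn (K \ C) v ∩ frontier K).Nonempty)
    (h' : ¬ (connectedComponentIn (K \ C') v ∩ frontier K).Nonempty) : False := by
  have hJK : frontier K ⊆ K := hK.isClosed.frontier_subset
  have hsub : ∀ A B : Set ℂ, B ⊆ frontier K → v ∈ K \ A →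
      ¬ (connectedComponentIn (K \ A) v ∩ frontier K).Nonempty →
      connectedComponentIn (K \ A) v ⊆ connectedComponentIn (K \ B) v := by
    intro A B hB hvA hn
    refine isPreconnected_connectedComponentIn.subset_connectedComponentIn
      (mem_connectedComponentIn hvA) fun z hz => ⟨(connectedComponentIn_subset _ _ hz).1, fun hzB =>
        hn ⟨z, hz, hB hzB⟩⟩
  have h1 := hsub C C' hCJ' hv h
  have h2 := hsub C' C hCJ hv' h'
  obtain ⟨c, hc⟩ := cC
  obtain ⟨w, hw, hwC⟩ := cc_closure_meets hKl hK.isClosed hKp hC ⟨c, hJK (hCJ hc), hc⟩ hv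
  have h3 : IsPreconnected (insert w (connectedComponentIn (K \ C) v)) :=
    isPreconnected_connectedComponentIn.subset_closure (subset_insert _ _)
      (insert_subset hw subset_closure)
  have h4 : insert w (connectedComponentIn (K \ C) v) ⊆ connectedComponentIn (K \ C') v := by
    refine h3.subset_connectedComponentIn (Or.inr (mem_connectedComponentIn hv)) ?_
    refine insert_subset ⟨hJK (hCJ hwC), Set.disjoint_left.1 hd hwC⟩ ?_
    exact h1.trans (connectedComponentIn_subset _ _)
  exact (connectedComponentIn_subset _ _ (h2 (h4 (mem_insert _ _)))).2 hwC

theorem unbounded_compl {K : Set ℂ} (hK : IsCompact K) : ¬ Bornology.IsBounded Kᶜ := by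
  intro h
  have h2 := h.union hK.isBounded
  rw [compl_union_self] at h2
  exact NormedSpace.unbounded_univ ℂ ℂ h2

theorem step_poly {p : Polynomial ℂ} {f : ℂ → ℂ} (hd : 2 ≤ p.natDegree)
    (hf : ∀ z, f z = p.eval z) {K : Set ℂ} (hKf : K = filledJulia f) (hKl : LCn K)
    (hKp : IsPreconnected K) {δ η : ℝ}
    (hsec : ∀ C Y : Set ℂ, IsConnected C → (C ∩ K).Nonempty →
      (∀ x ∈ C, ∀ y ∈ C, dist x y < δ) → f '' C ⊆ Y →
      (∀ w ∈ Y, ∃ v ∈ f '' C, dist w v < η) →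
      (∀ c, deriv f c = 0 → HasLog Y (fun w => w - f c)) →
      ∃ σ : ℂ → ℂ, ContinuousOn σ Y ∧ (∀ w ∈ Y, f (σ w) = w) ∧ ∀ x ∈ C, σ (f x) = x)
    (hη : 0 < η)
    {Z : Finset ℂ} (hZ : ∀ (C : Set ℂ) (w : ℂ), w ∈ K \ C →
      (∀ z ∈ Z, z ∉ connectedComponentIn (K \ C) w) → ∃ c ∈ C, dist w c < η)
    {C : Set ℂ} (hC : IsCompact C) (cC : IsConnected C) (hCK : C ⊆ K)
    (hdiam : ∀ x ∈ C, ∀ y ∈ C, dist x y < δ)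
    {S S' : Finset ℂ} (hS : ↑S ⊆ K) (hSS : ∀ s ∈ S, f s ∈ S') (hZS : Z ⊆ S')
    (hcv : ∀ c, deriv f c = 0 → f c ∉ f '' C ∧ (f c ∈ K → f c ∈ S' ∧
      (connectedComponentIn (K \ f '' C) (f c) ∩ frontier K).Nonempty)) :
    valc K C S ≤ valc K (f '' C) S' := by
  have hfc : Continuous f := poly_cont hf
  have hK : IsCompact K := hKf ▸ filled_compact hd hf
  have hKc : IsConnected Kᶜ := hKf ▸ basin_connected hd hf
  have hfK : f ⁻¹' K = K := by rw [hKf]; exact filled_preimage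
  have hC'c : IsCompact (f '' C) := hC.image hfc
  have hC'K : f '' C ⊆ K := by
    rintro _ ⟨x, hx, rfl⟩
    rw [← mem_preimage, hfK]; exact hCK hx
  have hYc := rest_compact hK hKl hC'c.isClosed S'
  set Y := K \ ⋃ s ∈ S', connectedComponentIn (K \ f '' C) s with hY
  have hYmem : ∀ w, w ∈ Y ↔ w ∈ K ∧ ∀ s' ∈ S', w ∉ connectedComponentIn (K \ f '' C) s' := by
    intro w; rw [hY]; simp
  have hCY : f '' C ⊆ Y := fun w hw => (hYmem w).2 ⟨hC'K hw, fun s _ h =>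
    (connectedComponentIn_subset _ _ h).2 hw⟩
  have hlog : ∀ c, deriv f c = 0 → HasLog Y (fun w => w - f c) := by
    intro c hc
    obtain ⟨g1, g2⟩ := hcv c hc
    by_cases hcK : f c ∈ K
    · obtain ⟨g3, j, hjD, hjJ⟩ := g2 hcK
      have hfcD := mem_connectedComponentIn (show f c ∈ K \ f '' C from ⟨hcK, g1⟩)
      have hA1 : IsPreconnected (insert j Kᶜ) := hKc.isPreconnected.subset_closure
        (subset_insert _ _) (insert_subset (frontier_sub_closure_compl K hjJ) subset_closure)
      have hA := hA1.union j (mem_insert _ _) hjD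
        (isPreconnected_connectedComponentIn (F := K \ f '' C) (x := f c))
      refine hasLog_unbounded hYc hA ?_ ?_ (Or.inr hfcD)
      · rw [Set.disjoint_left]
        rintro z ((rfl | hz) | hz) hzY
        · exact ((hYmem _).1 hzY).2 _ g3 hjD
        · exact hz ((hYmem _).1 hzY).1
        · exact ((hYmem _).1 hzY).2 _ g3 hz
      · intro hb
        exact unbounded_compl hK (hb.subset fun z hz => Or.inl (Or.inr hz))
    · refine hasLog_unbounded hYc hKc.isPreconnected ?_ (unbounded_compl hK) hcK
      rw [Set.disjoint_left]
      exact fun z hz hzY => hz ((hYmem _).1 hzY).1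
  obtain ⟨x0, hx0⟩ := cC.nonempty
  obtain ⟨σ, hσ, hσ1, hσ2⟩ := hsec C Y cC ⟨x0, hx0, hCK hx0⟩ hdiam hCY (by
    intro w hw
    by_cases hwC : w ∈ f '' C
    · exact ⟨w, hwC, by rw [dist_self]; exact hη⟩
    · refine hZ _ w ⟨((hYmem w).1 hw).1, hwC⟩ fun z hz hzw => ?_
      have e := connectedComponentIn_eq hzw
      have := mem_connectedComponentIn (show w ∈ K \ f '' C from ⟨((hYmem w).1 hw).1, hwC⟩)
      rw [e] at this
      exact ((hYmem w).1 hw).2 z (hZS hz) this) hlog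
  refine step_val hK hKc.isPreconnected hKl hKp hfc (poly_open hd hf) hfK hC cC hCK hS hSS hY hσ
    hσ1 hσ2 ?_
  intro x hx
  have hder : deriv f x ≠ 0 := fun h => by
    have := (hlog x h).ne_zero hx
    simp at this
  have han : AnalyticAt ℂ f x := (poly_diff hf).analyticAt x
  obtain ⟨e, he, hxe⟩ := loc_homeo han.hasStrictDerivAt hder
  exact ⟨e.source, e.open_source.mem_nhds hxe, he ▸ e.injOn⟩

theorem fiber_finite {p : Polynomial ℂ} {f : ℂ → ℂ} (hd : 2 ≤ p.natDegree)
    (hf : ∀ z, f z = p.eval z) (y : ℂ) : {z | f z = y}.Finite := by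
  have hne : p - Polynomial.C y ≠ 0 := by
    intro h
    rw [sub_eq_zero] at h
    rw [h, Polynomial.natDegree_C] at hd
    omega
  refine ((p - Polynomial.C y).rootSet_finite ℂ).subset fun z hz => ?_
  rw [Polynomial.mem_rootSet]
  refine ⟨hne, ?_⟩
  have : p.eval z = y := by rw [← hf]; exact hz
  simp [this]

theorem not_loc_const {p : Polynomial ℂ} {f : ℂ → ℂ} (hd : 2 ≤ p.natDegree)
    (hf : ∀ z, f z = p.eval z) (c : ℂ) : ¬ ∀ᶠ z in 𝓝 c, f z = f c := by
  intro h
  exact (infinite_of_mem_nhds c h) (fiber_finite hd hf (f c))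

theorem crit_finite {p : Polynomial ℂ} {f : ℂ → ℂ} (hd : 2 ≤ p.natDegree)
    (hf : ∀ z, f z = p.eval z) : {c | deriv f c = 0}.Finite := by
  have hfe : f = fun z => p.eval z := funext hf
  have hne : p.derivative ≠ 0 := by
    intro h
    have := Polynomial.derivative_eq_zero.1 h
    omega
  refine (p.derivative.rootSet_finite ℂ).subset fun z hz => ?_
  rw [Polynomial.mem_rootSet]
  refine ⟨hne, ?_⟩
  have h2 : deriv f z = 0 := hz
  rw [hfe, Polynomial.deriv] at h2
  simpa using h2

theorem image_nontrivial {p : Polynomial ℂ} {f : ℂ → ℂ} (hd : 2 ≤ p.natDegree)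
    (hf : ∀ z, f z = p.eval z) {C : Set ℂ} (cC : IsPreconnected C) (hC : C.Nontrivial) :
    (f '' C).Nontrivial := by
  by_contra h
  rw [Set.not_nontrivial_iff] at h
  obtain ⟨x, hx⟩ := hC.nonempty
  refine (cC.infinite_of_nontrivial hC) ((fiber_finite hd hf (f x)).subset fun z hz => ?_)
  exact h ⟨z, hz, rfl⟩ ⟨x, hx, rfl⟩

theorem eventually_not_of_unique {P : ℕ → Prop} (h : ∀ m n, m ≠ n → P m → P n → False) :
    ∃ N, ∀ n ≥ N, ¬ P n := by
  by_cases hP : ∃ m, P m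
  · obtain ⟨m, hm⟩ := hP
    exact ⟨m + 1, fun n hn hPn => h m n (by omega) hm hPn⟩
  · push Not at hP
    exact ⟨0, fun n _ => hP n⟩

open Classical in
theorem valc_mono {K C : Set ℂ} {S T : Finset ℂ} (h : S ⊆ T) : valc K C S ≤ valc K C T :=
  Finset.card_le_card (Finset.image_subset_image (Finset.filter_subset_filter _ h))


theorem no_wandering_continua (p : Polynomial ℂ) (d : ℕ) (hd : 2 ≤ d)
    (hdeg : p.natDegree = d) (f : ℂ → ℂ) (hf : ∀ z, f z = p.eval z)
    (J : Set ℂ) (hJ : J = frontier (filledJulia f))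
    (hJconn : IsConnected J) (hJlc : LocallyConnectedSpace J)
    (C : Set ℂ) (hCJ : C ⊆ J) (hCcomp : IsCompact C) (hCconn : IsConnected C)
    (hC2 : ∃ x ∈ C, ∃ y ∈ C, x ≠ y) :
    ∃ m n : ℕ, m ≠ n ∧ (f^[m] '' C ∩ f^[n] '' C).Nonempty := by
  classical
  by_contra hcon
  push Not at hcon
  have hd2 : 2 ≤ p.natDegree := hdeg ▸ hd
  have hJl : LCn (frontier (filledJulia f)) := hJ ▸ lcn_of_lc hJlc
  have hK : IsCompact (filledJulia f) := filled_compact hd2 hf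
  have hKc : IsConnected (filledJulia f)ᶜ := basin_connected hd2 hf
  have hKl : LCn (filledJulia f) := filled_lcn hK.isClosed hJl
  have hKp : IsPreconnected (filledJulia f) :=
    (filled_conn hK.isClosed (hJ ▸ hJconn)).isPreconnected
  have hfc : Continuous f := poly_cont hf
  have hJpre : f ⁻¹' J = J := by rw [hJ]; exact julia_preimage hd2 hf
  have hKpre : f ⁻¹' filledJulia f = filledJulia f := filled_preimage
  have hJK : J ⊆ filledJulia f := hJ ▸ hK.isClosed.frontier_subset
  have hJit : ∀ n z, f^[n] z ∈ J ↔ z ∈ J := by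
    intro n
    induction n with
    | zero => intro z; rfl
    | succ n ih => intro z; rw [iterate_succ_apply, ih, ← mem_preimage, hJpre]
  have hKit : ∀ n z, z ∈ filledJulia f → f^[n] z ∈ filledJulia f := by
    intro n
    induction n with
    | zero => intro z hz; exact hz
    | succ n ih =>
      intro z hz
      rw [iterate_succ_apply]
      exact ih _ (by rw [← mem_preimage, hKpre]; exact hz)
  -- the orbit of the continuum
  have hA1 : ∀ n, IsCompact (f^[n] '' C) := fun n => hCcomp.image (hfc.iterate n)
  have hA2 : ∀ n, IsConnected (f^[n] '' C) := fun n => hCconn.image _ (hfc.iterate n).continuousOn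
  have hA3 : ∀ n, f^[n] '' C ⊆ J := by
    rintro n _ ⟨x, hx, rfl⟩
    exact (hJit n x).2 (hCJ hx)
  have hA4 : ∀ m n, m ≠ n → Disjoint (f^[m] '' C) (f^[n] '' C) := fun m n hmn =>
    Set.disjoint_iff_inter_eq_empty.2 (hcon m n hmn)
  have himg : ∀ n, f '' (f^[n] '' C) = f^[n + 1] '' C := fun n => by
    rw [image_image]; simp only [iterate_succ_apply']
  have hA5 : ∀ n, (f^[n] '' C).Nontrivial := by
    intro n
    induction n with
    | zero =>
      obtain ⟨x, hx, y, hy, hxy⟩ := hC2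
      simpa using ⟨x, hx, y, hy, hxy⟩
    | succ n ih => rw [← himg]; exact image_nontrivial hd2 hf (hA2 n).isPreconnected ih
  -- uniform constants
  obtain ⟨δ, hδ, η, hη, hsec⟩ := unif_sec (fun c => (poly_diff hf).analyticAt c)
    (not_loc_const hd2 hf) hK
  obtain ⟨Z, hZK, hZ⟩ := lemZ hK hKl hη
  obtain ⟨N1, hN1⟩ := nullity hK hKc hJl hA1 (fun n => (hA2 n).isPreconnected)
    (fun n => hJ ▸ hA3 n) hA4 hδ
  set CP : Finset ℂ := (crit_finite hd2 hf).toFinset with hCP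
  have hCPm : ∀ c, c ∈ CP ↔ deriv f c = 0 := fun c => by simp [hCP]
  have hgood : ∀ c, ∃ N, ∀ n ≥ N, f c ∉ f^[n] '' C ∧ (f c ∈ filledJulia f →
      (connectedComponentIn (filledJulia f \ f^[n] '' C) (f c) ∩
        frontier (filledJulia f)).Nonempty) := by
    intro c
    obtain ⟨M1, hM1⟩ := eventually_not_of_unique (P := fun n => f c ∈ f^[n] '' C)
      (fun m n hmn h1 h2 => Set.disjoint_left.1 (hA4 m n hmn) h1 h2)
    obtain ⟨M2, hM2⟩ := eventually_not_of_unique (P := fun n =>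
      f c ∈ filledJulia f \ f^[n] '' C ∧
      ¬ (connectedComponentIn (filledJulia f \ f^[n] '' C) (f c) ∩
        frontier (filledJulia f)).Nonempty)
      (fun m n hmn h1 h2 => hole_unique hK hKl hKp (hA1 m).isClosed (hA2 m).nonempty
        (hJ ▸ hA3 m) (hJ ▸ hA3 n) (hA4 m n hmn) h1.1 h2.1 h1.2 h2.2)
    refine ⟨max M1 M2, fun n hn => ?_⟩
    have g1 := hM1 n ((le_max_left _ _).trans hn)
    refine ⟨g1, fun hcK => ?_⟩
    have g2 := hM2 n ((le_max_right _ _).trans hn)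
    by_contra h
    exact g2 ⟨⟨hcK, g1⟩, h⟩
  choose N2 hN2 using hgood
  set n0 := max N1 (CP.sup N2) with hn0
  set E : ℕ → Set ℂ := fun i => f^[n0 + i] '' C with hE
  have hEi : ∀ i, f '' E i = E (i + 1) := fun i => himg (n0 + i)
  -- empty interior
  have hno : ∀ W : Set ℂ, IsOpen W → (W ∩ frontier (filledJulia f)).Nonempty →
      ¬ (W ∩ frontier (filledJulia f) ⊆ E 0) := by
    intro W hW hWJ hsub
    obtain ⟨a, ha, b, hb, hab⟩ := hA5 n0
    obtain ⟨n, h⟩ := lemE hd2 hf hW hWJ hab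
    have key : ∀ c ∈ f^[n0] '' C, c ∉ f^[n + 1] '' W := by
      rintro c hc ⟨w, hw, rfl⟩
      have hwJ : w ∈ J := (hJit (n + 1) w).1 (hA3 n0 hc)
      obtain ⟨x, hx, hxw⟩ := hsub ⟨hw, hJ ▸ hwJ⟩
      refine Set.disjoint_left.1 (hA4 n0 (n + 1 + n0) (by omega)) hc ⟨x, hx, ?_⟩
      rw [← hxw, ← iterate_add_apply, add_zero]
    rcases h with h | h
    · exact key a ha h
    · exact key b hb h
  -- the marked points
  obtain ⟨a, haC, b, hbC, hab⟩ := hC2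
  set Q : Finset ℂ := Z ∪ (CP.image f).filter (· ∈ filledJulia f) ∪ {a, b} with hQ
  have hQK : ∀ q ∈ Q, q ∈ filledJulia f := by
    intro q hq
    rw [hQ, Finset.mem_union, Finset.mem_union] at hq
    rcases hq with (hq | hq) | hq
    · exact hZK hq
    · exact (Finset.mem_filter.1 hq).2
    · rcases Finset.mem_insert.1 hq with rfl | hq
      · exact hJK (hCJ haC)
      · rw [Finset.mem_singleton.1 hq]; exact hJK (hCJ hbC)
  have hZQ : Z ⊆ Q := fun z hz => by rw [hQ]; simp [hz]
  have haQ : a ∈ Q := by rw [hQ]; simp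
  have hbQ : b ∈ Q := by rw [hQ]; simp
  have hcQ : ∀ c, deriv f c = 0 → f c ∈ filledJulia f → f c ∈ Q := by
    intro c hc hcK
    rw [hQ, Finset.mem_union, Finset.mem_union]
    exact Or.inl (Or.inr (Finset.mem_filter.2 ⟨Finset.mem_image_of_mem f ((hCPm c).2 hc), hcK⟩))
  obtain ⟨T, hTc, hTJ, hTi⟩ := many_comps hK hKc hKl hJl (C := E 0) (hA1 _) (hA2 _)
    (hJ ▸ hA3 _) (hA5 _) hno (Q.card + 3)
  have hsel : ∀ t : ℂ, ∃ s n, t ∈ T → s ∈ J ∧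
      s ∈ connectedComponentIn (filledJulia f \ E 0) t ∧ f^[n + 1] s ∈ Q := by
    intro t
    by_cases ht : t ∈ T
    · obtain ⟨U, hU, hUK⟩ := cc_relopen hKl (hA1 (n0 + 0)).isClosed t
      have htJ := hTJ t ht
      have htU : t ∈ U := by
        have := mem_connectedComponentIn (show t ∈ filledJulia f \ E 0 from
          ⟨hJK (hJ ▸ htJ.1), htJ.2⟩)
        rw [hUK] at this; exact this.1
      obtain ⟨n, h⟩ := lemE hd2 hf hU ⟨t, htU, htJ.1⟩ hab
      have key : ∀ c ∈ C, c ∈ Q → c ∈ f^[n + 1] '' U → ∃ s, s ∈ J ∧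
          s ∈ connectedComponentIn (filledJulia f \ E 0) t ∧ f^[n + 1] s ∈ Q := by
        rintro c hc hcQ ⟨s, hs, rfl⟩
        have hsJ : s ∈ J := (hJit (n + 1) s).1 (hCJ hc)
        exact ⟨s, hsJ, by rw [hUK]; exact ⟨hs, hJK hsJ⟩, hcQ⟩
      rcases h with h | h
      · obtain ⟨s, hs⟩ := key a haC haQ h
        exact ⟨s, n, fun _ => hs⟩
      · obtain ⟨s, hs⟩ := key b hbC hbQ h
        exact ⟨s, n, fun _ => hs⟩
    · exact ⟨0, 0, fun h => absurd h ht⟩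
  choose s ν hsν using hsel
  set R : Finset ℂ := T.biUnion fun t => (Finset.range (ν t + 1)).image fun i => f^[i] (s t) with hR
  set S : ℕ → Finset ℂ := fun n => R ∪ (Finset.range (n + 1)).biUnion fun l => Q.image f^[l] with hS
  have hSmono : ∀ m n, m ≤ n → S m ⊆ S n := by
    intro m n hmn
    refine Finset.union_subset_union_right (Finset.biUnion_subset_biUnion_of_subset_left _ ?_)
    exact Finset.range_mono (by omega)
  have hQS : ∀ n, Q ⊆ S n := by
    intro n q hq
    refine Finset.mem_union_right _ (Finset.mem_biUnion.2 ⟨0, by simp, ?_⟩)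
    exact Finset.mem_image.2 ⟨q, hq, rfl⟩
  have hSK : ∀ n, (↑(S n) : Set ℂ) ⊆ filledJulia f := by
    intro n z hz
    rcases Finset.mem_union.1 hz with hz | hz
    · obtain ⟨t, ht, hz⟩ := Finset.mem_biUnion.1 hz
      obtain ⟨i, -, rfl⟩ := Finset.mem_image.1 hz
      exact hKit i _ (hJK (hsν t ht).1)
    · obtain ⟨l, -, hz⟩ := Finset.mem_biUnion.1 hz
      obtain ⟨q, hq, rfl⟩ := Finset.mem_image.1 hz
      exact hKit l q (hQK q hq)
  have hSf : ∀ n, ∀ z ∈ S n, f z ∈ S (n + 1) := by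
    intro n z hz
    rcases Finset.mem_union.1 hz with hz | hz
    · obtain ⟨t, ht, hz⟩ := Finset.mem_biUnion.1 hz
      obtain ⟨i, hi, rfl⟩ := Finset.mem_image.1 hz
      rw [← iterate_succ_apply' f]
      have hi2 := Finset.mem_range.1 hi
      by_cases h : i = ν t
      · rw [h]; exact hQS _ (hsν t ht).2.2
      · exact Finset.mem_union_left _ (Finset.mem_biUnion.2 ⟨t, ht, Finset.mem_image.2
          ⟨i + 1, Finset.mem_range.2 (by omega), rfl⟩⟩)
    · obtain ⟨l, hl, hz⟩ := Finset.mem_biUnion.1 hz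
      obtain ⟨q, hq, rfl⟩ := Finset.mem_image.1 hz
      rw [← iterate_succ_apply' f]
      have hl2 := Finset.mem_range.1 hl
      exact Finset.mem_union_right _ (Finset.mem_biUnion.2 ⟨l + 1, Finset.mem_range.2 (by omega),
        Finset.mem_image.2 ⟨q, hq, rfl⟩⟩)
  have hScard : ∀ n, (S n).card ≤ R.card + (n + 1) * Q.card := by
    intro n
    refine (Finset.card_union_le _ _).trans (Nat.add_le_add_left ?_ _)
    refine (Finset.card_biUnion_le_card_mul _ _ Q.card fun l _ => Finset.card_image_le).trans ?_
    rw [Finset.card_range]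
  -- the valence is propagated
  have hval : ∀ i, Q.card + 3 ≤ valc (filledJulia f) (E i) (S i) := by
    intro i
    induction i with
    | zero =>
      rw [← hTc]
      refine Finset.card_le_card_of_injOn
        (fun t => connectedComponentIn (filledJulia f \ E 0) (s t)) ?_ ?_
      · intro t ht
        refine Finset.mem_image_of_mem _ (Finset.mem_filter.2 ⟨?_, ?_⟩)
        · exact Finset.mem_union_left _ (Finset.mem_biUnion.2 ⟨t, ht, Finset.mem_image.2
            ⟨0, by simp, rfl⟩⟩)
        · exact (connectedComponentIn_subset _ _ (hsν t ht).2.1).2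
      · intro t ht t' ht' h
        apply hTi t ht t' ht'
        rw [connectedComponentIn_eq (hsν t ht).2.1, connectedComponentIn_eq (hsν t' ht').2.1]
        exact h
    | succ i ih =>
      refine ih.trans ?_
      rw [← hEi]
      refine step_poly hd2 hf rfl hKl hKp hsec hη hZ (hA1 _) (hA2 _) ((hA3 _).trans hJK)
        (hN1 _ ((le_max_left _ _).trans (Nat.le_add_right _ _))) (hSK i) (hSf i)
        (hZQ.trans (hQS _)) ?_
      intro c hc
      have h1 : N2 c ≤ n0 + (i + 1) :=
        ((Finset.le_sup (f := N2) ((hCPm c).2 hc)).trans (le_max_right _ _)).trans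
          (Nat.le_add_right _ _)
      obtain ⟨g1, g2⟩ := hN2 c _ h1
      rw [hEi]
      exact ⟨g1, fun hcK => ⟨hQS _ (hcQ c hc hcK), g2 hcK⟩⟩
  have hfin := count_main hKl hK.isClosed hKp (C := E) (fun i => (hA1 _).isClosed)
    (fun i => hA2 _) (fun i => (hA3 _).trans hJK)
    (fun i j hij => hA4 _ _ (by omega)) (Q.card + 1) R.card (Finset.range (R.card + 1))
    (Finset.card_range _) (S R.card) (hSK _) (fun i hi => by
      have hi2 := Finset.mem_range.1 hi
      exact (hval i).trans (valc_mono (hSmono i _ (by omega))))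
  have h2 := hScard R.card
  have h3 : (R.card + 1) * (Q.card + 1) = (R.card + 1) * Q.card + R.card + 1 := by ring
  omega
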